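/- Let G be a finite group and let s be a positive integer that is either a prime power or square-free, and let π = π(s). Then vcs(G) = {s} if and only if G = NH, where N is a normal Hall π-subgroup of G and H is an abelian π-complement of G, and one of the following occurs: (a) s is a prime power, H centralizes N (so that G = N × H internally), and cs(N) = {1, s}; (b) G/Z(G) is a Frobenius group with kernel NZ(G)/Z(G) of order s and complement HZ(G)/Z(G), and N contains no vanishing elements of G. -/

import Mathlib

open scoped Classical

noncomputable section

/-- `g` is a vanishing element of `G`: some irreducible complex character of `G`
takes the value `0` at `g`. -/
def IsVanishing (G : Type) [Group G] (g : G) : Prop :=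
  ∃ V : FDRep ℂ G, CategoryTheory.Simple V ∧ V.character g = 0

/-- The conjugacy class size of `g`, i.e. `|G : C_G(g)|`. -/
def classSize {G : Type*} [Group G] (g : G) : ℕ := (Subgroup.centralizer {g}).index

/-- The set of conjugacy class sizes of vanishing elements of `G`. -/
def vcs (G : Type) [Group G] : Set ℕ :=
  {n | ∃ g : G, IsVanishing G g ∧ classSize g = n}

/-- The set of conjugacy class sizes of `G`. -/
def cs (G : Type*) [Group G] : Set ℕ := {n | ∃ g : G, classSize g = n}

/-- `H` is a Hall `π`-subgroup of `G`. -/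
def IsHallSubgroup {G : Type*} [Group G] (π : Set ℕ) (H : Subgroup G) : Prop :=
  (∀ p : ℕ, p.Prime → p ∣ Nat.card H → p ∈ π) ∧
  (∀ p : ℕ, p.Prime → p ∣ H.index → p ∉ π)

/-- The set of prime divisors of `n`. -/
def primesOf (n : ℕ) : Set ℕ := {p | p.Prime ∧ p ∣ n}

/-- The `π`-part `n_π` of `n`: the largest divisor of `n` all of whose prime
factors lie in `π`. -/
noncomputable def piPart (π : Set ℕ) (n : ℕ) : ℕ :=
  ∏ p ∈ n.primeFactors, p ^ (if p ∈ π then n.factorization p else 0)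

/-- The subgroup `H` is abelian. -/
def IsAbelianSubgroup {G : Type*} [Group G] (H : Subgroup G) : Prop :=
  ∀ a ∈ H, ∀ b ∈ H, a * b = b * a

/-- `X` is a Frobenius group with kernel `K`: `K` is a nontrivial proper normal
subgroup and the centralizer of every nontrivial element of `K` lies in `K`. -/
def IsFrobeniusWithKernel {X : Type*} [Group X] (K : Subgroup X) : Prop :=
  K ≠ ⊥ ∧ K ≠ ⊤ ∧ K.Normal ∧ ∀ k ∈ K, k ≠ 1 → Subgroup.centralizer {k} ≤ K

/-- `X` is a Frobenius group with kernel `K` and complement `C`. -/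
def IsFrobenius {X : Type*} [Group X] (K C : Subgroup X) : Prop :=
  IsFrobeniusWithKernel K ∧ K ⊔ C = ⊤ ∧ K ⊓ C = ⊥

/-- `G` is supersolvable: there is a chain of subgroups from `⊥` to `⊤`, each
normal in `G`, with all successive quotients cyclic (equivalently, each term is
generated by the previous one together with a single element). -/
def IsSupersolvable (G : Type*) [Group G] : Prop :=
  ∃ (n : ℕ) (c : Fin (n + 1) → Subgroup G),
    c 0 = ⊥ ∧ c (Fin.last n) = ⊤ ∧
    (∀ i : Fin n, c i.castSucc ≤ c i.succ) ∧
    (∀ i : Fin (n + 1), (c i).Normal) ∧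
    (∀ i : Fin n, ∃ g : G, c i.castSucc ⊔ Subgroup.zpowers g = c i.succ)

/-- The Fitting subgroup of `G`: the subgroup generated by all nilpotent normal
subgroups of `G`. -/
def Fitting (G : Type*) [Group G] : Subgroup G :=
  ⨆ H ∈ {H : Subgroup G | H.Normal ∧ Group.IsNilpotent ↥H}, H

/-- `O_p(G)`: the subgroup generated by all normal `p`-subgroups of `G`
(the largest normal `p`-subgroup). -/
def pCore' (p : ℕ) (G : Type*) [Group G] : Subgroup G :=
  ⨆ K ∈ {K : Subgroup G | K.Normal ∧ IsPGroup p ↥K}, K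

section Wedderburn

set_option linter.unusedSectionVars false

variable (G : Type) [Group G] [Finite G]

/-- The complex group algebra is a product of matrix algebras. -/
theorem exists_wedderburn : ∃ (n : ℕ) (d : Fin n → ℕ), (∀ i, NeZero (d i)) ∧
    Nonempty (MonoidAlgebra ℂ G ≃ₐ[ℂ] Π i, Matrix (Fin (d i)) (Fin (d i)) ℂ) := by
  have : NeZero (Nat.card G : ℂ) := ⟨by exact_mod_cast Nat.card_pos.ne'⟩
  exact IsSemisimpleRing.exists_algEquiv_pi_matrix_of_isAlgClosed ℂ (MonoidAlgebra ℂ G)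

/-- The index set of the irreducible characters of `G`. -/
def Irr : Type := Fin (exists_wedderburn G).choose

instance : Fintype (Irr G) := inferInstanceAs (Fintype (Fin _))

variable {G}

/-- The degree of an irreducible character. -/
def deg (i : Irr G) : ℕ := (exists_wedderburn G).choose_spec.choose i

instance (i : Irr G) : NeZero (deg i) := (exists_wedderburn G).choose_spec.choose_spec.1 i

variable (G) in
/-- The Wedderburn isomorphism of the complex group algebra. -/
def wed : MonoidAlgebra ℂ G ≃ₐ[ℂ] Π i : Irr G, Matrix (Fin (deg i)) (Fin (deg i)) ℂ :=
  (exists_wedderburn G).choose_spec.choose_spec.2.some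

/-- The irreducible representations of the group algebra. -/
def rho (i : Irr G) : MonoidAlgebra ℂ G →ₐ[ℂ] Matrix (Fin (deg i)) (Fin (deg i)) ℂ :=
  (Pi.evalAlgHom ℂ _ i).comp (wed G).toAlgHom

theorem rho_apply (i : Irr G) (a : MonoidAlgebra ℂ G) : rho i a = wed G a i := rfl

/-- The irreducible characters, extended linearly to the group algebra. -/
def chi (i : Irr G) : MonoidAlgebra ℂ G →ₗ[ℂ] ℂ :=
  (Matrix.traceLinearMap _ ℂ ℂ).comp (rho i).toLinearMap

theorem chi_apply (i : Irr G) (a : MonoidAlgebra ℂ G) : chi i a = (rho i a).trace := rfl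

/-- A group element as an element of the group algebra. -/
def gof : G →* MonoidAlgebra ℂ G := MonoidAlgebra.of ℂ G

theorem gof_apply (g : G) : gof g = MonoidAlgebra.single g 1 := rfl

/-- The irreducible characters as functions on the group. -/
def ch (i : Irr G) (g : G) : ℂ := chi i (gof g)

theorem ch_def (i : Irr G) (g : G) : ch i g = (rho i (gof g)).trace := rfl

theorem rho_surjective (i : Irr G) : Function.Surjective (rho i) := fun m ↦
  ⟨(wed G).symm (Pi.single i m), by simp [rho_apply]⟩

theorem ext_rho {a b : MonoidAlgebra ℂ G} (h : ∀ i, rho i a = rho i b) : a = b :=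
  (wed G).injective (funext h)

theorem ch_one (i : Irr G) : ch i 1 = deg i := by
  simp [ch_def]

theorem chi_mul_comm (i : Irr G) (a b : MonoidAlgebra ℂ G) : chi i (a * b) = chi i (b * a) := by
  rw [chi_apply, map_mul, Matrix.trace_mul_comm, ← map_mul, chi_apply]

theorem ch_conj (i : Irr G) (x g : G) : ch i (x * g * x⁻¹) = ch i g := by
  unfold ch
  rw [map_mul, chi_mul_comm, ← map_mul, ← mul_assoc, inv_mul_cancel, one_mul]

/-- The central idempotent belonging to an irreducible character. -/
def idem (i : Irr G) : MonoidAlgebra ℂ G := (wed G).symm (Pi.single i 1)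

theorem rho_idem_self (i : Irr G) : rho i (idem i) = 1 := by simp [rho_apply, idem]

theorem rho_idem_of_ne {i j : Irr G} (h : j ≠ i) : rho j (idem i) = 0 := by
  simp [rho_apply, idem, h]

theorem idem_mul_idem (i : Irr G) : idem i * idem i = idem i := by
  apply ext_rho; intro j
  by_cases h : j = i
  · subst h; simp [rho_idem_self]
  · simp [rho_idem_of_ne h]

theorem coeff_one_trace (a : MonoidAlgebra ℂ G) :
    LinearMap.trace ℂ _ (LinearMap.mulLeft ℂ a) = Nat.card G * a.coeff 1 := by
  have := Fintype.ofFinite G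
  let b : Module.Basis G ℂ (MonoidAlgebra ℂ G) := ⟨MonoidAlgebra.coeffLinearEquiv ℂ⟩
  rw [LinearMap.trace_eq_matrix_trace ℂ b, Matrix.trace]
  have key (x : G) : (LinearMap.toMatrix b b (LinearMap.mulLeft ℂ a)).diag x = a.coeff 1 := by
    rw [Matrix.diag_apply, LinearMap.toMatrix_apply, LinearMap.mulLeft_apply]
    have : b x = MonoidAlgebra.single x 1 := rfl
    rw [this]
    change (a * MonoidAlgebra.single x 1).coeff x = _
    rw [MonoidAlgebra.coeff_mul_single_eq_coeff_mul 1]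
    · simp
    · intro y _; simp
  simp_rw [key]
  simp

theorem trace_pi_matrix {ι : Type} [Fintype ι] (d : ι → ℕ)
    (m : Π i, Matrix (Fin (d i)) (Fin (d i)) ℂ) :
    LinearMap.trace ℂ _ (LinearMap.mulLeft ℂ m) = ∑ i, d i * (m i).trace := by
  let b := Pi.basis (fun i ↦ Matrix.stdBasis ℂ (Fin (d i)) (Fin (d i)))
  rw [LinearMap.trace_eq_matrix_trace ℂ b, Matrix.trace, Fintype.sum_sigma]
  refine Finset.sum_congr rfl fun i _ ↦ ?_
  rw [Fintype.sum_prod_type]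
  have key (x y : Fin (d i)) : (LinearMap.toMatrix b b (LinearMap.mulLeft ℂ m)).diag ⟨i, (x, y)⟩ = m i x x := by
    rw [Matrix.diag_apply, LinearMap.toMatrix_apply, LinearMap.mulLeft_apply]
    simp only [b, Pi.basis_apply, Pi.basis_repr, Pi.mul_apply, Pi.single_eq_same]
    rw [Matrix.stdBasis_eq_single]
    simp [Matrix.stdBasis, Matrix.mul_apply, Matrix.single_apply]
  simp_rw [key]
  simp [Matrix.trace, Finset.mul_sum]

/-- The regular character. -/
theorem card_mul_coeff_one (a : MonoidAlgebra ℂ G) :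
    Nat.card G * a.coeff 1 = ∑ i : Irr G, deg i * chi i a := by
  rw [← coeff_one_trace, ← LinearMap.trace_conj' _ (wed G).toLinearEquiv]
  have : (wed G).toLinearEquiv.conj (LinearMap.mulLeft ℂ a) = LinearMap.mulLeft ℂ (wed G a) := by
    refine LinearMap.ext fun m ↦ ?_
    simp [LinearEquiv.conj_apply]
  rw [this, trace_pi_matrix]
  rfl

end Wedderburn

section Orthogonality

set_option linter.unusedSectionVars false

variable {G : Type} [Group G] [Finite G]

theorem coeff_mul_gof (a : MonoidAlgebra ℂ G) (g x : G) :
    (a * gof g).coeff x = a.coeff (x * g⁻¹) := by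
  rw [gof_apply, MonoidAlgebra.coeff_mul_single_eq_coeff_mul (x * g⁻¹)]
  · simp
  · intro y _; rw [eq_mul_inv_iff_mul_eq]

theorem eq_sum_gof [Fintype G] (a : MonoidAlgebra ℂ G) : a = ∑ g, a.coeff g • gof g := by
  ext x
  simp [gof_apply, MonoidAlgebra.coeff_sum]

theorem commute_of_commute_gof {a : MonoidAlgebra ℂ G} (ha : ∀ g, gof g * a = a * gof g)
    (b : MonoidAlgebra ℂ G) : b * a = a * b := by
  have := Fintype.ofFinite G
  rw [eq_sum_gof b, Finset.sum_mul, Finset.mul_sum]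
  simp [ha]

theorem rho_eq_smul_one {a : MonoidAlgebra ℂ G} (ha : ∀ g, gof g * a = a * gof g) (i : Irr G) :
    rho i a = (chi i a / deg i) • (1 : Matrix (Fin (deg i)) (Fin (deg i)) ℂ) := by
  have h1 : rho i a ∈ Set.range (Matrix.scalar (α := ℂ) (Fin (deg i))) := by
    refine Matrix.mem_range_scalar_of_commute_single fun x y _ ↦ ?_
    obtain ⟨b, hb⟩ := rho_surjective i (Matrix.single x y 1)
    rw [← hb]
    change _ * _ = _ * _
    rw [← map_mul, ← map_mul, commute_of_commute_gof ha]
  obtain ⟨c, hc⟩ := h1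
  have h2 : chi i a = c * deg i := by
    rw [chi_apply, ← hc]; simp [mul_comm, Matrix.trace]
  have h3 : (deg i : ℂ) ≠ 0 := by exact_mod_cast NeZero.ne (deg i)
  rw [h2, mul_div_cancel_right₀ _ h3, ← hc]
  ext x y; simp [Matrix.one_apply, Matrix.diagonal_apply]

theorem sum_ch_mul_ch_inv (g h : G) :
    ∑ i : Irr G, ch i g * ch i h⁻¹ = Nat.card {x : G // x * g * x⁻¹ = h} := by
  have := Fintype.ofFinite G
  set b : MonoidAlgebra ℂ G := ∑ x : G, gof (x * g * x⁻¹) with hb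
  have hbc : ∀ y, gof y * b = b * gof y := by
    intro y
    rw [hb, Finset.mul_sum, Finset.sum_mul]
    refine Fintype.sum_equiv (Equiv.mulLeft y) _ _ fun x ↦ ?_
    rw [← map_mul, ← map_mul]
    congr 1; simp [mul_assoc]
  have hchi (i : Irr G) : chi i b = Nat.card G * ch i g := by
    rw [hb, map_sum]
    have : ∀ x : G, chi i (gof (x * g * x⁻¹)) = ch i g := fun x ↦ ch_conj i x g
    simp_rw [this]; simp
  have key := card_mul_coeff_one (b * gof h⁻¹)
  rw [coeff_mul_gof] at key
  have h1 : b.coeff (1 * h⁻¹⁻¹) = Nat.card {x : G // x * g * x⁻¹ = h} := by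
    rw [hb, MonoidAlgebra.coeff_sum, Finsupp.finsetSum_apply]
    simp [gof_apply, Finsupp.single_apply, Fintype.card_subtype]
  have h2 (i : Irr G) : deg i * chi i (b * gof h⁻¹) = Nat.card G * (ch i g * ch i h⁻¹) := by
    have h3 : (deg i : ℂ) ≠ 0 := by exact_mod_cast NeZero.ne (deg i)
    rw [chi_apply, map_mul, rho_eq_smul_one hbc, smul_one_mul, Matrix.trace_smul, hchi, ← ch_def,
      smul_eq_mul]
    field_simp
  rw [h1] at key
  simp_rw [h2, ← Finset.mul_sum] at key
  have h4 : (Nat.card G : ℂ) ≠ 0 := by exact_mod_cast Nat.card_pos.ne'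
  exact (mul_left_cancel₀ h4 key).symm

theorem sum_ch_self (g : G) :
    ∑ i : Irr G, ch i g * ch i g⁻¹ = Nat.card (Subgroup.centralizer {g}) := by
  rw [sum_ch_mul_ch_inv]
  congr 1
  refine Nat.card_congr (Equiv.subtypeEquivRight fun x ↦ ?_)
  rw [Subgroup.mem_centralizer_singleton_iff, mul_inv_eq_iff_eq_mul]

theorem card_mul_idem_coeff (i : Irr G) (g : G) :
    Nat.card G * (idem i).coeff g = deg i * ch i g⁻¹ := by
  have h := card_mul_coeff_one (idem i * gof g⁻¹)
  rw [coeff_mul_gof, one_mul, inv_inv] at h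
  rw [h, Finset.sum_eq_single i]
  · rw [chi_apply, map_mul, rho_idem_self, one_mul, ch_def]
  · intro j _ hj
    rw [chi_apply, map_mul, rho_idem_of_ne hj]; simp
  · simp

theorem idem_coeff (i : Irr G) (g : G) :
    (idem i).coeff g = deg i / Nat.card G * ch i g⁻¹ := by
  have h4 : (Nat.card G : ℂ) ≠ 0 := by exact_mod_cast Nat.card_pos.ne'
  field_simp
  rw [← card_mul_idem_coeff, mul_comm]

theorem sum_ch_mul_ch_inv' [Fintype G] (i j : Irr G) :
    ∑ g, ch i g * ch j g⁻¹ = if i = j then (Nat.card G : ℂ) else 0 := by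
  have h4 : (Nat.card G : ℂ) ≠ 0 := by exact_mod_cast Nat.card_pos.ne'
  have h3 : (deg j : ℂ) ≠ 0 := by exact_mod_cast NeZero.ne (deg j)
  have h := congrArg (chi i) (eq_sum_gof (idem j))
  rw [map_sum] at h
  have h1 : ∑ x : G, (chi i) ((idem j).coeff x • gof x) =
      deg j / Nat.card G * ∑ g, ch i g * ch j g⁻¹ := by
    rw [Finset.mul_sum]
    refine Finset.sum_congr rfl fun x _ ↦ ?_
    rw [map_smul, idem_coeff, smul_eq_mul, ch, ch]; ring
  rw [h1] at h
  split_ifs with hij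
  · subst hij
    rw [chi_apply, rho_idem_self] at h
    simp only [Matrix.trace_one, Fintype.card_fin] at h
    field_simp at h
    exact h.symm
  · rw [chi_apply, rho_idem_of_ne hij, Matrix.trace_zero] at h
    have := mul_eq_zero.1 h.symm
    exact this.resolve_left (div_ne_zero h3 h4)

theorem exists_nat_trace_of_idempotent {n : ℕ} {m : Matrix (Fin n) (Fin n) ℂ} (h : m * m = m) :
    ∃ k : ℕ, m.trace = k := by
  have h1 : IsIdempotentElem (Matrix.toLin' m) := by
    change Matrix.toLin' m ∘ₗ Matrix.toLin' m = _
    rw [← Matrix.toLin'_mul, h]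
  refine ⟨Module.finrank ℂ (LinearMap.range (Matrix.toLin' m)), ?_⟩
  rw [← Matrix.trace_toLin'_eq]
  exact (LinearMap.IsIdempotentElem.isProj_range _ h1).trace

/-- The character of a matrix representation decomposes with natural multiplicities. -/
theorem exists_multiplicity {n : ℕ} (ψ : MonoidAlgebra ℂ G →ₐ[ℂ] Matrix (Fin n) (Fin n) ℂ) :
    ∃ m : Irr G → ℕ, ∀ a, (ψ a).trace = ∑ i, m i * chi i a := by
  let τ (i : Irr G) : Matrix (Fin (deg i)) (Fin (deg i)) ℂ →ₗ[ℂ] ℂ :=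
    (Matrix.traceLinearMap _ ℂ ℂ).comp (ψ.toLinearMap.comp
      ((wed G).symm.toLinearMap.comp
        (LinearMap.single ℂ (fun i : Irr G ↦ Matrix (Fin (deg i)) (Fin (deg i)) ℂ) i)))
  have hτ (i m) : τ i m = (ψ ((wed G).symm (Pi.single i m))).trace := rfl
  have hτc (i m m') : τ i (m * m') = τ i (m' * m) := by
    rw [hτ, hτ, Pi.single_mul, Pi.single_mul, map_mul, map_mul, map_mul, map_mul,
      Matrix.trace_mul_comm]
  have hψ (b) : (ψ b).trace = ∑ i, τ i (rho i b) := by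
    have : b = ∑ i, (wed G).symm (Pi.single i (rho i b)) := by
      rw [← map_sum]
      apply (wed G).injective
      rw [AlgEquiv.apply_symm_apply]
      exact (Finset.univ_sum_single (wed G b)).symm
    conv_lhs => rw [this, map_sum, Matrix.trace_sum]
    rfl
  have hoff (i x y) (c : ℂ) (hxy : x ≠ y) : τ i (Matrix.single x y c) = 0 := by
    have : Matrix.single x y c = Matrix.single x x 1 * Matrix.single x y c := by simp
    rw [this, hτc, Matrix.single_mul_single_of_ne _ _ _ _ hxy.symm, map_zero]
  have hdiag (i x y) (c : ℂ) : τ i (Matrix.single x x c) = τ i (Matrix.single y y c) := by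
    have : Matrix.single x x c = Matrix.single x y 1 * Matrix.single y x c := by simp
    rw [this, hτc]; simp
  have hτt (i m) : τ i m = m.trace * τ i (Matrix.single 0 0 1) := by
    conv_lhs => rw [Matrix.matrix_eq_sum_single m]
    rw [map_sum, Matrix.trace, Finset.sum_mul]
    refine Finset.sum_congr rfl fun x _ ↦ ?_
    rw [map_sum, Finset.sum_eq_single x]
    · rw [hdiag i x 0, Matrix.diag_apply]
      have (c : ℂ) : τ i (Matrix.single 0 0 c) = c * τ i (Matrix.single 0 0 1) := by
        rw [← smul_eq_mul, ← map_smul, Matrix.smul_single, smul_eq_mul, mul_one]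
      exact this _
    · intro y _ hy; exact hoff _ _ _ _ hy.symm
    · simp
  have hnat (i : Irr G) : ∃ k : ℕ, τ i (Matrix.single 0 0 1) = k := by
    apply exists_nat_trace_of_idempotent
    change ψ _ * ψ _ = ψ _
    rw [← map_mul]
    congr 1
    change (wed G).symm _ * (wed G).symm _ = (wed G).symm _
    rw [← map_mul]
    congr 1
    change Pi.single i _ * Pi.single i _ = Pi.single i _
    rw [← Pi.single_mul]; simp
  choose m hm using hnat
  refine ⟨m, fun a ↦ ?_⟩
  rw [hψ]
  refine Finset.sum_congr rfl fun i _ ↦ ?_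
  rw [hτt, hm, chi_apply, mul_comm]

/-- A matrix representation whose character has norm one is irreducible. -/
theorem exists_chi_eq {n : ℕ} [Fintype G]
    {ψ : MonoidAlgebra ℂ G →ₐ[ℂ] Matrix (Fin n) (Fin n) ℂ}
    (hnorm : ∑ g, (ψ (gof g)).trace * (ψ (gof g⁻¹)).trace = Nat.card G) :
    ∃ i : Irr G, deg i = n ∧ ∀ a, (ψ a).trace = chi i a := by
  obtain ⟨m, hm⟩ := exists_multiplicity ψ
  have h4 : (Nat.card G : ℂ) ≠ 0 := by exact_mod_cast Nat.card_pos.ne'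
  have h5 : ∑ g, (ψ (gof g)).trace * (ψ (gof g⁻¹)).trace = ∑ i, (m i : ℂ) ^ 2 * Nat.card G := by
    simp_rw [hm, Finset.sum_mul_sum]
    rw [Finset.sum_comm]
    refine Finset.sum_congr rfl fun i _ ↦ ?_
    rw [Finset.sum_comm, Finset.sum_eq_single i]
    · rw [← sum_ch_mul_ch_inv' i i |>.trans (if_pos rfl), Finset.mul_sum]
      refine Finset.sum_congr rfl fun x _ ↦ ?_
      unfold ch; ring
    · intro j _ hj
      have h6 : ∑ g, m i * chi i (gof g) * (m j * chi j (gof g⁻¹)) =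
          m i * m j * ∑ g, ch i g * ch j g⁻¹ := by
        rw [Finset.mul_sum]
        refine Finset.sum_congr rfl fun x _ ↦ ?_
        unfold ch; ring
      rw [h6, sum_ch_mul_ch_inv', if_neg hj.symm, mul_zero]
    · simp
  rw [h5, ← Finset.sum_mul, mul_eq_right₀ h4] at hnorm
  have h6 : ∑ i, m i ^ 2 = 1 := by exact_mod_cast hnorm
  obtain ⟨i, hi⟩ : ∃ i, m i ≠ 0 := by
    by_contra! h; simp [h] at h6
  have h7 : m i = 1 := by
    have := Finset.single_le_sum (f := fun i ↦ m i ^ 2) (fun i _ ↦ Nat.zero_le _) (Finset.mem_univ i)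
    have : m i ≤ 1 := by nlinarith
    omega
  have h8 : ∀ j, j ≠ i → m j = 0 := by
    intro j hj
    have := Finset.add_sum_erase Finset.univ (fun i ↦ m i ^ 2) (Finset.mem_univ i)
    have h9 : ∑ x ∈ Finset.univ.erase i, m x ^ 2 = 0 := by simp only [h7, h6] at this; omega
    have := Finset.sum_eq_zero_iff.1 h9 j (by simp [hj])
    simpa using this
  have h9 : ∀ a, (ψ a).trace = chi i a := by
    intro a
    rw [hm, Finset.sum_eq_single i]
    · simp [h7]
    · intro j _ hj; simp [h8 j hj]
    · simp
  refine ⟨i, ?_, h9⟩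
  have := h9 1
  rw [chi_apply] at this
  simp only [map_one, Matrix.trace_one, Fintype.card_fin] at this
  exact_mod_cast this.symm

theorem irr_ext {i j : Irr G} (h : ∀ g : G, ch i g = ch j g) : i = j := by
  by_contra hij
  have := Fintype.ofFinite G
  have h1 := sum_ch_mul_ch_inv' i j
  rw [if_neg hij] at h1
  have h2 := sum_ch_mul_ch_inv' j j
  rw [if_pos rfl] at h2
  simp_rw [h] at h1
  rw [h1] at h2
  have h4 : (Nat.card G : ℂ) ≠ 0 := by exact_mod_cast Nat.card_pos.ne'
  exact h4 h2.symm

end Orthogonality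

section Vanishing

set_option linter.unusedSectionVars false

variable {G : Type} [Group G] [Finite G]

theorem isVanishing_iff (g : G) : IsVanishing G g ↔ ∃ i : Irr G, ch i g = 0 := by
  have := Fintype.ofFinite G
  have : NeZero (Nat.card G : ℂ) := ⟨by exact_mod_cast Nat.card_pos.ne'⟩
  constructor
  · rintro ⟨V, hV, h⟩
    let b := Module.finBasis ℂ V
    let ψ : MonoidAlgebra ℂ G →ₐ[ℂ] Matrix (Fin (Module.finrank ℂ V)) (Fin (Module.finrank ℂ V)) ℂ :=
      (LinearMap.toMatrixAlgEquiv b).toAlgHom.comp (MonoidAlgebra.lift ℂ _ G V.ρ)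
    have hψ (x : G) : (ψ (gof x)).trace = V.character x := by
      have : ψ (gof x) = LinearMap.toMatrix b b (V.ρ x) := by
        simp [ψ, gof_apply, LinearMap.toMatrixAlgEquiv, LinearMap.toMatrix]
      rw [this, FDRep.character, LinearMap.trace_eq_matrix_trace ℂ b]
    obtain ⟨i, -, hi⟩ := exists_chi_eq (ψ := ψ) (by
      simp_rw [hψ]; exact (FDRep.simple_iff_char_is_norm_one V).1 hV)
    exact ⟨i, by rw [ch, ← hi, hψ, h]⟩
  · rintro ⟨i, hi⟩
    let ρ : Representation ℂ G (Fin (deg i) → ℂ) :=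
      ((Matrix.toLinAlgEquiv' (R := ℂ) (n := Fin (deg i))).toAlgHom.comp (rho i) : _ →* _).comp gof
    have hρ (x : G) : (FDRep.of ρ).character x = ch i x := by
      have : (FDRep.of ρ).ρ x = Matrix.toLin' (rho i (gof x)) := rfl
      rw [FDRep.character, this, ch_def]
      exact Matrix.trace_toLin'_eq _
    refine ⟨FDRep.of ρ, ?_, by rw [hρ, hi]⟩
    rw [FDRep.simple_iff_char_is_norm_one]
    simp_rw [hρ]
    rw [sum_ch_mul_ch_inv', if_pos rfl]

/-- Irreducible characters of a quotient inflate to irreducible characters. -/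
theorem exists_inflation {Q : Type} [Group Q] [Finite Q] (f : G →* Q) (hf : Function.Surjective f)
    (j : Irr Q) : ∃ i : Irr G, deg i = deg j ∧ ∀ g, ch i g = ch j (f g) := by
  have := Fintype.ofFinite G
  have := Fintype.ofFinite Q
  let ψ : MonoidAlgebra ℂ G →ₐ[ℂ] Matrix (Fin (deg j)) (Fin (deg j)) ℂ :=
    (rho j).comp (MonoidAlgebra.mapDomainAlgHom ℂ ℂ f)
  have hψ (x : G) : (ψ (gof x)).trace = ch j (f x) := by
    simp [ψ, gof_apply, ch_def]
  obtain ⟨i, hi, h⟩ := exists_chi_eq (ψ := ψ) (by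
    simp_rw [hψ, map_inv]
    have h1 := sum_ch_mul_ch_inv' j j
    rw [if_pos rfl] at h1
    have h2 : ∀ q : Q, (Finset.univ.filter fun g ↦ f g = q).card = Nat.card f.ker := by
      intro q
      obtain ⟨g, rfl⟩ := hf q
      rw [← Fintype.card_subtype, Nat.card_eq_fintype_card]
      refine Fintype.card_congr ⟨fun x ↦ ⟨g⁻¹ * x.1, by simp [MonoidHom.mem_ker, x.2]⟩,
        fun x ↦ ⟨g * x.1, by simp [MonoidHom.mem_ker.1 x.2]⟩, fun x ↦ by simp, fun x ↦ by simp⟩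
    rw [← Finset.sum_fiberwise' Finset.univ f (fun q ↦ ch j q * ch j q⁻¹)]
    simp_rw [Finset.sum_const, h2, ← Finset.smul_sum, h1]
    rw [nsmul_eq_mul, ← Nat.cast_mul]
    congr 1
    have h3 := Subgroup.card_mul_index f.ker
    rw [Subgroup.index_ker, MonoidHom.range_eq_top.2 hf, Subgroup.card_top] at h3
    exact h3)
  exact ⟨i, hi, fun g ↦ by rw [ch, ← h, hψ]⟩

theorem IsVanishing.of_map {Q : Type} [Group Q] [Finite Q] (f : G →* Q)
    (hf : Function.Surjective f) {g : G} (h : IsVanishing Q (f g)) : IsVanishing G g := by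
  rw [isVanishing_iff] at h ⊢
  obtain ⟨j, hj⟩ := h
  obtain ⟨i, -, hi⟩ := exists_inflation f hf j
  exact ⟨i, by rw [hi, hj]⟩

theorem IsVanishing.conj {g : G} (h : IsVanishing G g) (x : G) : IsVanishing G (x * g * x⁻¹) := by
  rw [isVanishing_iff] at h ⊢
  obtain ⟨i, hi⟩ := h
  exact ⟨i, by rw [ch_conj, hi]⟩

theorem rho_of_deg_one {i : Irr G} (hi : deg i = 1) (a : MonoidAlgebra ℂ G) :
    rho i a = chi i a • (1 : Matrix (Fin (deg i)) (Fin (deg i)) ℂ) := by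
  rw [chi_apply]
  generalize rho i a = m
  have : Subsingleton (Fin (deg i)) := by rw [hi]; infer_instance
  ext x y
  rw [Subsingleton.elim x 0, Subsingleton.elim y 0]
  simp [Matrix.trace, Fintype.sum_subsingleton _ (0 : Fin (deg i))]

theorem exists_deg_gt_one (h : ∃ a b : G, a * b ≠ b * a) : ∃ i : Irr G, 1 < deg i := by
  obtain ⟨a, b, hab⟩ := h
  by_contra! hc
  apply hab
  have hd : ∀ i : Irr G, deg i = 1 := fun i ↦
    le_antisymm (hc i) (Nat.one_le_iff_ne_zero.2 (NeZero.ne _))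
  have : gof (a * b) = gof (b * a) := by
    apply ext_rho
    intro i
    rw [map_mul, map_mul, map_mul, map_mul, rho_of_deg_one (hd i) (gof a)]
    simp
  exact MonoidAlgebra.of_injective this

/-- Values of an irreducible character on powers of an element. -/
theorem exists_polynomial (i : Irr G) (g : G) {n : ℕ} (hn : g ^ n = 1) (hn0 : n ≠ 0) {ζ : ℂ}
    (hζ : IsPrimitiveRoot ζ n) :
    ∃ P : Polynomial ℤ, ∀ k : ℕ, ch i (g ^ k) = P.aeval (ζ ^ k) := by
  set A := rho i (gof g) with hA
  have hAk (k : ℕ) : A ^ k = rho i (gof (g ^ k)) := by rw [map_pow, map_pow]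
  have hAn : A ^ n = 1 := by rw [hAk, hn, map_one, map_one]
  have hnc : (n : ℂ) ≠ 0 := by exact_mod_cast hn0
  have hζ0 : ζ ≠ 0 := hζ.ne_zero hn0
  let E (j : ℕ) : Matrix (Fin (deg i)) (Fin (deg i)) ℂ :=
    (n : ℂ)⁻¹ • ∑ k ∈ Finset.range n, (ζ⁻¹ ^ (j * k)) • A ^ k
  have hAE (j : ℕ) : A * E j = ζ ^ j • E j := by
    have h1 : A * E j = (n : ℂ)⁻¹ • ∑ k ∈ Finset.range n, (ζ⁻¹ ^ (j * k)) • A ^ (k + 1) := by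
      simp only [E, mul_smul_comm, Finset.mul_sum]
      simp_rw [pow_succ']
    have h2 : ζ ^ j • E j =
        (n : ℂ)⁻¹ • ∑ k ∈ Finset.range n, (ζ ^ j * ζ⁻¹ ^ (j * k)) • A ^ k := by
      simp only [E]
      rw [smul_comm, Finset.smul_sum]
      simp_rw [smul_smul]
    rw [h1, h2]
    congr 1
    have h3 := Finset.sum_range_succ' (fun k ↦ (ζ ^ j * ζ⁻¹ ^ (j * k)) • A ^ k) n
    rw [Finset.sum_range_succ] at h3
    have h4 : (ζ ^ j * ζ⁻¹ ^ (j * n)) • A ^ n = (ζ ^ j * ζ⁻¹ ^ (j * 0)) • A ^ 0 := by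
      rw [hAn, mul_comm j n, pow_mul, inv_pow, hζ.pow_eq_one]; simp
    rw [h4] at h3
    rw [add_right_cancel h3]
    refine Finset.sum_congr rfl fun k _ ↦ ?_
    congr 1
    rw [mul_add, mul_one, pow_add, inv_pow, inv_pow]
    field_simp
  have hAEk (j k : ℕ) : A ^ k * E j = ζ ^ (j * k) • E j := by
    induction k with
    | zero => simp
    | succ k ih => rw [pow_succ', mul_assoc, ih, mul_smul_comm, hAE, smul_smul]; congr 1; ring
  have hEE (j : ℕ) : E j * E j = E j := by
    have : E j * E j = (n : ℂ)⁻¹ • ∑ k ∈ Finset.range n, (ζ⁻¹ ^ (j * k)) • (A ^ k * E j) := by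
      conv_lhs => enter [1]; unfold E
      rw [smul_mul_assoc, Finset.sum_mul]
      simp_rw [smul_mul_assoc]
    rw [this]
    simp_rw [hAEk, smul_smul, inv_pow]
    have h5 : ∀ k, (ζ ^ (j * k))⁻¹ * ζ ^ (j * k) = 1 := fun k ↦ inv_mul_cancel₀ (pow_ne_zero _ hζ0)
    simp_rw [h5, one_smul, Finset.sum_const, Finset.card_range]
    rw [← Nat.cast_smul_eq_nsmul ℂ, smul_smul, inv_mul_cancel₀ hnc, one_smul]
  have hsum : ∑ j ∈ Finset.range n, E j = 1 := by
    simp only [E]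
    rw [← Finset.smul_sum, Finset.sum_comm]
    simp_rw [← Finset.sum_smul]
    rw [Finset.sum_eq_single 0]
    · simp [smul_smul, hnc]
    · intro k hk hk0
      have h6 : ∑ j ∈ Finset.range n, ζ⁻¹ ^ (j * k) = 0 := by
        have h7 : ζ⁻¹ ^ k ≠ 1 := hζ.inv.pow_ne_one_of_pos_of_lt hk0 (Finset.mem_range.1 hk)
        have h8 := geom_sum_mul (ζ⁻¹ ^ k) n
        rw [← pow_mul, mul_comm k n, pow_mul, hζ.inv.pow_eq_one, one_pow, sub_self] at h8
        have h9 := (mul_eq_zero.1 h8).resolve_right (sub_ne_zero.2 h7)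
        rw [← h9]
        exact Finset.sum_congr rfl fun j _ ↦ by rw [← pow_mul, mul_comm]
      rw [h6, zero_smul]
    · intro h; exact absurd (Finset.mem_range.2 (Nat.pos_of_ne_zero hn0)) h
  choose m hm using fun j ↦ exists_nat_trace_of_idempotent (hEE j)
  refine ⟨∑ j ∈ Finset.range n, Polynomial.monomial j (m j : ℤ), fun k ↦ ?_⟩
  · rw [ch_def, ← hAk, ← mul_one (A ^ k), ← hsum, Finset.mul_sum, Matrix.trace_sum, map_sum]
    refine Finset.sum_congr rfl fun j _ ↦ ?_
    rw [hAEk, Matrix.trace_smul, hm, Polynomial.aeval_monomial, smul_eq_mul]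
    simp only [algebraMap_int_eq, eq_intCast, Int.cast_natCast]
    rw [mul_comm, ← pow_mul, mul_comm j k]

end Vanishing

section Values

set_option linter.unusedSectionVars false

variable {G : Type} [Group G] [Finite G]

theorem ch_inv (i : Irr G) (g : G) : ch i g⁻¹ = star (ch i g) := by
  have hn0 : Nat.card G ≠ 0 := Nat.card_pos.ne'
  have hζ := Complex.isPrimitiveRoot_exp _ hn0
  obtain ⟨P, hP⟩ := exists_polynomial i g pow_card_eq_one' hn0 hζ
  set ζ := Complex.exp (2 * Real.pi * Complex.I / (Nat.card G : ℕ)) with hζd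
  have h1 : g⁻¹ = g ^ (Nat.card G - 1) := by
    rw [inv_eq_iff_mul_eq_one, ← pow_succ', Nat.sub_add_cancel Nat.card_pos, pow_card_eq_one']
  have h2 : star ζ = ζ ^ (Nat.card G - 1) := by
    have h3 : star ζ = ζ⁻¹ := by
      rw [Complex.inv_def, Complex.normSq_eq_norm_sq, hζ.norm'_eq_one hn0]; simp
    rw [h3, inv_eq_iff_eq_inv]
    refine eq_inv_of_mul_eq_one_right ?_
    rw [← pow_succ, Nat.sub_add_cancel Nat.card_pos, hζ.pow_eq_one]
  have h4 : ch i g = P.aeval (ζ ^ 1) := by rw [← hP, pow_one]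
  rw [h1, hP, ← h2, h4, pow_one]
  simp [Polynomial.aeval_eq_sum_range]

theorem ch_mul_ch_inv (i : Irr G) (g : G) : ch i g * ch i g⁻¹ = ((‖ch i g‖ ^ 2 : ℝ) : ℂ) := by
  rw [ch_inv, Complex.star_def, Complex.mul_conj, Complex.normSq_eq_norm_sq]

theorem sum_norm_sq (g : G) :
    ∑ i : Irr G, ‖ch i g‖ ^ 2 = (Nat.card (Subgroup.centralizer {g}) : ℝ) := by
  have := sum_ch_self g
  simp_rw [ch_mul_ch_inv] at this
  exact_mod_cast this

theorem sum_norm_sq' [Fintype G] (i : Irr G) : ∑ g, ‖ch i g‖ ^ 2 = (Nat.card G : ℝ) := by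
  have := sum_ch_mul_ch_inv' i i
  simp_rw [ch_mul_ch_inv, if_pos] at this
  exact_mod_cast this

theorem ch_isIntegral (i : Irr G) (g : G) : IsIntegral ℤ (ch i g) := by
  have hn0 : Nat.card G ≠ 0 := Nat.card_pos.ne'
  have hζ := Complex.isPrimitiveRoot_exp _ hn0
  obtain ⟨P, hP⟩ := exists_polynomial i g pow_card_eq_one' hn0 hζ
  rw [← pow_one g, hP, Polynomial.aeval_eq_sum_range]
  exact IsIntegral.sum _ fun j _ ↦ (((hζ.isIntegral (Nat.pos_of_ne_zero hn0)).pow _).pow _).smul _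

/-- The exponents coprime to the group order. -/
def unitExp (n : ℕ) : Finset ℕ := {k ∈ Finset.range n | n.Coprime k}

theorem card_unitExp (n : ℕ) : (unitExp n).card = n.totient := rfl

theorem prod_aeval_eq_int {n : ℕ} (hn0 : n ≠ 0) {ζ : ℂ} (hζ : IsPrimitiveRoot ζ n)
    (P : Polynomial ℤ) : ∃ z : ℤ, ∏ k ∈ unitExp n, P.aeval (ζ ^ k) = z := by
  have : NeZero n := ⟨hn0⟩
  have h1 : ∏ k ∈ unitExp n, P.aeval (ζ ^ k) = ∏ η ∈ primitiveRoots n ℂ, P.aeval η := by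
    refine Finset.prod_bij (fun k _ ↦ ζ ^ k) ?_ ?_ ?_ (fun _ _ ↦ rfl)
    · intro k hk
      rw [unitExp, Finset.mem_filter] at hk
      rw [mem_primitiveRoots (Nat.pos_of_ne_zero hn0)]
      exact hζ.pow_of_coprime k hk.2.symm
    · intro k hk l hl h
      rw [unitExp, Finset.mem_filter, Finset.mem_range] at hk hl
      exact hζ.pow_inj hk.1 hl.1 h
    · intro η hη
      rw [mem_primitiveRoots (Nat.pos_of_ne_zero hn0)] at hη
      obtain ⟨k, hk, hc, rfl⟩ := (hζ.isPrimitiveRoot_iff).1 hη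
      exact ⟨k, by rw [unitExp, Finset.mem_filter, Finset.mem_range]; exact ⟨hk, hc.symm⟩, rfl⟩
  have h2 := Polynomial.resultant_eq_prod_eval (Polynomial.cyclotomic n ℂ)
    (P.map (algebraMap ℤ ℂ)) P.natDegree Polynomial.natDegree_map_le
    (IsAlgClosed.splits _)
  rw [(Polynomial.cyclotomic.monic n ℂ).leadingCoeff, one_pow, one_mul,
    Polynomial.cyclotomic.roots_eq_primitiveRoots_val] at h2
  refine ⟨Polynomial.resultant (Polynomial.cyclotomic n ℤ) P n.totient P.natDegree, ?_⟩
  have h3 := Polynomial.resultant_map_map (Polynomial.cyclotomic n ℤ) P n.totient P.natDegree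
    (algebraMap ℤ ℂ)
  rw [Polynomial.map_cyclotomic, ← Polynomial.natDegree_cyclotomic n ℂ, h2] at h3
  rw [← Polynomial.natDegree_cyclotomic n ℂ]
  simp only [algebraMap_int_eq, eq_intCast] at h3
  rw [h1, ← h3, Finset.prod_map_val]
  simp [Polynomial.eval_map, Polynomial.aeval_def]

theorem card_le_sum_of_one_le_prod {ι : Type} (s : Finset ι) (f : ι → ℝ) (hf : ∀ k ∈ s, 0 < f k)
    (h : 1 ≤ ∏ k ∈ s, f k) : (s.card : ℝ) ≤ ∑ k ∈ s, f k := by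
  have h1 : 0 ≤ ∑ k ∈ s, Real.log (f k) := by
    rw [← Real.log_prod fun k hk ↦ (hf k hk).ne']
    exact Real.log_nonneg h
  have h2 : ∑ k ∈ s, Real.log (f k) ≤ ∑ k ∈ s, (f k - 1) :=
    Finset.sum_le_sum fun k hk ↦ Real.log_le_sub_one_of_pos (hf k hk)
  rw [Finset.sum_sub_distrib] at h2
  simp at h2
  linarith

theorem totient_le_sum_norm_sq (i : Irr G) {g : G} (h : ch i g ≠ 0) :
    ((Nat.card G).totient : ℝ) ≤ ∑ k ∈ unitExp (Nat.card G), ‖ch i (g ^ k)‖ ^ 2 := by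
  have hn0 : Nat.card G ≠ 0 := Nat.card_pos.ne'
  have hζ := Complex.isPrimitiveRoot_exp _ hn0
  obtain ⟨P, hP⟩ := exists_polynomial i g pow_card_eq_one' hn0 hζ
  set ζ := Complex.exp (2 * Real.pi * Complex.I / (Nat.card G : ℕ)) with hζd
  have hne : ∀ k ∈ unitExp (Nat.card G), ch i (g ^ k) ≠ 0 := by
    intro k hk hz
    rw [unitExp, Finset.mem_filter] at hk
    have hζk := hζ.pow_of_coprime k hk.2.symm
    apply h
    rw [← pow_one g, hP, pow_one]
    rw [hP] at hz
    have h1 : minpoly ℤ (ζ ^ k) ∣ P :=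
      minpoly.isIntegrallyClosed_dvd (hζk.isIntegral (Nat.pos_of_ne_zero hn0)) hz
    rw [← Polynomial.cyclotomic_eq_minpoly hζk (Nat.pos_of_ne_zero hn0),
      Polynomial.cyclotomic_eq_minpoly hζ (Nat.pos_of_ne_zero hn0)] at h1
    obtain ⟨Q, hQ⟩ := h1
    rw [hQ, map_mul, minpoly.aeval, zero_mul]
  rw [← card_unitExp]
  apply card_le_sum_of_one_le_prod
  · intro k hk
    have := norm_pos_iff.2 (hne k hk)
    positivity
  · obtain ⟨z, hz⟩ := prod_aeval_eq_int hn0 hζ P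
    simp_rw [← hP] at hz
    rw [Finset.prod_pow, ← norm_prod, hz]
    have hz0 : z ≠ 0 := by
      rintro rfl
      rw [Int.cast_zero] at hz
      obtain ⟨k, hk, hk0⟩ := Finset.prod_eq_zero_iff.1 hz
      exact hne k hk hk0
    have h1 : (1 : ℝ) ≤ ‖(z : ℂ)‖ := by
      rw [Complex.norm_intCast]
      exact_mod_cast Int.one_le_abs hz0
    nlinarith

/-- Burnside: nonlinear irreducible characters vanish somewhere. -/
theorem exists_ch_eq_zero (i : Irr G) (hi : 1 < deg i) : ∃ g, ch i g = 0 := by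
  by_contra! hc
  have := Fintype.ofFinite G
  set n := Nat.card G with hn
  have hφ : 0 < n.totient := Nat.totient_pos.2 Nat.card_pos
  have h1 : ∀ k ∈ unitExp n, ∑ g : G, ‖ch i (g ^ k)‖ ^ 2 = (n : ℝ) := by
    intro k hk
    rw [unitExp, Finset.mem_filter] at hk
    rw [hn, ← sum_norm_sq' i]
    exact Fintype.sum_equiv (powCoprime hk.2) _ _ fun g ↦ rfl
  have h2 : ∑ g : G, ∑ k ∈ unitExp n, ‖ch i (g ^ k)‖ ^ 2 = (n.totient : ℝ) * n := by
    rw [Finset.sum_comm, Finset.sum_congr rfl h1, Finset.sum_const, card_unitExp, nsmul_eq_mul]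
  have h3 : (∑ g ∈ Finset.univ.erase (1 : G), ∑ k ∈ unitExp n, ‖ch i (g ^ k)‖ ^ 2) ≥
      (n - 1 : ℝ) * n.totient := by
    have := Finset.card_nsmul_le_sum (Finset.univ.erase (1 : G))
      (fun g ↦ ∑ k ∈ unitExp n, ‖ch i (g ^ k)‖ ^ 2) (n.totient : ℝ)
      (fun g _ ↦ totient_le_sum_norm_sq i (hc g))
    rw [Finset.card_erase_of_mem (Finset.mem_univ _), nsmul_eq_mul, Finset.card_univ,
      ← Nat.card_eq_fintype_card, ← hn, Nat.cast_sub Nat.card_pos] at this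
    simpa only [Nat.cast_one] using this
  rw [← Finset.add_sum_erase _ _ (Finset.mem_univ (1 : G))] at h2
  simp only [one_pow, ch_one, Finset.sum_const, card_unitExp, nsmul_eq_mul,
    Complex.norm_natCast] at h2
  have h4 : (2 : ℝ) ≤ deg i := by exact_mod_cast hi
  have h5 : (1 : ℝ) ≤ n.totient := by exact_mod_cast hφ
  nlinarith [mul_le_mul h4 h4 (by norm_num) (by linarith)]

end Values

section ClassSizes

set_option linter.unusedSectionVars false

variable {G : Type} [Group G] [Finite G]

theorem card_centralizer_mul_classSize (g : G) :
    Nat.card (Subgroup.centralizer {g}) * classSize g = Nat.card G :=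
  Subgroup.card_mul_index _

theorem classSize_pos (g : G) : 0 < classSize g :=
  Nat.pos_of_ne_zero Subgroup.index_ne_zero_of_finite

theorem mem_centralizer_singleton {x g : G} :
    x ∈ Subgroup.centralizer {g} ↔ Commute x g := by
  rw [Subgroup.mem_centralizer_singleton_iff]; exact Iff.rfl

theorem classSize_eq_one_iff {g : G} : classSize g = 1 ↔ g ∈ Subgroup.center G := by
  rw [classSize, Subgroup.index_eq_one, Subgroup.centralizer_eq_top_iff_subset]
  simp

theorem card_isConj [Fintype G] (g : G) :
    (Finset.univ.filter fun y ↦ IsConj g y).card = classSize g := by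
  have h1 := MulAction.index_stabilizer (ConjAct G) g
  rw [ConjAct.orbit_eq_carrier_conjClasses] at h1
  have h2 : (MulAction.stabilizer (ConjAct G) g).index = classSize g := by
    rw [classSize, Subgroup.centralizer_eq_comap_stabilizer]
    exact (Subgroup.index_comap_of_surjective _ ConjAct.toConjAct.surjective).symm
  rw [← h2, h1, Set.ncard_eq_toFinset_card']
  congr 1
  ext y
  rw [Finset.mem_filter, Set.mem_toFinset, ConjClasses.mem_carrier_iff_mk_eq,
    ConjClasses.mk_eq_mk_iff_isConj, isConj_comm]
  simp

theorem exists_pow_eq_left {g y : G} (h : Commute g y)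
    (hc : (orderOf g).Coprime (orderOf y)) : ∃ m : ℕ, (g * y) ^ m = g := by
  obtain ⟨m, h1, h2⟩ := Nat.chineseRemainder hc 1 0
  refine ⟨m, ?_⟩
  rw [h.mul_pow, pow_eq_pow_iff_modEq.2 h1, pow_eq_pow_iff_modEq.2 h2]; simp

theorem commute_of_commute_mul {g y x : G} (h : Commute g y)
    (hc : (orderOf g).Coprime (orderOf y)) (hx : Commute x (g * y)) :
    Commute x g ∧ Commute x y := by
  constructor
  · obtain ⟨m, hm⟩ := exists_pow_eq_left h hc
    rw [← hm]; exact hx.pow_right m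
  · obtain ⟨m, hm⟩ := exists_pow_eq_left h.symm hc.symm
    rw [← hm, ← h.eq]; exact hx.pow_right m

/-- For a power map coprime to the group order, centralizers do not change. -/
theorem centralizer_pow_eq {g : G} {k : ℕ} (hk : (Nat.card G).Coprime k) :
    Subgroup.centralizer {g ^ k} = Subgroup.centralizer {g} := by
  ext x
  rw [mem_centralizer_singleton, mem_centralizer_singleton]
  refine ⟨fun h ↦ ?_, fun h ↦ h.pow_right k⟩
  obtain ⟨m, hm⟩ := exists_pow_eq_self_of_coprime
    (hk.symm.coprime_dvd_right (orderOf_dvd_natCard g))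
  rw [← hm]; exact h.pow_right m

theorem card_irr_le_of_not_isVanishing {u : G} (hu : ¬ IsVanishing G u) :
    Fintype.card (Irr G) ≤ Nat.card (Subgroup.centralizer {u}) := by
  rw [isVanishing_iff] at hu
  push Not at hu
  set n := Nat.card G with hn
  have hφ : 0 < n.totient := Nat.totient_pos.2 Nat.card_pos
  have h1 : ∀ k ∈ unitExp n, ∑ i : Irr G, ‖ch i (u ^ k)‖ ^ 2 =
      (Nat.card (Subgroup.centralizer {u}) : ℝ) := by
    intro k hk
    rw [unitExp, Finset.mem_filter] at hk
    rw [sum_norm_sq, centralizer_pow_eq hk.2]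
  have h2 := Finset.sum_congr rfl h1
  rw [Finset.sum_comm, Finset.sum_const, card_unitExp, nsmul_eq_mul] at h2
  have h3 := Finset.card_nsmul_le_sum Finset.univ
    (fun i : Irr G ↦ ∑ k ∈ unitExp n, ‖ch i (u ^ k)‖ ^ 2) (n.totient : ℝ)
    (fun i _ ↦ totient_le_sum_norm_sq i (hu i))
  rw [h2, nsmul_eq_mul, mul_comm, Finset.card_univ] at h3
  have h4 : (0 : ℝ) < n.totient := by exact_mod_cast hφ
  exact_mod_cast le_of_mul_le_mul_left h3 h4

theorem sum_card_centralizer [Fintype G] :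
    ∑ g : G, Nat.card (Subgroup.centralizer {g}) = Fintype.card (Irr G) * Nat.card G := by
  have h : ∑ g : G, (Nat.card (Subgroup.centralizer {g}) : ℝ) =
      Fintype.card (Irr G) * Nat.card G := by
    simp_rw [← sum_norm_sq]
    rw [Finset.sum_comm]
    simp_rw [sum_norm_sq', Finset.sum_const, Finset.card_univ, nsmul_eq_mul]
  exact_mod_cast h

variable {s : ℕ}

theorem classSize_of_isVanishing (hv : vcs G = {s}) {g : G} (hg : IsVanishing G g) :
    classSize g = s := by
  have : classSize g ∈ vcs G := ⟨g, hg, rfl⟩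
  rwa [hv] at this

theorem exists_isVanishing (hv : vcs G = {s}) : ∃ g : G, IsVanishing G g := by
  have : s ∈ vcs G := by rw [hv]; rfl
  obtain ⟨g, hg, -⟩ := this
  exact ⟨g, hg⟩

theorem classSize_le (hv : vcs G = {s}) (g : G) : classSize g ≤ s := by
  have := Fintype.ofFinite G
  by_cases hg : IsVanishing G g
  · exact (classSize_of_isVanishing hv hg).le
  obtain ⟨v, hv'⟩ := exists_isVanishing hv
  have hs := classSize_of_isVanishing hv hv'
  have hcard : ∀ w, IsVanishing G w → Nat.card (Subgroup.centralizer {w}) =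
      Nat.card (Subgroup.centralizer {v}) := by
    intro w hw
    have h1 := card_centralizer_mul_classSize w
    have h2 := card_centralizer_mul_classSize v
    rw [classSize_of_isVanishing hv hw, ← h2, hs] at h1
    exact Nat.eq_of_mul_eq_mul_right (hs ▸ classSize_pos v) h1
  have hle : Nat.card (Subgroup.centralizer {v}) ≤ Fintype.card (Irr G) := by
    by_contra! hlt
    have h1 : ∀ w : G, Fintype.card (Irr G) ≤ Nat.card (Subgroup.centralizer {w}) := by
      intro w
      by_cases hw : IsVanishing G w
      · rw [hcard w hw]; exact hlt.le
      · exact card_irr_le_of_not_isVanishing hw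
    have h2 := Finset.sum_lt_sum (s := Finset.univ) (fun w _ ↦ h1 w) ⟨v, Finset.mem_univ _, hlt⟩
    rw [sum_card_centralizer, Finset.sum_const, Finset.card_univ, smul_eq_mul, mul_comm,
      Nat.card_eq_fintype_card] at h2
    exact lt_irrefl _ h2
  have h3 := hle.trans (card_irr_le_of_not_isVanishing hg)
  have h4 := card_centralizer_mul_classSize g
  rw [← card_centralizer_mul_classSize v, hs] at h4
  by_contra! h5
  have : Nat.card (Subgroup.centralizer {v}) * s <
      Nat.card (Subgroup.centralizer {g}) * classSize g :=
    Nat.mul_lt_mul_of_le_of_lt h3 h5 Nat.card_pos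
  omega

/-- An element commuting with a vanishing element of coprime order is centralized by
everything that centralizes the vanishing element. -/
theorem centralizer_le_of_isVanishing (hv : vcs G = {s}) {g y : G} (hg : IsVanishing G g)
    (hy : Commute g y) (hc : (orderOf g).Coprime (orderOf y)) {x : G} (hx : Commute x g) :
    Commute x y := by
  have h1 : Subgroup.centralizer {g * y} ≤ Subgroup.centralizer {g} := by
    intro z hz
    rw [mem_centralizer_singleton] at hz ⊢
    exact (commute_of_commute_mul hy hc hz).1
  have h2 : Nat.card (Subgroup.centralizer {g}) ≤ Nat.card (Subgroup.centralizer {g * y}) := by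
    have h3 := card_centralizer_mul_classSize g
    rw [← card_centralizer_mul_classSize (g * y), classSize_of_isVanishing hv hg] at h3
    have h4 := classSize_le hv (g * y)
    by_contra! h5
    have := Nat.mul_lt_mul_of_lt_of_le h5 h4 ((classSize_pos (g * y)).trans_le h4)
    omega
  have h3 := Subgroup.eq_of_le_of_card_ge h1 h2
  have h4 : x ∈ Subgroup.centralizer {g * y} := by
    rw [h3]; exact mem_centralizer_singleton.2 hx
  exact (commute_of_commute_mul hy hc (mem_centralizer_singleton.1 h4)).2

theorem not_isVanishing_of_mem_center {g : G} (hg : g ∈ Subgroup.center G) :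
    ¬ IsVanishing G g := by
  rw [isVanishing_iff]
  rintro ⟨i, hi⟩
  have h1 : ∀ x, gof x * gof g = gof g * gof x := fun x ↦ by
    rw [← map_mul, ← map_mul, Subgroup.mem_center_iff.1 hg]
  have h2 := rho_eq_smul_one h1 i
  have h3 : chi i (gof g) = 0 := hi
  rw [h3, zero_div, zero_smul] at h2
  have h4 : rho i (gof g⁻¹) * rho i (gof g) = 1 := by
    rw [← map_mul, ← map_mul, inv_mul_cancel, map_one, map_one]
  rw [h2, mul_zero] at h4
  exact zero_ne_one h4

theorem one_lt_of_vcs (hv : vcs G = {s}) : 1 < s := by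
  obtain ⟨v, hv'⟩ := exists_isVanishing hv
  have hs := classSize_of_isVanishing hv hv'
  have h1 := classSize_pos v
  have h2 : classSize v ≠ 1 := fun h ↦
    not_isVanishing_of_mem_center (classSize_eq_one_iff.1 h) hv'
  omega

theorem card_dvd_sum_of_invariant [Fintype G] (K : Subgroup G) (f : G → ℤ)
    (hf : ∀ x, ∀ k ∈ K, f (x * k) = f x) : (Nat.card K : ℤ) ∣ ∑ x, f x := by
  rw [← Finset.sum_fiberwise Finset.univ (fun x : G ↦ (x : G ⧸ K)) f]
  refine Finset.dvd_sum fun q _ ↦ ?_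
  obtain ⟨x, rfl⟩ := QuotientGroup.mk_surjective q
  have h1 : ∀ y ∈ Finset.univ.filter (fun y : G ↦ (y : G ⧸ K) = x), f y = f x := by
    intro y hy
    rw [Finset.mem_filter] at hy
    have := QuotientGroup.eq.1 hy.2.symm
    rw [← hf x _ this]; simp
  have h2 : (Finset.univ.filter (fun y : G ↦ (y : G ⧸ K) = x)).card = Nat.card K := by
    rw [← Fintype.card_subtype, Nat.card_eq_fintype_card]
    refine Fintype.card_congr ⟨fun y ↦ ⟨x⁻¹ * y.1, QuotientGroup.eq.1 y.2.symm⟩,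
      fun k ↦ ⟨x * k.1, (QuotientGroup.eq.2 (by simp)).symm⟩, fun y ↦ by simp, fun k ↦ by simp⟩
  rw [Finset.sum_congr rfl h1, Finset.sum_const, h2, nsmul_eq_mul]
  exact dvd_mul_right _ _

/-- A linear character as a homomorphism. -/
def linChar (i : Irr G) (hi : deg i = 1) : G →* ℂ where
  toFun := ch i
  map_one' := by rw [ch_one, hi, Nat.cast_one]
  map_mul' x y := by
    have h := congrArg Matrix.trace (map_mul (rho i) (gof x) (gof y))
    rw [← map_mul, rho_of_deg_one hi (gof x), smul_one_mul, Matrix.trace_smul] at h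
    exact h

theorem ch_eq_one_of_mem_commutator {i : Irr G} (hi : deg i = 1) {g : G}
    (hg : g ∈ commutator G) : ch i g = 1 := by
  have := Abelianization.commutator_subset_ker (linChar i hi).toHomUnits hg
  rw [MonoidHom.mem_ker, Units.ext_iff] at this
  exact this

theorem exists_prod_class_sums [Fintype G] (hv : vcs G = {s}) (S : Finset (Irr G))
    (hS : ∀ i ∈ S, 1 < deg i) : ∃ (a : MonoidAlgebra ℂ G) (f : G → ℤ) (k : ℕ),
      (∀ g, a.coeff g = f g) ∧ ∑ g, f g = (s : ℤ) ^ k ∧ ∀ i ∈ S, rho i a = 0 := by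
  induction S using Finset.induction_on with
  | empty =>
    refine ⟨1, fun g ↦ if g = 1 then 1 else 0, 0, fun g ↦ ?_, by simp, by simp⟩
    rw [MonoidAlgebra.one_def, MonoidAlgebra.coeff_single, Finsupp.single_apply]
    simp [eq_comm]
  | insert j S hj ih =>
    obtain ⟨a, f, k, hf, hk, hS0⟩ := ih fun i hi ↦ hS i (Finset.mem_insert_of_mem hi)
    obtain ⟨x, hx⟩ := exists_ch_eq_zero j (hS j (Finset.mem_insert_self _ _))
    have hxs := classSize_of_isVanishing hv ((isVanishing_iff x).2 ⟨j, hx⟩)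
    set C := Finset.univ.filter fun y ↦ IsConj x y with hC
    set c : MonoidAlgebra ℂ G := ∑ y ∈ C, gof y with hc
    have hcc : ∀ g, gof g * c = c * gof g := by
      intro g
      rw [hc, Finset.mul_sum, Finset.sum_mul]
      refine Finset.sum_bij (fun y _ ↦ g * y * g⁻¹) ?_ ?_ ?_ ?_
      · intro y hy
        rw [hC, Finset.mem_filter] at hy ⊢
        exact ⟨Finset.mem_univ _, hy.2.trans (isConj_iff.2 ⟨g, rfl⟩)⟩
      · intro y _ z _ h; simpa using h
      · intro y hy
        rw [hC, Finset.mem_filter] at hy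
        refine ⟨g⁻¹ * y * g, ?_, by group⟩
        rw [hC, Finset.mem_filter]
        exact ⟨Finset.mem_univ _, hy.2.trans (isConj_iff.2 ⟨g⁻¹, by simp⟩)⟩
      · intro y _
        rw [← map_mul, ← map_mul]; simp
    have hj0 : rho j c = 0 := by
      rw [rho_eq_smul_one hcc]
      have : chi j c = 0 := by
        rw [hc, map_sum]
        refine Finset.sum_eq_zero fun y hy ↦ ?_
        rw [hC, Finset.mem_filter] at hy
        obtain ⟨g, rfl⟩ := isConj_iff.1 hy.2
        exact (ch_conj j g x).trans hx
      rw [this, zero_div, zero_smul]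
    refine ⟨a * c, fun g ↦ ∑ y ∈ C, f (g * y⁻¹), k + 1, fun g ↦ ?_, ?_, fun i hi ↦ ?_⟩
    · rw [hc, Finset.mul_sum, MonoidAlgebra.coeff_sum, Finsupp.finsetSum_apply, Int.cast_sum]
      refine Finset.sum_congr rfl fun y _ ↦ ?_
      rw [coeff_mul_gof, hf]
    · rw [Finset.sum_comm]
      have : ∀ y ∈ C, ∑ g, f (g * y⁻¹) = (s : ℤ) ^ k := fun y _ ↦ by
        rw [← hk]; exact Fintype.sum_equiv (Equiv.mulRight y⁻¹) _ _ fun g ↦ rfl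
      rw [Finset.sum_congr rfl this, Finset.sum_const, card_isConj, hxs, nsmul_eq_mul, pow_succ']
    · rw [map_mul]
      rcases Finset.mem_insert.1 hi with rfl | hi
      · rw [hj0, mul_zero]
      · rw [hS0 i hi, zero_mul]

/-- If all vanishing elements have class size `s`, the order of the derived group divides a
power of `s`. -/
theorem exists_card_commutator_dvd (hv : vcs G = {s}) : ∃ k, Nat.card (commutator G) ∣ s ^ k := by
  have := Fintype.ofFinite G
  obtain ⟨a, f, k, hf, hk, ha⟩ := exists_prod_class_sums hv
    (Finset.univ.filter fun i ↦ 1 < deg i) (by simp)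
  refine ⟨k, ?_⟩
  have h1 : ∀ g ∈ commutator G, a * gof g = a := by
    intro g hg
    apply ext_rho; intro i
    by_cases hi : 1 < deg i
    · rw [map_mul, ha i (by simp [hi]), zero_mul]
    · have hi1 : deg i = 1 := by have := NeZero.ne (deg i); omega
      rw [map_mul, rho_of_deg_one hi1 (gof g)]
      have : chi i (gof g) = 1 := ch_eq_one_of_mem_commutator hi1 hg
      rw [this, one_smul, mul_one]
  have h2 := card_dvd_sum_of_invariant (commutator G) f (fun x g hg ↦ by
    have h3 := coeff_mul_gof a g⁻¹ x
    rw [h1 _ (inv_mem hg), inv_inv, hf, hf] at h3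
    exact_mod_cast h3.symm)
  rw [hk] at h2
  exact_mod_cast h2

end ClassSizes

section VanishingCriteria

open scoped commutatorElement

set_option linter.unusedSectionVars false

variable {G : Type} [Group G] [Finite G]

/-- If every element of the coset `hU` of a nontrivial normal subgroup `U` is conjugate to `h`,
then `h` is a vanishing element. -/
theorem isVanishing_of_forall_isConj (U : Subgroup G) [hn : U.Normal] (hU : U ≠ ⊥) {h : G}
    (hh : ∀ u ∈ U, ∃ t, t⁻¹ * h * t = h * u) : IsVanishing G h := by
  have := Fintype.ofFinite G
  rw [isVanishing_iff]
  by_contra! hne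
  set e : MonoidAlgebra ℂ G := ∑ u : U, gof (u : G) with he
  have hcard : (Nat.card U : ℂ) ≠ 0 := by exact_mod_cast Nat.card_pos.ne'
  have hleft : ∀ u ∈ U, gof u * e = e := by
    intro u hu
    rw [he, Finset.mul_sum]
    refine Fintype.sum_equiv (Equiv.mulLeft (⟨u, hu⟩ : U)) _ _ fun x ↦ ?_
    rw [← map_mul]; rfl
  have hcent : ∀ g, gof g * e = e * gof g := by
    intro g
    rw [he, Finset.mul_sum, Finset.sum_mul]
    refine Fintype.sum_equiv (MulAut.conjNormal (H := U) g).toEquiv _ _ fun x ↦ ?_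
    rw [← map_mul, ← map_mul]
    congr 1
    simp [MulAut.conjNormal_apply]
  have hee : e * e = (Nat.card U : ℂ) • e := by
    nth_rw 1 [he]
    rw [Finset.sum_mul, Finset.sum_congr rfl (fun (u : U) _ ↦ hleft u u.2), Finset.sum_const,
      Finset.card_univ, ← Nat.card_eq_fintype_card, Nat.cast_smul_eq_nsmul]
  have hchi : ∀ i : Irr G, rho i e = (Nat.card U : ℂ) • 1 := by
    intro i
    have h1 : chi i (gof h * e) = Nat.card U * ch i h := by
      rw [he, Finset.mul_sum, map_sum, Finset.sum_congr rfl (g := fun _ ↦ ch i h),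
        Finset.sum_const, Finset.card_univ, ← Nat.card_eq_fintype_card, nsmul_eq_mul]
      rintro ⟨u, hu⟩ -
      obtain ⟨t, ht⟩ := hh u hu
      rw [← map_mul]
      change ch i (h * u) = _
      rw [← ht]
      simpa using ch_conj i t⁻¹ h
    have h2 := rho_eq_smul_one hcent i
    set ω := chi i e / deg i with hω
    have h3 : ω * ω = Nat.card U * ω := by
      have h4 := congrArg (rho i) hee
      rw [map_mul, map_smul, h2, smul_mul_smul_comm, one_mul, smul_smul] at h4
      have h5 := congrFun (congrFun h4 0) 0
      simpa [Matrix.smul_apply] using h5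
    have h6 : ω ≠ 0 := by
      intro h0
      rw [chi_apply, map_mul, h2, h0, zero_smul, mul_zero, Matrix.trace_zero] at h1
      exact mul_ne_zero hcard (hne i) h1.symm
    rw [h2, mul_right_cancel₀ h6 h3]
  have heq : e = (Nat.card U : ℂ) • 1 := ext_rho fun i ↦ by rw [hchi, map_smul, map_one]
  obtain ⟨u, hu1⟩ := Subgroup.ne_bot_iff_exists_ne_one.1 hU
  have h1 := congrArg (fun a ↦ a.coeff (u : G)) heq
  rw [he] at h1
  have h7 : ∀ x : U, (gof (x : G)).coeff (u : G) = if x = u then (1 : ℂ) else 0 := by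
    intro x
    rw [gof_apply, MonoidAlgebra.coeff_single, Finsupp.single_apply]
    exact if_congr Subtype.ext_iff.symm rfl rfl
  have h8 : (1 : MonoidAlgebra ℂ G).coeff (u : G) = 0 := by
    rw [MonoidAlgebra.one_def, MonoidAlgebra.coeff_single, Finsupp.single_apply, if_neg]
    exact fun h ↦ hu1 (Subtype.ext h.symm)
  rw [MonoidAlgebra.coeff_smul, Finsupp.smul_apply, h8, MonoidAlgebra.coeff_sum,
    Finsupp.finsetSum_apply, Finset.sum_congr rfl (fun x _ ↦ h7 x)] at h1
  simp at h1

/-- A vanishing criterion: `h` acts on a normal subgroup `A` with central commutators, and all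
conjugates of `h` act on `A` as powers of `h`. -/
theorem isVanishing_of_central_commutators (A : Subgroup G) [hn : A.Normal] {h : G}
    (h1 : ∀ x ∈ A, ∀ y ∈ A, Commute (x⁻¹ * h⁻¹ * x * h) y) (h2 : ∃ x ∈ A, ¬ Commute x h)
    (h3 : ∀ t, ∃ (k : ℕ) (z : G), (∀ a ∈ A, Commute z a) ∧ t⁻¹ * h * t = h ^ k * z) :
    IsVanishing G h := by
  have hconj : ∀ x ∈ A, ∀ t, t⁻¹ * x * t ∈ A := fun x hx t ↦ by
    simpa using hn.conj_mem x hx t⁻¹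
  have hmul : ∀ x ∈ A, ∀ y ∈ A, (x * y)⁻¹ * h⁻¹ * (x * y) * h =
      (x⁻¹ * h⁻¹ * x * h) * (y⁻¹ * h⁻¹ * y * h) := by
    intro x hx y hy
    have := (h1 x hx y⁻¹ (A.inv_mem hy)).eq
    calc _ = (y⁻¹ * (x⁻¹ * h⁻¹ * x * h)) * (h⁻¹ * y * h) := by group
      _ = _ := by rw [← this]; group
  let U : Subgroup G :=
    { carrier := {u | ∃ x ∈ A, u = x⁻¹ * h⁻¹ * x * h}
      one_mem' := ⟨1, A.one_mem, by group⟩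
      mul_mem' := by
        rintro _ _ ⟨x, hx, rfl⟩ ⟨y, hy, rfl⟩
        exact ⟨x * y, A.mul_mem hx hy, (hmul x hx y hy).symm⟩
      inv_mem' := by
        rintro _ ⟨x, hx, rfl⟩
        refine ⟨x⁻¹, A.inv_mem hx, ?_⟩
        have := hmul x hx x⁻¹ (A.inv_mem hx)
        rw [mul_inv_cancel] at this
        rw [inv_eq_iff_mul_eq_one, ← this]; group }
  have hmemU : ∀ x ∈ A, x⁻¹ * h⁻¹ * x * h ∈ U := fun x hx ↦ ⟨x, hx, rfl⟩
  have hUh : ∀ u ∈ U, h⁻¹ * u * h ∈ U := by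
    rintro _ ⟨x, hx, rfl⟩
    exact ⟨h⁻¹ * x * h, hconj x hx h, by group⟩
  have hpow : ∀ k : ℕ, ∀ x ∈ A, x⁻¹ * (h ^ k)⁻¹ * x * h ^ k ∈ U := by
    intro k
    induction k with
    | zero => intro x hx; simp [U.one_mem]
    | succ k ih =>
      intro x hx
      have := U.mul_mem (hmemU x hx) (hUh _ (ih x hx))
      convert this using 1
      rw [pow_succ]; group
  have hN : U.Normal := by
    constructor
    rintro _ ⟨x, hx, rfl⟩ t
    obtain ⟨k, z, hz, hk⟩ := h3 t⁻¹
    set y := t * x * t⁻¹ with hy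
    have hyA : y ∈ A := hn.conj_mem x hx t
    have hk' : t * h * t⁻¹ = h ^ k * z := by rw [← hk]; group
    have : t * (x⁻¹ * h⁻¹ * x * h) * t⁻¹ = y⁻¹ * (h ^ k)⁻¹ * y * h ^ k := by
      calc _ = y⁻¹ * (t * h * t⁻¹)⁻¹ * y * (t * h * t⁻¹) := by rw [hy]; group
        _ = y⁻¹ * (z⁻¹ * ((h ^ k)⁻¹ * y * h ^ k)) * z := by rw [hk']; group
        _ = y⁻¹ * (((h ^ k)⁻¹ * y * h ^ k) * z⁻¹) * z := by
          rw [((hz _ (hconj y hyA (h ^ k))).inv_left).eq]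
        _ = _ := by group
    rw [this]
    exact hpow k y hyA
  refine isVanishing_of_forall_isConj U ?_ ?_
  · obtain ⟨x, hx, hxh⟩ := h2
    intro hb
    have := hmemU x hx
    rw [hb, Subgroup.mem_bot] at this
    apply hxh
    calc x * h = h * x * (x⁻¹ * h⁻¹ * x * h) := by group
      _ = h * x := by rw [this, mul_one]
  · intro u hu
    obtain ⟨x, hx, hxu⟩ := U.inv_mem hu
    refine ⟨x, ?_⟩
    rw [← inv_inv u, hxu]; group

theorem exists_not_and_succ {P : ℕ → Prop} (h0 : ¬ P 0) {n : ℕ} (hn : P n) :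
    ∃ i, ¬ P i ∧ P (i + 1) := by
  by_contra! h
  exact (Nat.rec h0 (fun i hi ↦ h i hi) n : ¬ P n) hn

theorem mem_center_of_map_subtype {N : Subgroup G} {K : Subgroup N} {x : G} (hx : x ∈ N) :
    x ∈ K.map N.subtype ↔ (⟨x, hx⟩ : N) ∈ K := by
  simp [hx]

/-- A noncentral element of a nilpotent normal subgroup `N` with `G = N C_G(u)` is vanishing. -/
theorem isVanishing_of_isNilpotent (N : Subgroup G) [hn : N.Normal] (hnil : Group.IsNilpotent N)
    {u : G} (hu : u ∈ N) (hnc : ∃ n ∈ N, ¬ Commute n u)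
    (hG : ∀ g, ∃ n ∈ N, ∃ c, Commute c u ∧ g = n * c) : IsVanishing G u := by
  let Z : ℕ → Subgroup G := fun i ↦ (Subgroup.upperCentralSeries N i).map N.subtype
  have hcomm : ∀ n ∈ N, n⁻¹ * u⁻¹ * n * u ∈ N := fun n hn ↦
    N.mul_mem (N.mul_mem (N.mul_mem (N.inv_mem hn) (N.inv_mem hu)) hn) hu
  obtain ⟨i, hi, hi1⟩ : ∃ i, (¬ ∀ n ∈ N, n⁻¹ * u⁻¹ * n * u ∈ Z i) ∧
      ∀ n ∈ N, n⁻¹ * u⁻¹ * n * u ∈ Z (i + 1) := by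
    obtain ⟨k, hk⟩ := hnil.nilpotent
    refine exists_not_and_succ (P := fun i ↦ ∀ n ∈ N, n⁻¹ * u⁻¹ * n * u ∈ Z i) ?_ (n := k) ?_
    · intro h
      obtain ⟨n, hnN, hnu⟩ := hnc
      have := h n hnN
      simp only [Z, Subgroup.upperCentralSeries_zero, Subgroup.map_bot, Subgroup.mem_bot] at this
      apply hnu
      calc n * u = u * n * (n⁻¹ * u⁻¹ * n * u) := by group
        _ = u * n := by rw [this, mul_one]
    · intro n hnN
      rw [mem_center_of_map_subtype (hcomm n hnN), hk]; trivial
  have hZn : (Z i).Normal := inferInstance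
  let q := QuotientGroup.mk' (Z i)
  have hq : Function.Surjective q := QuotientGroup.mk'_surjective _
  have hqmem : ∀ x, q x = 1 ↔ x ∈ Z i := fun x ↦ QuotientGroup.eq_one_iff x
  have hcent : ∀ x ∈ Z (i + 1), ∀ y ∈ N, Commute (q x) (q y) := by
    rintro x hx y hy
    have hxN : x ∈ N := by obtain ⟨z, -, rfl⟩ := hx; exact z.2
    rw [mem_center_of_map_subtype hxN, Subgroup.mem_upperCentralSeries_succ_iff] at hx
    have := hx ⟨y, hy⟩
    have h2 : q (x * y * x⁻¹ * y⁻¹) = 1 := by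
      rw [hqmem]; exact ⟨_, this, rfl⟩
    rw [map_mul, map_mul, map_mul, map_inv, map_inv, mul_inv_eq_one, mul_inv_eq_iff_eq_mul] at h2
    exact h2
  apply IsVanishing.of_map q hq
  have hNq : (N.map q).Normal := hn.map q hq
  refine isVanishing_of_central_commutators (N.map q) ?_ ?_ ?_
  · rintro _ ⟨x, hx, rfl⟩ _ ⟨y, hy, rfl⟩
    simpa using hcent _ (hi1 x hx) y hy
  · push Not at hi
    obtain ⟨n, hnN, hnu⟩ := hi
    refine ⟨q n, ⟨n, hnN, rfl⟩, fun hc ↦ hnu ?_⟩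
    rw [← hqmem, map_mul, map_mul, map_mul, map_inv, map_inv, mul_assoc _ (q n), hc.eq]
    group
  · intro t
    obtain ⟨t, rfl⟩ := hq t
    obtain ⟨n, hnN, c, hc, rfl⟩ := hG t
    refine ⟨1, q (c⁻¹ * (n⁻¹ * u⁻¹ * n * u)⁻¹ * c), ?_, ?_⟩
    · rintro _ ⟨y, hy, rfl⟩
      refine hcent _ ?_ y hy
      have hZ : (Z (i + 1)).Normal := inferInstance
      simpa using hZ.conj_mem _ ((Z (i + 1)).inv_mem (hi1 n hnN)) c⁻¹
    · have : u = c⁻¹ * u * c := by rw [mul_assoc, ← hc.eq]; group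
      rw [pow_one]
      simp only [← map_mul, ← map_inv]
      congr 1
      calc (n * c)⁻¹ * u * (n * c) = c⁻¹ * u * c * (c⁻¹ * (n⁻¹ * u⁻¹ * n * u)⁻¹ * c) := by group
        _ = _ := by rw [← this]

theorem eq_one_of_coprime_commutator {Q : Type} [Group Q] {h n c : Q} (hc : h⁻¹ * n * h = n * c)
    (hch : Commute c h) {m : ℕ} (hm : c ^ m = 1) (hco : (orderOf h).Coprime m) : c = 1 := by
  have h1 : n⁻¹ * h⁻¹ * n = c * h⁻¹ := by
    calc n⁻¹ * h⁻¹ * n = n⁻¹ * (h⁻¹ * n * h) * h⁻¹ := by group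
      _ = _ := by rw [hc]; group
  have h2 : (c * h⁻¹) ^ orderOf h = 1 := by
    rw [← h1]
    have := conj_pow (a := n⁻¹) (b := h⁻¹) (i := orderOf h)
    rw [inv_inv] at this
    rw [this, inv_pow, pow_orderOf_eq_one]; group
  rw [hch.inv_right.mul_pow, inv_pow, pow_orderOf_eq_one, inv_one, mul_one] at h2
  have h3 := Nat.dvd_gcd (orderOf_dvd_of_pow_eq_one h2) (orderOf_dvd_of_pow_eq_one hm)
  rw [hco.gcd_eq_one] at h3
  exact orderOf_eq_one_iff.1 (Nat.dvd_one.1 h3)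

/-- Coprime action on a solvable normal subgroup produces vanishing elements. -/
theorem isVanishing_of_coprime_action (K : Subgroup G) [hn : K.Normal] (hsol : Group.IsSolvable K)
    {h : G} (hco : (orderOf h).Coprime (Nat.card K)) (hnc : ∃ n ∈ K, ¬ Commute n h)
    (hG : ∀ t : G, ∃ a ∈ K, ∃ (k : ℕ) (c : G), (∀ x ∈ K, Commute c x) ∧
      t⁻¹ * h * t = a⁻¹ * (h ^ k * c) * a) : IsVanishing G h := by
  let D : ℕ → Subgroup G := fun i ↦ (derivedSeries K i).map K.subtype
  have hDK : ∀ i, D i ≤ K := fun i ↦ by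
    rintro _ ⟨z, -, rfl⟩; exact z.2
  have hcomm : ∀ n ∈ K, n⁻¹ * h⁻¹ * n * h ∈ K := fun n hnK ↦ by
    have := K.mul_mem (K.inv_mem hnK) (hn.conj_mem n hnK h⁻¹)
    simpa [mul_assoc] using this
  obtain ⟨i, hi1, hi⟩ : ∃ i, (¬ ¬ ∀ n ∈ K, n⁻¹ * h⁻¹ * n * h ∈ D i) ∧
      ¬ ∀ n ∈ K, n⁻¹ * h⁻¹ * n * h ∈ D (i + 1) := by
    obtain ⟨k, hk⟩ := hsol.solvable
    refine exists_not_and_succ (P := fun i ↦ ¬ ∀ n ∈ K, n⁻¹ * h⁻¹ * n * h ∈ D i) ?_ (n := k) ?_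
    · intro hh
      apply hh
      intro n hnK
      rw [mem_center_of_map_subtype (hcomm n hnK), derivedSeries_zero]; trivial
    · intro hh
      obtain ⟨n, hnN, hnu⟩ := hnc
      have := hh n hnN
      simp only [D, hk, Subgroup.map_bot, Subgroup.mem_bot] at this
      apply hnu
      calc n * h = h * n * (n⁻¹ * h⁻¹ * n * h) := by group
        _ = h * n := by rw [this, mul_one]
  rw [not_not] at hi1
  have hDn : (D (i + 1)).Normal := inferInstance
  have hDn' : (D i).Normal := inferInstance
  let q := QuotientGroup.mk' (D (i + 1))
  have hq : Function.Surjective q := QuotientGroup.mk'_surjective _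
  have hqmem : ∀ x, q x = 1 ↔ x ∈ D (i + 1) := fun x ↦ QuotientGroup.eq_one_iff x
  have hab : ∀ x ∈ D i, ∀ y ∈ D i, Commute (q x) (q y) := by
    rintro _ ⟨x, hx, rfl⟩ _ ⟨y, hy, rfl⟩
    have h2 : q ⁅(x : G), (y : G)⁆ = 1 := by
      rw [hqmem]
      refine ⟨⁅x, y⁆, ?_, rfl⟩
      change _ ∈ derivedSeries K (i + 1)
      rw [derivedSeries_succ]
      exact Subgroup.commutator_mem_commutator hx hy
    rw [map_commutatorElement, commutatorElement_eq_one_iff_commute] at h2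
    exact h2
  apply IsVanishing.of_map q hq
  have hNq : ((D i).map q).Normal := hDn'.map q hq
  refine isVanishing_of_central_commutators ((D i).map q) ?_ ?_ ?_
  · rintro _ ⟨x, hx, rfl⟩ _ ⟨y, hy, rfl⟩
    simpa using hab _ (hi1 x (hDK i hx)) y hy
  · by_contra! hall
    apply hi
    intro n hnK
    rw [← hqmem]
    refine eq_one_of_coprime_commutator (h := q h) (n := q n) (m := Nat.card K) ?_ ?_ ?_ ?_
    · simp only [← map_mul, ← map_inv]; congr 1; group
    · exact hall _ ⟨_, hi1 n hnK, rfl⟩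
    · have : (⟨_, hcomm n hnK⟩ : K) ^ Nat.card K = 1 := pow_card_eq_one'
      rw [← map_pow]
      rw [Subtype.ext_iff] at this
      simp only [Subgroup.coe_pow, Subgroup.coe_one] at this
      rw [this, map_one]
    · exact hco.coprime_dvd_left (orderOf_map_dvd q h)
  · intro t
    obtain ⟨t, rfl⟩ := hq t
    obtain ⟨a, ha, k, c, hc, htk⟩ := hG t
    let p := QuotientGroup.mk' (D i)
    have hah : Commute (p a) (p h) := by
      have : p (a⁻¹ * h⁻¹ * a * h) = 1 := (QuotientGroup.eq_one_iff _).2 (hi1 a ha)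
      calc p a * p h = p h * p a * p (a⁻¹ * h⁻¹ * a * h) := by
            simp only [← map_mul]; congr 1; group
        _ = _ := by rw [this, mul_one]
    have hd : (h ^ k)⁻¹ * a⁻¹ * h ^ k * a ∈ D i := by
      apply (QuotientGroup.eq_one_iff _).1
      change p _ = 1
      simp only [map_inv, map_mul, map_pow]
      rw [mul_assoc, ← (hah.pow_right k).eq]; group
    refine ⟨k, q ((h ^ k)⁻¹ * a⁻¹ * h ^ k * a * c), ?_, ?_⟩
    · rintro _ ⟨y, hy, rfl⟩
      rw [map_mul]
      exact (hab _ hd y hy).mul_left ((hc y (hDK i hy)).map q)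
    · simp only [← map_mul, ← map_inv, ← map_pow]
      congr 1
      rw [htk]
      calc _ = a⁻¹ * h ^ k * (c * a) := by group
        _ = _ := by rw [(hc a ha).eq]; group

end VanishingCriteria

section RelativeSylow

set_option linter.unusedSectionVars false

variable {G : Type} [Group G] [Finite G]

theorem exists_fixed_of_not_dvd_card {α : Type} {p : ℕ} [Fact p.Prime] {Γ : Subgroup G}
    (hΓ : IsPGroup p Γ) (act : G → α → α) (h1 : ∀ a, act 1 a = a)
    (hmul : ∀ g h a, act (g * h) a = act g (act h a)) (Ω : Set α)
    (hΩ : ∀ γ ∈ Γ, ∀ a ∈ Ω, act γ a ∈ Ω) (hp : ¬ p ∣ Nat.card Ω) :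
    ∃ a ∈ Ω, ∀ γ ∈ Γ, act γ a = a := by
  let inst : MulAction Γ Ω :=
    { smul := fun γ a ↦ ⟨act γ a, hΩ γ γ.2 a a.2⟩
      one_smul := fun a ↦ Subtype.ext (h1 a)
      mul_smul := fun g h a ↦ Subtype.ext (hmul g h a) }
  obtain ⟨a, ha⟩ := hΓ.nonempty_fixed_point_of_prime_not_dvd_card Ω hp
  exact ⟨a, a.2, fun γ hγ ↦ congrArg Subtype.val (ha ⟨γ, hγ⟩)⟩

/-- `Γ` normalizes `K`. -/
def Normalizes (Γ K : Subgroup G) : Prop := ∀ γ ∈ Γ, ∀ x ∈ K, γ * x * γ⁻¹ ∈ K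

theorem normalizes_of_normal (Γ K : Subgroup G) [hK : K.Normal] : Normalizes Γ K :=
  fun γ _ x hx ↦ hK.conj_mem x hx γ

theorem exists_commute_of_not_dvd_card {p : ℕ} [Fact p.Prime] {Γ : Subgroup G}
    (hΓ : IsPGroup p Γ) (Ω : Set G) (hΩ : ∀ γ ∈ Γ, ∀ x ∈ Ω, γ * x * γ⁻¹ ∈ Ω)
    (hp : ¬ p ∣ Nat.card Ω) : ∃ x ∈ Ω, ∀ γ ∈ Γ, Commute γ x := by
  obtain ⟨x, hx, h⟩ := exists_fixed_of_not_dvd_card hΓ (fun γ x ↦ γ * x * γ⁻¹) (by simp)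
    (fun g h a ↦ by group) Ω hΩ hp
  exact ⟨x, hx, fun γ hγ ↦ mul_inv_eq_iff_eq_mul.1 (h γ hγ)⟩

/-- A conjugate of a subgroup. -/
def cj (g : G) (S : Subgroup G) : Subgroup G := S.map (MulAut.conj g).toMonoidHom

theorem mem_cj {g x : G} {S : Subgroup G} : x ∈ cj g S ↔ g⁻¹ * x * g ∈ S := by
  constructor
  · rintro ⟨y, hy, rfl⟩
    have : g⁻¹ * (MulAut.conj g).toMonoidHom y * g = y := by
      change g⁻¹ * (g * y * g⁻¹) * g = y
      group
    rwa [this]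
  · intro h
    refine ⟨_, h, ?_⟩
    change g * (g⁻¹ * x * g) * g⁻¹ = x
    group

theorem card_cj (g : G) (S : Subgroup G) : Nat.card (cj g S) = Nat.card S :=
  Subgroup.card_map_of_injective (MulAut.conj g).injective

theorem cj_one (S : Subgroup G) : cj 1 S = S := by ext; simp [mem_cj]

theorem cj_mul (g h : G) (S : Subgroup G) : cj (g * h) S = cj g (cj h S) := by
  ext; simp [mem_cj, mul_assoc]

theorem Normalizes.cj_eq {Γ K : Subgroup G} (h : Normalizes Γ K) {γ : G} (hγ : γ ∈ Γ) :
    cj γ K = K := by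
  ext x
  rw [mem_cj]
  constructor
  · intro hx
    have := h γ hγ _ hx
    simpa [mul_assoc] using this
  · intro hx
    have := h γ⁻¹ (Γ.inv_mem hγ) _ hx
    simpa using this

theorem cj_mono {g : G} {S K : Subgroup G} (h : S ≤ K) : cj g S ≤ cj g K :=
  Subgroup.map_mono h

theorem cj_eq_of_mem {g : G} {K : Subgroup G} (h : g ∈ K) : cj g K = K := by
  ext x
  rw [mem_cj, K.mul_mem_cancel_right h, K.mul_mem_cancel_left (K.inv_mem h)]

theorem normalizes_of_forall_cj_eq {Γ K : Subgroup G} (h : ∀ γ ∈ Γ, cj γ K = K) :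
    Normalizes Γ K := fun γ hγ x hx ↦ by
  rw [← h γ hγ, mem_cj]; simpa [mul_assoc] using hx

/-- `S` is a Sylow `r`-subgroup of `K`. -/
def IsSyl (r : ℕ) (K S : Subgroup G) : Prop :=
  S ≤ K ∧ Nat.card S = r ^ (Nat.card K).factorization r

variable {r : ℕ} [hr : Fact r.Prime]

theorem IsSyl.isPGroup {K S : Subgroup G} (h : IsSyl r K S) : IsPGroup r S :=
  IsPGroup.of_card h.2

theorem IsSyl.exists_sylow {K S : Subgroup G} (h : IsSyl r K S) :
    ∃ P : Sylow r K, (P : Subgroup K).map K.subtype = S := by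
  have h1 : Nat.card (S.subgroupOf K) = r ^ (Nat.card K).factorization r := by
    rw [← h.2]; exact Nat.card_congr (Subgroup.subgroupOfEquivOfLe h.1).toEquiv
  exact ⟨Sylow.ofCard (S.subgroupOf K) h1, Subgroup.map_subgroupOf_eq_of_le h.1⟩

theorem isSyl_map {K : Subgroup G} (P : Sylow r K) :
    IsSyl r K ((P : Subgroup K).map K.subtype) :=
  ⟨Subgroup.map_subtype_le _, by
    rw [Subgroup.card_map_of_injective K.subtype_injective, Sylow.card_eq_multiplicity]⟩

variable (r) in
theorem exists_isSyl (K : Subgroup G) : ∃ S, IsSyl r K S :=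
  ⟨_, isSyl_map (default : Sylow r K)⟩

theorem exists_isSyl_ge {A K : Subgroup G} (hAK : A ≤ K) (hA : IsPGroup r A) :
    ∃ S, IsSyl r K S ∧ A ≤ S := by
  have h1 : IsPGroup r (A.subgroupOf K) := hA.comap_subtype
  obtain ⟨P, hP⟩ := h1.exists_le_sylow
  refine ⟨_, isSyl_map P, ?_⟩
  rw [← Subgroup.map_subgroupOf_eq_of_le hAK]
  exact Subgroup.map_mono hP

theorem IsSyl.exists_cj {K S T : Subgroup G} (hS : IsSyl r K S) (hT : IsSyl r K T) :
    ∃ k ∈ K, T = cj k S := by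
  obtain ⟨P, rfl⟩ := hS.exists_sylow
  obtain ⟨Q, rfl⟩ := hT.exists_sylow
  obtain ⟨k, rfl⟩ := MulAction.exists_smul_eq K P Q
  refine ⟨k, k.2, ?_⟩
  ext x
  rw [mem_cj]
  constructor
  · rintro ⟨y, hy, rfl⟩
    obtain ⟨z, hz, rfl⟩ := hy
    exact ⟨z, hz, by simp [mul_assoc]⟩
  · rintro ⟨z, hz, hx⟩
    refine ⟨k * z * k⁻¹, ⟨z, hz, by simp⟩, ?_⟩
    have : (z : G) = (k : G)⁻¹ * x * k := hx
    simp [this, mul_assoc]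

theorem IsSyl.map_cj {K S : Subgroup G} (h : IsSyl r K S) (g : G) : IsSyl r (cj g K) (cj g S) :=
  ⟨cj_mono h.1, by rw [card_cj, card_cj, h.2]⟩

theorem card_isSyl_dvd (K : Subgroup G) :
    Nat.card {S : Subgroup G | IsSyl r K S} ∣ Nat.card K := by
  have h : Nat.card (Sylow r K) = Nat.card {S : Subgroup G | IsSyl r K S} := by
    refine Nat.card_congr (Equiv.ofBijective
      (fun P ↦ ⟨(P : Subgroup K).map K.subtype, isSyl_map P⟩) ⟨fun P Q h ↦ ?_, fun S ↦ ?_⟩)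
    · apply Sylow.ext
      exact Subgroup.map_injective K.subtype_injective (congrArg Subtype.val h)
    · obtain ⟨P, hP⟩ := S.2.exists_sylow
      exact ⟨P, Subtype.ext hP⟩
  rw [← h]
  exact ((default : Sylow r K).card_dvd_index).trans (Subgroup.index_dvd_card _)

variable {p : ℕ} [hp : Fact p.Prime]

/-- A `p`-group acting on a `p'`-group `K` normalizes a Sylow `r`-subgroup of `K`. -/
theorem exists_isSyl_normalizes {Γ K : Subgroup G} (hΓ : IsPGroup p Γ) (hK : Normalizes Γ K)
    (hpK : ¬ p ∣ Nat.card K) : ∃ S, IsSyl r K S ∧ Normalizes Γ S := by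
  obtain ⟨S, hS, h⟩ := exists_fixed_of_not_dvd_card hΓ cj cj_one cj_mul {S | IsSyl r K S}
    (fun γ hγ S hS ↦ by
      have := IsSyl.map_cj hS γ
      rwa [hK.cj_eq hγ] at this)
    (fun h ↦ hpK (h.trans (card_isSyl_dvd K)))
  exact ⟨S, hS, normalizes_of_forall_cj_eq h⟩

theorem exists_coset_commute {Γ Z : Subgroup G} (hΓ : IsPGroup p Γ) (hZ : Normalizes Γ Z)
    (hpZ : ¬ p ∣ Nat.card Z) {b : G} (hb : ∀ γ ∈ Γ, b⁻¹ * (γ * b * γ⁻¹) ∈ Z) :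
    ∃ z ∈ Z, ∀ γ ∈ Γ, Commute γ (b * z) := by
  have hcard : Nat.card {x | b⁻¹ * x ∈ Z} = Nat.card Z :=
    Nat.card_congr ((Equiv.mulLeft b⁻¹).subtypeEquiv fun x ↦ Iff.rfl)
  obtain ⟨x, hx, h⟩ := exists_commute_of_not_dvd_card hΓ {x | b⁻¹ * x ∈ Z} (fun γ hγ x hx ↦ by
    have := Z.mul_mem (hb γ hγ) (hZ γ hγ _ hx)
    simpa [mul_assoc] using this) (by rwa [hcard])
  exact ⟨b⁻¹ * x, hx, by simpa using h⟩

theorem normalizes_inf_normalizer {Γ K A : Subgroup G} (hK : Normalizes Γ K)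
    (hA : Normalizes Γ A) : Normalizes Γ (K ⊓ Subgroup.normalizer (A : Set G)) := by
  intro γ hγ x hx
  refine ⟨hK γ hγ x hx.1, ?_⟩
  change _ ∈ Subgroup.normalizer (A : Set G)
  rw [Subgroup.mem_normalizer_iff]
  intro y
  have h1 : ∀ z, z ∈ A ↔ γ * z * γ⁻¹ ∈ A := fun z ↦ by
    rw [← inv_inv γ, inv_inv γ⁻¹, ← mem_cj, hA.cj_eq (Γ.inv_mem hγ)]
  rw [show y = γ * (γ⁻¹ * y * γ) * γ⁻¹ by group, ← h1, Subgroup.mem_normalizer_iff.1 hx.2, h1]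
  refine iff_of_eq (congrArg (· ∈ A) ?_)
  group

theorem IsSyl.of_isSyl_normalizer {K A : Subgroup G}
    (hA : IsSyl r (K ⊓ Subgroup.normalizer (A : Set G)) A) : IsSyl r K A := by
  have hAK : A ≤ K := hA.1.trans inf_le_left
  obtain ⟨n, hn⟩ := IsPGroup.iff_card.1 hA.isPGroup
  obtain ⟨S, hS, hAS⟩ := exists_isSyl_ge hAK hA.isPGroup
  refine ⟨hAK, ?_⟩
  have hlt : n ≤ (Nat.card K).factorization r := by
    have := Subgroup.card_dvd_of_le hAS
    rw [hS.2, hn] at this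
    exact (Nat.pow_dvd_pow_iff_le_right hr.out.one_lt).1 this
  rcases hlt.eq_or_lt with h | h
  · rw [hn, h]
  exfalso
  have h1 : r ^ (n + 1) ∣ Nat.card K := (pow_dvd_pow r h).trans (Nat.ordProj_dvd _ _)
  have h2 : Nat.card (A.subgroupOf K) = r ^ n := by
    rw [← hn]; exact Nat.card_congr (Subgroup.subgroupOfEquivOfLe hAK).toEquiv
  have h3 := Sylow.prime_pow_dvd_card_normalizer h1 h2
  have h4 : Nat.card (Subgroup.normalizer (A.subgroupOf K : Set K)) =
      Nat.card (K ⊓ Subgroup.normalizer (A : Set G) : Subgroup G) := by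
    rw [← Subgroup.subgroupOf_normalizer_eq hAK, inf_comm, ← Subgroup.subgroupOf_map_subtype,
      Subgroup.card_map_of_injective K.subtype_injective]
  rw [h4, hr.out.pow_dvd_iff_le_factorization Nat.card_pos.ne'] at h3
  have h5 := hA.2
  rw [hn] at h5
  have := Nat.pow_right_injective hr.out.two_le h5
  omega

/-- A `p`-group acting on a `p'`-group `K`: an invariant `r`-subgroup is contained in an
invariant Sylow `r`-subgroup. -/
theorem exists_isSyl_normalizes_ge {Γ K A : Subgroup G} (hΓ : IsPGroup p Γ)
    (hK : Normalizes Γ K) (hpK : ¬ p ∣ Nat.card K) (hAK : A ≤ K) (hA : IsPGroup r A)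
    (hAΓ : Normalizes Γ A) : ∃ S, IsSyl r K S ∧ Normalizes Γ S ∧ A ≤ S := by
  obtain ⟨S, ⟨hSK, hS, hSΓ, hAS⟩, hmax⟩ := (Set.toFinite
    {S : Subgroup G | S ≤ K ∧ IsPGroup r S ∧ Normalizes Γ S ∧ A ≤ S}).exists_maximal
    ⟨A, hAK, hA, hAΓ, le_rfl⟩
  refine ⟨S, ?_, hSΓ, hAS⟩
  apply IsSyl.of_isSyl_normalizer
  set N := K ⊓ Subgroup.normalizer (S : Set G) with hN
  obtain ⟨T, hT, hTΓ⟩ := exists_isSyl_normalizes (r := r) hΓ (normalizes_inf_normalizer hK hSΓ)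
    (fun h ↦ hpK (h.trans (Subgroup.card_dvd_of_le inf_le_left)))
  obtain ⟨T', hT', hST'⟩ := exists_isSyl_ge (le_inf hSK Subgroup.le_normalizer) hS
  obtain ⟨k, hk, rfl⟩ := hT'.exists_cj hT
  have hST : S ≤ cj k T' := by
    have := cj_mono (g := k) hST'
    rwa [(show Normalizes N S from fun γ hγ x hx ↦
      (Subgroup.mem_normalizer_iff.1 hγ.2 x).1 hx).cj_eq hk] at this
  have h1 := hmax ⟨hT.1.trans inf_le_left, hT.isPGroup, hTΓ, hAS.trans hST⟩ hST
  rwa [le_antisymm hST h1]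

theorem normalizes_of_le_centralizer {Γ A : Subgroup G}
    (h : A ≤ Subgroup.centralizer (Γ : Set G)) : Normalizes Γ A := fun γ hγ x hx ↦ by
  rw [Subgroup.mem_centralizer_iff.1 (h hx) γ hγ]; simpa using hx

/-- An invariant Sylow subgroup of `K` meets the fixed points in a Sylow subgroup of
the fixed points. -/
theorem IsSyl.inf_centralizer {Γ K S : Subgroup G} (hΓ : IsPGroup p Γ) (hK : Normalizes Γ K)
    (hpK : ¬ p ∣ Nat.card K) (hS : IsSyl r K S) (hSΓ : Normalizes Γ S) :
    IsSyl r (K ⊓ Subgroup.centralizer (Γ : Set G)) (S ⊓ Subgroup.centralizer (Γ : Set G)) := by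
  set C := K ⊓ Subgroup.centralizer (Γ : Set G) with hC
  refine ⟨inf_le_inf_right _ hS.1, ?_⟩
  obtain ⟨A, hA⟩ := exists_isSyl r C
  obtain ⟨T, hT, hTΓ, hAT⟩ := exists_isSyl_normalizes_ge hΓ hK hpK (hA.1.trans inf_le_left)
    hA.isPGroup (normalizes_of_le_centralizer (hA.1.trans inf_le_right))
  obtain ⟨k, hk, rfl⟩ := hT.exists_cj hS
  set N := K ⊓ Subgroup.normalizer (T : Set G) with hN
  have hNn : Normalizes N T := fun γ hγ x hx ↦ (Subgroup.mem_normalizer_iff.1 hγ.2 x).1 hx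
  obtain ⟨z, hz, hzc⟩ := exists_coset_commute (b := k) hΓ (normalizes_inf_normalizer hK hTΓ)
    (fun h ↦ hpK (h.trans (Subgroup.card_dvd_of_le inf_le_left))) (fun γ hγ ↦ by
      refine ⟨K.mul_mem (K.inv_mem hk) (hK γ hγ k hk), ?_⟩
      have h1 : cj (k⁻¹ * (γ * k * γ⁻¹)) T = T := by
        rw [cj_mul, cj_mul, cj_mul, hTΓ.cj_eq (Γ.inv_mem hγ), hSΓ.cj_eq hγ, ← cj_mul,
          inv_mul_cancel, cj_one]
      change _ ∈ Subgroup.normalizer (T : Set G)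
      rw [Subgroup.mem_normalizer_iff]
      intro x
      nth_rw 2 [← h1]
      rw [mem_cj]
      refine iff_of_eq (congrArg (· ∈ T) ?_)
      group)
  have hkz : cj (k * z) T = cj k T := by rw [cj_mul, hNn.cj_eq hz]
  rw [← hkz]
  have hkC : k * z ∈ C := ⟨K.mul_mem hk hz.1, Subgroup.mem_centralizer_iff.2 hzc⟩
  have hAc := hA.map_cj (k * z)
  rw [cj_eq_of_mem hkC] at hAc
  have h1 : cj (k * z) A ≤ cj (k * z) T ⊓ Subgroup.centralizer (Γ : Set G) :=
    le_inf (cj_mono hAT) (hAc.1.trans inf_le_right)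
  have h2 := Subgroup.card_dvd_of_le h1
  rw [hAc.2] at h2
  obtain ⟨n, hn⟩ := IsPGroup.iff_card.1
    ((hT.isPGroup.map (MulAut.conj (k * z)).toMonoidHom).to_le
      (inf_le_left : cj (k * z) T ⊓ Subgroup.centralizer (Γ : Set G) ≤ _))
  have h3 : cj (k * z) T ⊓ Subgroup.centralizer (Γ : Set G) ≤ C := by
    rw [hkz]; exact inf_le_inf_right _ hS.1
  have h4 := Subgroup.card_dvd_of_le h3
  rw [hn] at h2 h4 ⊢
  exact congrArg _ (le_antisymm
    ((hr.out.pow_dvd_iff_le_factorization Nat.card_pos.ne').1 h4)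
    ((Nat.pow_dvd_pow_iff_le_right hr.out.one_lt).1 h2))

end RelativeSylow

section NormalComplements

set_option linter.unusedSectionVars false

variable {G : Type} [Group G] [Finite G] {r : ℕ} [hr : Fact r.Prime]

/-- The `r`-regular elements of `K` are closed under multiplication. -/
def RNilp (r : ℕ) (K : Subgroup G) : Prop :=
  ∀ x ∈ K, ∀ y ∈ K, ¬ r ∣ orderOf x → ¬ r ∣ orderOf y → ¬ r ∣ orderOf (x * y)

theorem orderOf_conj' (x g : G) : orderOf (g * x * g⁻¹) = orderOf x :=
  orderOf_injective (MulAut.conj g).toMonoidHom (MulAut.conj g).injective x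

/-- The subgroup of `r`-regular elements. -/
def regularPart (r : ℕ) [hr : Fact r.Prime] (K : Subgroup G) (h : RNilp r K) : Subgroup G where
  carrier := {x | x ∈ K ∧ ¬ r ∣ orderOf x}
  one_mem' := ⟨K.one_mem, by simp [hr.out.one_lt.ne']⟩
  mul_mem' := fun ha hb ↦ ⟨K.mul_mem ha.1 hb.1, h _ ha.1 _ hb.1 ha.2 hb.2⟩
  inv_mem' := fun ha ↦ ⟨K.inv_mem ha.1, by rw [orderOf_inv]; exact ha.2⟩

theorem mem_regularPart {K : Subgroup G} {h : RNilp r K} {x : G} :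
    x ∈ regularPart r K h ↔ x ∈ K ∧ ¬ r ∣ orderOf x := Iff.rfl

theorem regularPart_le {K : Subgroup G} {h : RNilp r K} : regularPart r K h ≤ K :=
  fun _ hx ↦ hx.1

instance normal_regularPart {K : Subgroup G} [hK : K.Normal] {h : RNilp r K} :
    (regularPart r K h).Normal :=
  ⟨fun x hx g ↦ ⟨hK.conj_mem x hx.1 g, by rw [orderOf_conj']; exact hx.2⟩⟩

theorem not_dvd_card_regularPart {K : Subgroup G} {h : RNilp r K} :
    ¬ r ∣ Nat.card (regularPart r K h) := by
  intro hd
  obtain ⟨x, hx⟩ := exists_prime_orderOf_dvd_card' r hd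
  apply x.2.2
  rw [Subgroup.orderOf_coe, hx]

theorem exists_mul_of_card_mul {K M R : Subgroup G} (hM : M ≤ K) (hR : R ≤ K)
    (hcard : Nat.card M * Nat.card R = Nat.card K) (hco : (Nat.card M).Coprime (Nat.card R))
    {k : G} (hk : k ∈ K) : ∃ m ∈ M, ∃ x ∈ R, k = m * x := by
  have h1 : Subgroup.IsComplement' (M.subgroupOf K) (R.subgroupOf K) := by
    apply Subgroup.isComplement'_of_coprime
    · rw [Nat.card_congr (Subgroup.subgroupOfEquivOfLe hM).toEquiv,
        Nat.card_congr (Subgroup.subgroupOfEquivOfLe hR).toEquiv, hcard]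
    · rwa [Nat.card_congr (Subgroup.subgroupOfEquivOfLe hM).toEquiv,
        Nat.card_congr (Subgroup.subgroupOfEquivOfLe hR).toEquiv]
  obtain ⟨⟨⟨m, hm⟩, ⟨x, hx⟩⟩, hmx⟩ := h1.2 ⟨k, hk⟩
  exact ⟨m, hm, x, hx, (congrArg Subtype.val hmx).symm⟩

theorem exists_pow_not_dvd_orderOf (x : G) : ∃ n : ℕ, ¬ r ∣ orderOf (x ^ r ^ n) := by
  obtain ⟨n, m, hm, h⟩ := Nat.exists_eq_pow_mul_and_not_dvd (orderOf_pos x).ne' r hr.out.ne_one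
  refine ⟨n, fun hd ↦ hm (hd.trans ?_)⟩
  apply orderOf_dvd_of_pow_eq_one
  rw [← pow_mul, ← h, pow_orderOf_eq_one]

theorem card_regularPart_mul {K : Subgroup G} (h : RNilp r K) :
    Nat.card (regularPart r K h) * r ^ (Nat.card K).factorization r = Nat.card K := by
  set M := regularPart r K h with hMdef
  have hn : (M.subgroupOf K).Normal := ⟨fun x hx g ↦ by
    refine ⟨(g * x * g⁻¹).2, ?_⟩
    change ¬ r ∣ orderOf ((g : G) * x * (g : G)⁻¹)
    rw [orderOf_conj']; exact hx.2⟩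
  have hp : IsPGroup r (K ⧸ M.subgroupOf K) := by
    intro x
    obtain ⟨x, rfl⟩ := QuotientGroup.mk_surjective x
    obtain ⟨n, hn⟩ := exists_pow_not_dvd_orderOf (r := r) (x : G)
    refine ⟨n, ?_⟩
    rw [← QuotientGroup.mk_pow, QuotientGroup.eq_one_iff]
    exact ⟨(x ^ r ^ n).2, hn⟩
  obtain ⟨n, hn⟩ := IsPGroup.iff_card.1 hp
  have h1 := Subgroup.card_mul_index (M.subgroupOf K)
  rw [Subgroup.index_eq_card, hn, Nat.card_congr (Subgroup.subgroupOfEquivOfLe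
    (regularPart_le : M ≤ K)).toEquiv] at h1
  have h2 : (Nat.card K).factorization r = n := by
    rw [← h1, Nat.factorization_mul Nat.card_pos.ne' (pow_pos hr.out.pos n).ne',
      hr.out.factorization_pow]
    have h3 : ¬ r ∣ Nat.card M := not_dvd_card_regularPart
    simp [← hMdef, Nat.factorization_eq_zero_of_not_dvd h3]
  rw [h2, h1]

theorem IsSyl.exists_mul_regularPart {K R : Subgroup G} (hR : IsSyl r K R) (h : RNilp r K)
    {k : G} (hk : k ∈ K) : ∃ m ∈ regularPart r K h, ∃ x ∈ R, k = m * x := by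
  refine exists_mul_of_card_mul regularPart_le hR.1 ?_ ?_ hk
  · rw [hR.2, card_regularPart_mul]
  · rw [hR.2]
    exact (Nat.Coprime.pow_left _ ((hr.out.coprime_iff_not_dvd).2 not_dvd_card_regularPart)).symm

/-- Burnside's transfer theorem. -/
theorem IsSyl.rNilp_of_normalizer {K R : Subgroup G} (hR : IsSyl r K R)
    (h : ∀ b ∈ K, (∀ x ∈ R, b * x * b⁻¹ ∈ R) → ∀ x ∈ R, Commute b x) : RNilp r K := by
  obtain ⟨P, rfl⟩ := hR.exists_sylow
  have hP : Subgroup.normalizer (P : Set K) ≤ Subgroup.centralizer (P : Set K) := by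
    intro b hb
    rw [Subgroup.mem_centralizer_iff]
    intro x hx
    have := h b b.2 (by
      rintro _ ⟨y, hy, rfl⟩
      exact ⟨_, (Subgroup.mem_normalizer_iff.1 hb y).1 hy, rfl⟩) x ⟨x, hx, rfl⟩
    exact Subtype.ext this.eq.symm
  have key : ∀ x : K, ¬ r ∣ orderOf (x : G) → x ∈ (MonoidHom.transferSylow P hP).ker := by
    intro x hx
    rw [MonoidHom.mem_ker]
    have h1 : orderOf (MonoidHom.transferSylow P hP x) ∣ orderOf (x : G) := by
      rw [Subgroup.orderOf_coe]; exact orderOf_map_dvd _ x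
    obtain ⟨n, hn⟩ := P.isPGroup' (MonoidHom.transferSylow P hP x)
    have h2 : (r ^ n).Coprime (orderOf (x : G)) :=
      ((hr.out.coprime_iff_not_dvd).2 hx).pow_left n
    have := Nat.dvd_gcd (orderOf_dvd_of_pow_eq_one hn) h1
    rw [h2.gcd_eq_one] at this
    exact orderOf_eq_one_iff.1 (Nat.dvd_one.1 this)
  intro x hx y hy hxr hyr hd
  have h1 := mul_mem (key ⟨x, hx⟩ hxr) (key ⟨y, hy⟩ hyr)
  apply MonoidHom.not_dvd_card_ker_transferSylow P hP
  refine hd.trans ?_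
  have := orderOf_dvd_natCard (⟨_, h1⟩ : (MonoidHom.transferSylow P hP).ker)
  rwa [← Subgroup.orderOf_coe, ← Subgroup.orderOf_coe] at this

theorem IsSyl.of_le {K L S : Subgroup G} (hS : IsSyl r K S) (h1 : S ≤ L) (h2 : L ≤ K) :
    IsSyl r L S := by
  refine ⟨h1, ?_⟩
  have h3 := Subgroup.card_dvd_of_le h1
  have h4 : r ^ (Nat.card L).factorization r ∣ Nat.card K :=
    (Nat.ordProj_dvd _ _).trans (Subgroup.card_dvd_of_le h2)
  rw [hS.2] at h3 ⊢
  rw [hr.out.pow_dvd_iff_le_factorization Nat.card_pos.ne'] at h3 h4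
  rw [le_antisymm h3 h4]

theorem IsSyl.mem_of_normalizes {K R : Subgroup G} (hR : IsSyl r K R) {y : G} (hy : y ∈ K)
    (hyR : y ∈ Subgroup.normalizer (R : Set G)) {n : ℕ} (hn : y ^ r ^ n = 1) : y ∈ R := by
  have hR' : IsSyl r (K ⊓ Subgroup.normalizer (R : Set G)) R :=
    hR.of_le (le_inf hR.1 Subgroup.le_normalizer) inf_le_left
  have hp : IsPGroup r (Subgroup.zpowers y) := by
    obtain ⟨m, -, hm⟩ := (Nat.dvd_prime_pow hr.out).1 (orderOf_dvd_of_pow_eq_one hn)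
    apply IsPGroup.of_card (n := m)
    rw [Nat.card_zpowers, hm]
  obtain ⟨T, hT, hyT⟩ := exists_isSyl_ge (A := Subgroup.zpowers y)
    (K := K ⊓ Subgroup.normalizer (R : Set G)) (by
      rw [Subgroup.zpowers_le]; exact ⟨hy, hyR⟩) hp
  obtain ⟨k, hk, rfl⟩ := hR'.exists_cj hT
  have : cj k R = R := by
    ext x
    rw [mem_cj]
    simpa using (Subgroup.mem_normalizer_iff.1 (inv_mem hk.2) x).symm
  rw [this] at hyT
  exact hyT (Subgroup.mem_zpowers y)

theorem prime_dvd_sub_one_of_fixedPoints {R : Type} [Group R] [Finite R] {τ : MulAut R} {l : ℕ}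
    (hl : l.Prime) (hτ : orderOf τ = l) (hlR : ¬ l ∣ Nat.card R) (D : Subgroup R)
    (hD : ∀ x ∈ D, τ x = x) : ∃ d, d ∣ Nat.card R ∧ d ≤ D.index ∧ d ≠ 1 ∧ l ∣ d - 1 := by
  have : Fact l.Prime := ⟨hl⟩
  let F : Subgroup R := MonoidHom.eqLocus τ.toMonoidHom (MonoidHom.id R)
  have hF : ∀ x, x ∈ F ↔ τ x = x := fun x ↦ Iff.rfl
  have hp : IsPGroup l (Subgroup.zpowers τ) :=
    IsPGroup.of_card (n := 1) (by rw [Nat.card_zpowers, hτ, pow_one])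
  have h1 := hp.card_modEq_card_fixedPoints R
  have h2 : MulAction.fixedPoints (Subgroup.zpowers τ) R = (F : Set R) := by
    ext x
    constructor
    · intro h
      exact h ⟨τ, Subgroup.mem_zpowers τ⟩
    · rintro h ⟨σ, hσ⟩
      have : Subgroup.zpowers τ ≤ MulAction.stabilizer (MulAut R) x := by
        rw [Subgroup.zpowers_le]; exact h
      exact this hσ
  rw [h2] at h1
  change Nat.card R ≡ Nat.card F [MOD l] at h1
  have h3 := Subgroup.card_mul_index F
  have h4 : ¬ l ∣ Nat.card F := fun h ↦ hlR (h.trans (Subgroup.card_subgroup_dvd_card F))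
  refine ⟨F.index, Subgroup.index_dvd_card F, ?_, ?_, ?_⟩
  · exact Nat.le_of_dvd (Nat.pos_of_ne_zero Subgroup.index_ne_zero_of_finite)
      (Subgroup.index_dvd_of_le fun x hx ↦ (hF x).2 (hD x hx))
  · intro h
    rw [Subgroup.index_eq_one] at h
    have : τ = 1 := by
      ext x
      exact (hF x).1 (h ▸ Subgroup.mem_top x)
    rw [this, orderOf_one] at hτ
    exact hl.one_lt.ne hτ
  · have h5 : (1 : ℕ) ≤ F.index := Nat.pos_of_ne_zero Subgroup.index_ne_zero_of_finite
    have h6 : Nat.card F * 1 ≡ Nat.card F * F.index [MOD l] := by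
      rw [h3, mul_one]; exact h1.symm
    have h7 := Nat.ModEq.cancel_left_of_coprime ((hl.coprime_iff_not_dvd).2 h4).gcd_eq_one h6
    exact (Nat.modEq_iff_dvd' h5).1 h7

/-- If `r` is the smallest prime dividing `|K|`, then an element of `K` normalizing an abelian
Sylow `r`-subgroup `R` and centralizing a large subgroup of `R` centralizes `R`. -/
theorem IsSyl.commute_of_relIndex {K R D : Subgroup G} (hR : IsSyl r K R)
    (hab : ∀ x ∈ R, ∀ y ∈ R, Commute x y)
    (hmin : ∀ q, q.Prime → q ∣ Nat.card K → r ≤ q) {b : G} (hbK : b ∈ K)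
    (hb : b ∈ Subgroup.normalizer (R : Set G)) (hD : ∀ x ∈ D, x ∈ R → Commute b x)
    (hidx : D.relIndex R ≤ r ∨ (D.relIndex R ≤ r ^ 2 ∧ r ≠ 2)) : ∀ x ∈ R, Commute b x := by
  set σ := Subgroup.normalizerMonoidHom R ⟨b, hb⟩ with hσ
  have hσa : ∀ (b' : Subgroup.normalizer (R : Set G)) (x : R),
      ((Subgroup.normalizerMonoidHom R b' x : R) : G) = b' * x * (b' : G)⁻¹ := fun b' x ↦ rfl
  suffices h : σ = 1 by
    intro x hx
    have h1 := hσa ⟨b, hb⟩ ⟨x, hx⟩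
    rw [← hσ, h] at h1
    exact mul_inv_eq_iff_eq_mul.1 h1.symm
  by_contra hne
  obtain ⟨a, ha⟩ : ∃ a, orderOf σ = a := ⟨_, rfl⟩
  have ha1 : a ≠ 1 := fun h ↦ hne (orderOf_eq_one_iff.1 (ha.trans h))
  have hl := Nat.minFac_prime ha1
  set l := a.minFac with hldef
  obtain ⟨m, hm⟩ := Nat.minFac_dvd a
  have hcb : orderOf σ ∣ orderOf b := by
    have := orderOf_map_dvd (Subgroup.normalizerMonoidHom R) (⟨b, hb⟩ : Subgroup.normalizer (R : Set G))
    rwa [← Subgroup.orderOf_coe] at this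
  have hlK : l ∣ Nat.card K := by
    refine (Nat.minFac_dvd a).trans (ha ▸ hcb.trans ?_)
    have := orderOf_dvd_natCard (⟨b, hbK⟩ : K)
    rwa [← Subgroup.orderOf_coe] at this
  have hlr : l ≠ r := by
    intro hlr
    set c := Nat.card K / r ^ (Nat.card K).factorization r with hc
    have hcr : ¬ r ∣ c := Nat.not_dvd_ordCompl hr.out Nat.card_pos.ne'
    have h1 : b ^ c ∈ R := by
      refine hR.mem_of_normalizes (K.pow_mem hbK c) (Subgroup.pow_mem _ hb c)
        (n := (Nat.card K).factorization r) ?_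
      rw [← pow_mul, Nat.div_mul_cancel (Nat.ordProj_dvd _ _)]
      have : (⟨b, hbK⟩ : K) ^ Nat.card K = 1 := pow_card_eq_one'
      exact congrArg Subtype.val this
    have h2 : σ ^ c = 1 := by
      rw [hσ, ← map_pow]
      ext x
      rw [hσa]
      change b ^ c * x * (b ^ c)⁻¹ = x
      rw [(hab _ h1 _ x.2).eq]; group
    apply hcr
    rw [← hlr]
    exact (Nat.minFac_dvd a).trans (ha ▸ orderOf_dvd_of_pow_eq_one h2)
  have hm0 : m ≠ 0 := by
    rintro rfl
    rw [mul_zero] at hm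
    exact (orderOf_pos σ).ne' (ha.trans hm)
  have hτ : orderOf (σ ^ m) = l := by
    rw [orderOf_pow_of_dvd hm0 (by rw [ha, hm]; exact dvd_mul_left _ _), ha]
    nth_rw 1 [hm]
    exact Nat.mul_div_cancel _ (Nat.pos_of_ne_zero hm0)
  have hlR : ¬ l ∣ Nat.card R := by
    rw [hR.2]
    intro h
    exact hlr ((Nat.prime_dvd_prime_iff_eq hl hr.out).1 (hl.dvd_of_dvd_pow h))
  obtain ⟨d, hd, hdle, hd1, hld⟩ := prime_dvd_sub_one_of_fixedPoints hl hτ hlR (D.subgroupOf R)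
    (by
      rintro x hx
      rw [hσ, ← map_pow]
      apply Subtype.ext
      rw [hσa]
      change b ^ m * x * (b ^ m)⁻¹ = x
      rw [((hD x hx x.2).pow_left m).eq]; group)
  change d ≤ D.relIndex R at hdle
  rw [hR.2, Nat.dvd_prime_pow hr.out] at hd
  obtain ⟨e, -, rfl⟩ := hd
  have hrl : r < l := lt_of_le_of_ne (hmin l hl hlK) hlr.symm
  have hr2 := hr.out.two_le
  have he0 : e ≠ 0 := fun h ↦ hd1 (by rw [h, pow_zero])
  have he1 : e ≠ 1 := by
    rintro rfl
    rw [pow_one] at hld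
    have := Nat.le_of_dvd (by omega) hld
    omega
  rcases hidx with h | ⟨h, hr3⟩
  · have := (Nat.pow_le_pow_iff_right hr.out.one_lt).1 (hdle.trans (h.trans_eq (pow_one r).symm))
    omega
  · have := (Nat.pow_le_pow_iff_right hr.out.one_lt).1 (hdle.trans h)
    obtain rfl : e = 2 := by omega
    have h1 : r ^ 2 - 1 = (r + 1) * (r - 1) := by
      have := Nat.sq_sub_sq r 1
      simpa using this
    rw [h1, hl.dvd_mul] at hld
    rcases hld with h | h
    · have h2 := Nat.le_of_dvd (by omega) h
      have h3 : l = r + 1 := by omega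
      have h4 := hr.out.eq_two_or_odd
      have h5 := hl.eq_two_or_odd
      omega
    · have := Nat.le_of_dvd (by omega) h
      omega

end NormalComplements

section CoprimeAction

set_option linter.unusedSectionVars false

variable {G : Type} [Group G] [Finite G] {r : ℕ} [hr : Fact r.Prime] {p : ℕ} [hp : Fact p.Prime]

theorem mem_centralizer_zpowers {g x : G} :
    x ∈ Subgroup.centralizer (Subgroup.zpowers g : Set G) ↔ Commute x g := by
  rw [Subgroup.mem_centralizer_iff]
  constructor
  · intro h; exact (h g (Subgroup.mem_zpowers g)).symm
  · rintro h _ ⟨n, rfl⟩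
    exact ((h.symm.zpow_left n).eq :)

theorem IsSyl.relIndex_eq {C K S T : Subgroup G} (hCK : C ≤ K) (hS : IsSyl r C S)
    (hT : IsSyl r K T) (hST : S ≤ T) : S.relIndex T = r ^ (C.relIndex K).factorization r := by
  have h1 := Subgroup.relIndex_mul_relIndex ⊥ S T bot_le hST
  have h2 := Subgroup.relIndex_mul_relIndex ⊥ C K bot_le hCK
  simp only [Subgroup.relIndex_bot_left] at h1 h2
  have h3 : C.relIndex K ≠ 0 := fun h ↦ by
    rw [h, mul_zero] at h2; exact Nat.card_pos.ne h2
  rw [hS.2, hT.2, ← h2, Nat.factorization_mul Nat.card_pos.ne' h3, Finsupp.add_apply,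
    pow_add] at h1
  exact Nat.eq_of_mul_eq_mul_left (pow_pos hr.out.pos _) h1

theorem isPGroup_zpowers {g : G} {n : ℕ} (hg : g ^ p ^ n = 1) :
    IsPGroup p (Subgroup.zpowers g) := by
  obtain ⟨m, -, hm⟩ := (Nat.dvd_prime_pow hp.out).1 (orderOf_dvd_of_pow_eq_one hg)
  apply IsPGroup.of_card (n := m)
  rw [Nat.card_zpowers, hm]

theorem coprime_orderOf_of_pow {g : G} {n m : ℕ} (hg : g ^ p ^ n = 1) (hm : ¬ p ∣ m) :
    (orderOf g).Coprime m :=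
  (((hp.out.coprime_iff_not_dvd).2 hm).pow_left n).coprime_dvd_left
    (orderOf_dvd_of_pow_eq_one hg)

theorem pow_card_eq_one_of_mem {K : Subgroup G} {x : G} (hx : x ∈ K) : x ^ Nat.card K = 1 := by
  have : (⟨x, hx⟩ : K) ^ Nat.card K = 1 := pow_card_eq_one'
  exact congrArg Subtype.val this

/-- For a coprime automorphism: an element whose commutator with `g` is fixed by `g` is fixed. -/
theorem commute_of_commutator_commute {K : Subgroup G} {g x : G} {n : ℕ} (hg : g ^ p ^ n = 1)
    (hpK : ¬ p ∣ Nat.card K) (hxK : x⁻¹ * g⁻¹ * x * g ∈ K)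
    (h : Commute (x⁻¹ * g⁻¹ * x * g) g) : Commute x g := by
  have h1 := eq_one_of_coprime_commutator (h := g) (n := x) (by group) h
    (pow_card_eq_one_of_mem hxK) (coprime_orderOf_of_pow hg hpK)
  calc x * g = g * x * (x⁻¹ * g⁻¹ * x * g) := by group
    _ = g * x := by rw [h1, mul_one]

/-- An `r`-group acted on coprimely with abelian fixed points of index at most `r` is abelian. -/
theorem commute_of_relIndex_inf_centralizer {R : Subgroup G} {g : G} {n : ℕ}
    (hg : g ^ p ^ n = 1) (hpR : ¬ p ∣ Nat.card R) (hR : IsPGroup r R)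
    (hgR : Normalizes (Subgroup.zpowers g) R)
    (hC : ∀ x ∈ R, ∀ y ∈ R, Commute x g → Commute y g → Commute x y)
    (hidx : (R ⊓ Subgroup.centralizer (Subgroup.zpowers g : Set G)).relIndex R = r) :
    (∀ x ∈ R, ∀ y ∈ R, Commute x y) ∧ r ≠ 2 := by
  set S := (R ⊓ Subgroup.centralizer (Subgroup.zpowers g : Set G)).subgroupOf R with hS
  have hSmem : ∀ x : R, x ∈ S ↔ Commute (x : G) g := fun x ↦ by
    rw [hS, Subgroup.mem_subgroupOf, Subgroup.mem_inf, mem_centralizer_zpowers]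
    exact ⟨fun h ↦ h.2, fun h ↦ ⟨x.2, h⟩⟩
  have hSidx : S.index = r := hidx
  have hSn : S.Normal := by
    apply Subgroup.normal_of_index_eq_minFac_card
    rw [hSidx]
    obtain ⟨m, hm⟩ := IsPGroup.iff_card.1 hR
    rw [hm]
    have : m ≠ 0 := by
      rintro rfl
      have h1 := Subgroup.index_dvd_card S
      rw [hSidx, hm, pow_zero] at h1
      exact hr.out.one_lt.ne' (Nat.dvd_one.1 h1)
    rw [Nat.pow_minFac this, hr.out.minFac_eq]
  obtain ⟨x, hx⟩ : ∃ x, x ∉ S := by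
    by_contra! h
    have : S = ⊤ := by ext; simp [h]
    rw [this, Subgroup.index_top] at hSidx
    exact hr.out.one_lt.ne hSidx
  have hgx : g⁻¹ * (x : G) * g ∈ R := by
    have := hgR g⁻¹ (inv_mem (Subgroup.mem_zpowers g)) x x.2
    simpa using this
  have hu : (x : G)⁻¹ * g⁻¹ * x * g ∈ R := by
    have := R.mul_mem (R.inv_mem x.2) hgx
    simpa [mul_assoc] using this
  have huS : (⟨_, hu⟩ : R) ∉ S := by
    intro h
    rw [hSmem] at h hx
    exact hx (commute_of_commutator_commute hg hpR hu h)
  have hcent : ∀ c ∈ S, Commute (⟨_, hu⟩ : R) c := by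
    intro c hc
    have h1 := (hSmem _).1 (hSn.conj_mem c hc x)
    have h2 := (hSmem _).1 hc
    apply Subtype.ext
    change (x : G)⁻¹ * g⁻¹ * x * g * c = c * ((x : G)⁻¹ * g⁻¹ * x * g)
    have h3 : (x : G) * c * (x : G)⁻¹ * g = g * (x * c * (x : G)⁻¹) := h1
    calc (x : G)⁻¹ * g⁻¹ * x * g * c = (x : G)⁻¹ * g⁻¹ * x * (c * g) := by rw [h2.eq]; group
      _ = (x : G)⁻¹ * g⁻¹ * (x * c * (x : G)⁻¹ * g) * g⁻¹ * x * g := by group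
      _ = _ := by rw [h3]; group
  have hSab : ∀ c ∈ S, ∀ d ∈ S, Commute c d := fun c hc d hd ↦
    Subtype.ext (hC c c.2 d d.2 ((hSmem c).1 hc) ((hSmem d).1 hd))
  have hcentralizer : Subgroup.centralizer (S : Set R) = ⊤ := by
    have h1 : S ≤ Subgroup.centralizer (S : Set R) := fun c hc ↦
      Subgroup.mem_centralizer_iff.2 fun d hd ↦ hSab d hd c hc
    have h2 := Subgroup.relIndex_mul_index h1
    rw [hSidx] at h2
    rcases (Nat.dvd_prime hr.out).1 ⟨_, h2.symm⟩ with h | h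
    · rw [Subgroup.relIndex_eq_one] at h
      exact absurd (h (Subgroup.mem_centralizer_iff.2 fun d hd ↦ (hcent d hd).symm)) huS
    · rw [h] at h2
      exact Subgroup.index_eq_one.1 (Nat.eq_of_mul_eq_mul_left hr.out.pos (h2.trans (mul_one r).symm))
  constructor
  · intro a ha b hb
    have : IsCyclic (R ⧸ S) := isCyclic_of_prime_card (p := r) (by
      rw [← Subgroup.index_eq_card, hSidx])
    have h1 := (MonoidHom.isMulCommutative_of_isCyclic_of_ker_le_center
      (QuotientGroup.mk' S) (by
      rw [QuotientGroup.ker_mk']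
      intro c hc
      rw [Subgroup.mem_center_iff]
      intro y
      have : y ∈ Subgroup.centralizer (S : Set R) := hcentralizer ▸ Subgroup.mem_top y
      exact (Subgroup.mem_centralizer_iff.1 this c hc).symm)).is_comm.comm ⟨a, ha⟩ ⟨b, hb⟩
    exact congrArg Subtype.val h1
  · rintro rfl
    apply huS
    have h1 : (⟨_, hgx⟩ : R) ∉ S := by
      intro h
      apply hx
      rw [hSmem] at h ⊢
      have h2 : g⁻¹ * (x : G) * g * g = g * (g⁻¹ * (x : G) * g) := h
      have h3 : (x : G) * g = g * (g⁻¹ * x * g) := by group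
      rw [Commute, SemiconjBy, h3, ← h2]
      have h4 : g⁻¹ * (x : G) * g * g = (x : G) * g := by rw [h2]; group
      have h5 : g⁻¹ * (x : G) * g = x := mul_right_cancel h4
      rw [h5, h3, h5]
    have h2 := (Subgroup.mul_mem_iff_of_index_two hSidx (a := x⁻¹) (b := ⟨_, hgx⟩)).2
      (by simp [hx, h1])
    convert h2 using 1
    apply Subtype.ext
    change (x : G)⁻¹ * g⁻¹ * x * g = (x : G)⁻¹ * (g⁻¹ * x * g)
    group

/-- Existence of a normal `r`-complement from a coprime automorphism with abelian fixed points
of index not divisible by `r²`, where `r` is the smallest prime divisor. -/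
theorem rNilp_of_coprime_action {K : Subgroup G} {g : G} {n : ℕ} (hg : g ^ p ^ n = 1)
    (hK : Normalizes (Subgroup.zpowers g) K) (hpK : ¬ p ∣ Nat.card K)
    (hC : ∀ x ∈ K, ∀ y ∈ K, Commute x g → Commute y g → Commute x y)
    (hmin : ∀ q, q.Prime → q ∣ Nat.card K → r ≤ q)
    (hidx : ¬ r ^ 2 ∣ (K ⊓ Subgroup.centralizer (Subgroup.zpowers g : Set G)).relIndex K) :
    RNilp r K := by
  set Γ := Subgroup.zpowers g with hΓdef
  have hΓ : IsPGroup p Γ := isPGroup_zpowers hg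
  obtain ⟨R, hR, hRΓ⟩ := exists_isSyl_normalizes (r := r) hΓ hK hpK
  have hpR : ¬ p ∣ Nat.card R := fun h ↦ hpK (h.trans (Subgroup.card_dvd_of_le hR.1))
  have hCR : ∀ x ∈ R, ∀ y ∈ R, Commute x g → Commute y g → Commute x y :=
    fun x hx y hy ↦ hC x (hR.1 hx) y (hR.1 hy)
  set R1 := R ⊓ Subgroup.centralizer (Γ : Set G) with hR1
  have hR1mem : ∀ x, x ∈ R1 ↔ x ∈ R ∧ Commute x g := fun x ↦ by
    rw [hR1, Subgroup.mem_inf, mem_centralizer_zpowers]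
  have hrel := IsSyl.relIndex_eq inf_le_left (hR.inf_centralizer hΓ hK hpK hRΓ) hR inf_le_left
  have hle : ((K ⊓ Subgroup.centralizer (Γ : Set G)).relIndex K).factorization r < 2 := by
    by_contra! h
    have h0 : (K ⊓ Subgroup.centralizer (Γ : Set G)).relIndex K ≠ 0 :=
      Subgroup.index_ne_zero_of_finite
    exact hidx ((hr.out.pow_dvd_iff_le_factorization h0).2 h)
  have hcase : R1.relIndex R = 1 ∨ R1.relIndex R = r := by
    rw [hrel]
    interval_cases ((K ⊓ Subgroup.centralizer (Γ : Set G)).relIndex K).factorization r <;> simp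
  have hab : (∀ x ∈ R, ∀ y ∈ R, Commute x y) ∧ (R1.relIndex R = 1 ∨ (R1.relIndex R = r ∧ r ≠ 2)) := by
    rcases hcase with h | h
    · refine ⟨fun x hx y hy ↦ ?_, Or.inl h⟩
      rw [Subgroup.relIndex_eq_one] at h
      exact hCR x hx y hy ((hR1mem x).1 (h hx)).2 ((hR1mem y).1 (h hy)).2
    · have := commute_of_relIndex_inf_centralizer hg hpR hR.isPGroup hRΓ hCR h
      exact ⟨this.1, Or.inr ⟨h, this.2⟩⟩
  obtain ⟨hab, hcase⟩ := hab
  have hr1 := hr.out.one_lt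
  set Z := K ⊓ Subgroup.centralizer (R : Set G) with hZdef
  have hZmem : ∀ x, x ∈ Z ↔ x ∈ K ∧ ∀ y ∈ R, Commute x y := fun x ↦ by
    rw [hZdef, Subgroup.mem_inf, Subgroup.mem_centralizer_iff]
    exact and_congr_right fun _ ↦ forall₂_congr fun y _ ↦ ⟨fun h ↦ h.symm, fun h ↦ h.symm⟩
  have hZΓ : Normalizes Γ Z := by
    intro γ hγ x hx
    rw [hZmem] at hx ⊢
    refine ⟨hK γ hγ x hx.1, fun y hy ↦ ?_⟩
    have h1 : γ⁻¹ * y * γ ∈ R := by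
      have := hRΓ γ⁻¹ (Γ.inv_mem hγ) y hy
      simpa using this
    have h2 := (hx.2 _ h1).eq
    calc γ * x * γ⁻¹ * y = γ * (x * (γ⁻¹ * y * γ)) * γ⁻¹ := by group
      _ = _ := by rw [h2]; group
  have stepA : ∀ b ∈ K, b ∈ Subgroup.normalizer (R : Set G) →
      (∀ γ ∈ Γ, b⁻¹ * (γ * b * γ⁻¹) ∈ Z) → b ∈ Z := by
    intro b hbK hb hbΓ
    obtain ⟨z, hz, hzc⟩ := exists_coset_commute hΓ hZΓ
      (fun h ↦ hpK (h.trans (Subgroup.card_dvd_of_le inf_le_left))) hbΓ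
    have hzn : z ∈ Subgroup.normalizer (R : Set G) := by
      refine Subgroup.mem_normalizer_fintype fun y hy ↦ ?_
      rw [(((hZmem z).1 hz).2 y hy).eq, mul_inv_cancel_right]
      exact hy
    have h1 := hR.commute_of_relIndex (D := R1) hab hmin (K.mul_mem hbK hz.1)
      (Subgroup.mul_mem _ hb hzn) (fun x hx _ ↦ hC _ (K.mul_mem hbK hz.1) x (hR.1 hx.1)
        (hzc g (Subgroup.mem_zpowers g)).symm ((hR1mem x).1 hx).2)
      (Or.inl (by rcases hcase with h | h <;> [omega; exact h.1.le]))
    have h2 : b * z ∈ Z := (hZmem _).2 ⟨K.mul_mem hbK hz.1, h1⟩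
    exact (Z.mul_mem_cancel_right hz).1 h2
  have hnorm : ∀ b ∈ K, b ∈ Subgroup.normalizer (R : Set G) → b ∈ Z := by
    intro b hbK hb
    apply stepA b hbK hb
    intro γ hγ
    have hγK : b⁻¹ * (γ * b * γ⁻¹) ∈ K := K.mul_mem (K.inv_mem hbK) (hK γ hγ b hbK)
    have hγR : b⁻¹ * (γ * b * γ⁻¹) ∈ Subgroup.normalizer (R : Set G) := by
      have := (normalizes_inf_normalizer hK hRΓ γ hγ b ⟨hbK, hb⟩).2
      exact Subgroup.mul_mem _ (Subgroup.inv_mem _ hb) this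
    have hγc : ∀ x ∈ R1, Commute γ x := fun x hx ↦
      (Subgroup.mem_centralizer_iff.1 hx.2 γ hγ)
    refine (hZmem _).2 ⟨hγK, hR.commute_of_relIndex (D := R1 ⊓ cj b⁻¹ R1) hab hmin hγK hγR ?_ ?_⟩
    · intro x hx _
      have h1 := hγc x hx.1
      have h2 : b * x * b⁻¹ ∈ R1 := by
        have := mem_cj.1 hx.2
        rwa [inv_inv] at this
      have h3 := (hγc _ h2).eq
      calc b⁻¹ * (γ * b * γ⁻¹) * x = b⁻¹ * γ * b * (γ⁻¹ * x) := by group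
        _ = b⁻¹ * (γ * (b * x * b⁻¹)) * b * γ⁻¹ := by rw [h1.inv_left.eq]; group
        _ = _ := by rw [h3]; group
    · have h1 : (cj b⁻¹ R1).relIndex R = R1.relIndex R := by
        have h2 : cj b⁻¹ R = R := by
          ext x
          rw [mem_cj, inv_inv]
          exact (Subgroup.mem_normalizer_iff.1 hb x).symm
        nth_rw 1 [← h2]
        exact Subgroup.relIndex_map_map_of_injective _ _ (MulAut.conj b⁻¹).injective
      have h3 := Subgroup.relIndex_inf_le (H := R1) (K := cj b⁻¹ R1) (L := R)
      rw [h1] at h3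
      rcases hcase with h | ⟨h, h'⟩
      · rw [h] at h3; left; omega
      · rw [h] at h3; right; exact ⟨by rw [sq]; exact h3, h'⟩
  refine hR.rNilp_of_normalizer fun b hbK hb ↦ ?_
  have hbn : b ∈ Subgroup.normalizer (R : Set G) := Subgroup.mem_normalizer_fintype hb
  exact ((hZmem b).1 (hnorm b hbK hbn)).2

end CoprimeAction

section Modular

set_option linter.unusedSectionVars false

theorem exists_residue_field (r : ℕ) [hr : Fact r.Prime] :
    ∃ (k : Type) (_ : Field k) (_ : integralClosure ℤ ℂ →+* k), CharP k r ∧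
      ∀ x : k, x ≠ 0 → ∃ n, 0 < n ∧ x ^ n = 1 := by
  have hnu : ¬ IsUnit (r : integralClosure ℤ ℂ) := by
    intro h
    obtain ⟨b, hb⟩ := h.exists_right_inv
    have h1 : (r : ℂ) * b = 1 := by exact_mod_cast congrArg Subtype.val hb
    have h2 : IsIntegral ℤ (algebraMap ℚ ℂ ((r : ℚ)⁻¹)) := by
      have : (b : ℂ) = algebraMap ℚ ℂ ((r : ℚ)⁻¹) := by
        rw [map_inv₀, map_natCast, eq_inv_of_mul_eq_one_right h1]
      rw [← this]
      exact b.2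
    rw [isIntegral_algebraMap_iff (algebraMap ℚ ℂ).injective] at h2
    obtain ⟨z, hz⟩ := IsIntegrallyClosed.isIntegral_iff.1 h2
    have h3 : (r : ℚ) * z = 1 := by
      have : (z : ℚ) = (r : ℚ)⁻¹ := hz
      rw [this, mul_inv_cancel₀ (by exact_mod_cast hr.out.ne_zero)]
    have h4 : (r : ℤ) * z = 1 := by exact_mod_cast h3
    have h5 := Int.isUnit_iff_natAbs_eq.1 (IsUnit.of_mul_eq_one _ h4)
    rw [Int.natAbs_natCast] at h5
    exact hr.out.one_lt.ne' h5
  obtain ⟨I, hI, hrI⟩ := exists_max_ideal_of_mem_nonunits hnu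
  have hchar : CharP (integralClosure ℤ ℂ ⧸ I) r := by
    have h0 : ((r : ℕ) : integralClosure ℤ ℂ ⧸ I) = 0 := by
      rw [← map_natCast (Ideal.Quotient.mk I)]
      exact Ideal.Quotient.eq_zero_iff_mem.2 hrI
    have : Nontrivial (integralClosure ℤ ℂ ⧸ I) := Ideal.Quotient.nontrivial_iff.2 hI.ne_top
    exact (CharP.charP_iff_prime_eq_zero hr.out).2 h0
  refine ⟨_, Ideal.Quotient.field I, Ideal.Quotient.mk I, hchar, fun x hx ↦ ?_⟩
  let _ := Ideal.Quotient.field I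
  let _ : Algebra (ZMod r) (integralClosure ℤ ℂ ⧸ I) := ZMod.algebra _ r
  have hint : IsIntegral (ZMod r) x := by
    obtain ⟨y, rfl⟩ := Ideal.Quotient.mk_surjective x
    have h1 : IsIntegral ℤ y := (isIntegral_algebraMap_iff
      (FaithfulSMul.algebraMap_injective (integralClosure ℤ ℂ) ℂ)).1 y.2
    have h2 : IsIntegral ℤ (Ideal.Quotient.mk I y) := h1.map (Ideal.Quotient.mkₐ ℤ I)
    exact h2.tower_top
  have hfin : Module.Finite (ZMod r) (Algebra.adjoin (ZMod r) {x}) :=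
    Module.Finite.iff_fg.2 hint.fg_adjoin_singleton
  have : Finite (Algebra.adjoin (ZMod r) {x}) := Module.finite_of_finite (ZMod r)
  obtain ⟨a, b, hab, h⟩ := Finite.exists_ne_map_eq_of_infinite fun n : ℕ ↦
    ((⟨x, Algebra.self_mem_adjoin_singleton _ x⟩ : Algebra.adjoin (ZMod r) {x}) ^ n)
  have h' : x ^ a = x ^ b := congrArg Subtype.val h
  rcases lt_or_gt_of_ne hab with hlt | hlt
  · refine ⟨b - a, by omega, ?_⟩
    apply mul_left_cancel₀ (pow_ne_zero a hx)
    rw [← pow_add, mul_one, h']; congr 1; omega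
  · refine ⟨a - b, by omega, ?_⟩
    apply mul_left_cancel₀ (pow_ne_zero b hx)
    rw [← pow_add, mul_one, ← h']; congr 1; omega

variable {P : Type} [Group P] [Finite P] {r : ℕ} [hr : Fact r.Prime]
  {k : Type} [Field k] (φ : integralClosure ℤ ℂ →+* k) [CharP k r]

/-- Irreducible characters with values reduced along `φ`. -/
def mch (i : Irr P) (x : P) : k := φ ⟨ch i x, ch_isIntegral i x⟩

theorem mch_one (i : Irr P) : mch φ i 1 = deg i := by
  rw [← map_natCast φ, mch]
  congr 1
  apply Subtype.ext
  push_cast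
  exact ch_one i

theorem mch_conj (i : Irr P) (g x : P) : mch φ i (g * x * g⁻¹) = mch φ i x := by
  simp only [mch, ch_conj]

theorem mch_pow (i : Irr P) (x : P) (n : ℕ) : mch φ i (x ^ r ^ n) = mch φ i x ^ r ^ n := by
  have hn0 : Nat.card P ≠ 0 := Nat.card_pos.ne'
  have hζ := Complex.isPrimitiveRoot_exp _ hn0
  obtain ⟨Q, hQ⟩ := exists_polynomial i x pow_card_eq_one' hn0 hζ
  set Z : integralClosure ℤ ℂ := ⟨_, hζ.isIntegral (Nat.pos_of_ne_zero hn0)⟩ with hZ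
  have h1 (j : ℕ) : mch φ i (x ^ j) = Q.aeval (φ Z ^ j) := by
    have : (⟨ch i (x ^ j), ch_isIntegral i _⟩ : integralClosure ℤ ℂ) = Q.aeval (Z ^ j) := by
      apply Subtype.ext
      change ch i (x ^ j) = (integralClosure ℤ ℂ).val _
      rw [hQ, ← Polynomial.aeval_algHom_apply]
      rfl
    rw [mch, this, ← map_pow]
    exact (Polynomial.aeval_algHom_apply φ.toIntAlgHom _ Q).symm
  have h2 := h1 1
  rw [pow_one, pow_one] at h2
  rw [h1, h2]
  exact Polynomial.aeval_algHom_apply (iterateFrobenius k r n).toIntAlgHom (φ Z) Q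

/-- The sum of a set of group elements in the group algebra. -/
def ssum (S : Finset P) : MonoidAlgebra ℂ P := ∑ x ∈ S, gof x

theorem ssum_eq_map (S : Finset P) : ssum S =
    MonoidAlgebra.mapRingHom P (Int.castRingHom ℂ) (∑ x ∈ S, MonoidAlgebra.single x (1 : ℤ)) := by
  rw [map_sum]
  refine Finset.sum_congr rfl fun x _ ↦ ?_
  ext y
  rw [MonoidAlgebra.coeff_mapRingHom, gof_apply, MonoidAlgebra.coeff_single,
    MonoidAlgebra.coeff_single, Finsupp.single_apply, Finsupp.single_apply]
  split_ifs <;> simp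

theorem ssum_commute {S : Finset P} (hS : ∀ x ∈ S, ∀ g, g * x * g⁻¹ ∈ S) (g : P) :
    gof g * ssum S = ssum S * gof g := by
  rw [ssum, Finset.mul_sum, Finset.sum_mul]
  refine Finset.sum_bij (fun y _ ↦ g * y * g⁻¹) (fun y hy ↦ hS y hy g) (fun y _ z _ h ↦ by
    simpa using h) (fun y hy ↦ ⟨g⁻¹ * y * g, by simpa using hS y hy g⁻¹, by group⟩) fun y _ ↦ ?_
  rw [← map_mul, ← map_mul]; simp

theorem isIntegral_ssum_div {S : Finset P} (hS : ∀ x ∈ S, ∀ g, g * x * g⁻¹ ∈ S) (i : Irr P) :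
    IsIntegral ℤ (chi i (ssum S) / deg i) := by
  have h1 : IsIntegral ℤ (∑ x ∈ S, MonoidAlgebra.single x (1 : ℤ)) := by
    have : Module.Finite ℤ (MonoidAlgebra ℤ P) := inferInstance
    exact IsIntegral.of_finite ℤ _
  have h2 : IsIntegral ℤ (rho i (ssum S)) := by
    rw [ssum_eq_map]
    exact h1.map (((rho i).toRingHom.comp (MonoidAlgebra.mapRingHom P
      (Int.castRingHom ℂ))).toIntAlgHom)
  rw [rho_eq_smul_one (ssum_commute hS), ← Algebra.algebraMap_eq_smul_one] at h2
  exact (isIntegral_algebraMap_iff (FaithfulSMul.algebraMap_injective _ _)).1 h2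

/-- The reduced central character at a conjugation invariant set. -/
def mom {S : Finset P} (hS : ∀ x ∈ S, ∀ g, g * x * g⁻¹ ∈ S) (i : Irr P) : k :=
  φ ⟨_, isIntegral_ssum_div hS i⟩

theorem sum_mch_mul {S : Finset P} (hS : ∀ x ∈ S, ∀ g, g * x * g⁻¹ ∈ S) (i : Irr P) (y : P) :
    ∑ g ∈ S, mch φ i (y * g) = mom φ hS i * mch φ i y := by
  unfold mch mom
  rw [← map_sum, ← map_mul]
  congr 1
  apply Subtype.ext
  push_cast
  have h : chi i (gof y * ssum S) = chi i (ssum S) / deg i * ch i y := by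
    rw [chi_apply, map_mul, rho_eq_smul_one (ssum_commute hS), mul_smul_comm, mul_one,
      Matrix.trace_smul, ← ch_def, smul_eq_mul]
  rw [← h, ssum, Finset.mul_sum, map_sum]
  refine Finset.sum_congr rfl fun g _ ↦ ?_
  rw [← map_mul]; rfl

theorem sum_deg_sq_mul_mom_pow {S : Finset P} (hS : ∀ x ∈ S, ∀ g, g * x * g⁻¹ ∈ S)
    (hP : r ∣ Nat.card P) (N : ℕ) : ∑ i, (deg i : k) ^ 2 * mom φ hS i ^ N = 0 := by
  have h1 := card_mul_coeff_one (ssum S ^ N)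
  obtain ⟨z, hz⟩ : ∃ z : ℤ, (ssum S ^ N).coeff 1 = z := by
    rw [ssum_eq_map, ← map_pow, MonoidAlgebra.coeff_mapRingHom]
    exact ⟨_, rfl⟩
  have h2 (i : Irr P) : chi i (ssum S ^ N) = deg i * (chi i (ssum S) / deg i) ^ N := by
    rw [chi_apply, map_pow, rho_eq_smul_one (ssum_commute hS), smul_pow, one_pow,
      Matrix.trace_smul, Matrix.trace_one, smul_eq_mul, Fintype.card_fin, mul_comm]
  simp_rw [hz, h2] at h1
  have h3 : ((Nat.card P : ℕ) : integralClosure ℤ ℂ) * z =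
      ∑ i : Irr P, (deg i : integralClosure ℤ ℂ) ^ 2 * ⟨_, isIntegral_ssum_div hS i⟩ ^ N := by
    apply Subtype.ext
    push_cast
    rw [h1]
    exact Finset.sum_congr rfl fun i _ ↦ by ring
  have h4 := congrArg φ h3
  simp only [map_sum, map_mul, map_pow, map_natCast, (CharP.cast_eq_zero_iff k r _).2 hP,
    zero_mul] at h4
  exact h4.symm

end Modular

section ModularCongruence

set_option linter.unusedSectionVars false

variable {P : Type} [Group P] [Finite P] {r : ℕ} [hr : Fact r.Prime]

variable (P r) in
/-- The `r`-regular elements. -/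
def rreg : Finset P := (Set.toFinite {x : P | ¬ r ∣ orderOf x}).toFinset

theorem mem_rreg {x : P} : x ∈ rreg P r ↔ ¬ r ∣ orderOf x := by simp [rreg]

theorem rreg_conj : ∀ x ∈ rreg P r, ∀ g, g * x * g⁻¹ ∈ rreg P r := by
  intro x hx g
  rw [mem_rreg] at hx ⊢
  rwa [orderOf_conj']

theorem card_modEq_card_commute {R : Subgroup P} (hR : IsPGroup r R) (S : Finset P)
    (hS : ∀ x ∈ S, ∀ g ∈ R, g * x * g⁻¹ ∈ S) :
    S.card ≡ (S.filter fun x ↦ x ∈ Subgroup.centralizer (R : Set P)).card [MOD r] := by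
  let inst : MulAction R S :=
    { smul := fun g x ↦ ⟨g * x * (g : P)⁻¹, hS x x.2 g g.2⟩
      one_smul := fun x ↦ Subtype.ext (by change (1 : P) * x * (1 : P)⁻¹ = x; simp)
      mul_smul := fun g h x ↦ Subtype.ext (by
        change ((g : P) * h) * x * ((g : P) * h)⁻¹ = g * (h * x * (h : P)⁻¹) * (g : P)⁻¹; group) }
  have h := hR.card_modEq_card_fixedPoints S
  rw [Nat.card_eq_fintype_card, Fintype.card_coe] at h
  convert h using 1
  rw [← Fintype.card_coe, ← Nat.card_eq_fintype_card]
  refine Nat.card_congr ⟨fun x ↦ ⟨⟨x.1, (Finset.mem_filter.1 x.2).1⟩, fun g ↦ Subtype.ext ?_⟩,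
    fun x ↦ ⟨x.1.1, Finset.mem_filter.2 ⟨x.1.2, Subgroup.mem_centralizer_iff.2 fun g hg ↦ ?_⟩⟩,
    fun x ↦ rfl, fun x ↦ rfl⟩
  · exact mul_inv_eq_of_eq_mul
      (Subgroup.mem_centralizer_iff.1 (Finset.mem_filter.1 x.2).2 g g.2)
  · exact mul_inv_eq_iff_eq_mul.1 (congrArg Subtype.val (x.2 ⟨g, hg⟩))

variable {k : Type} [Field k] [CharP k r]

theorem sum_eq_sum_commute {R : Subgroup P} (hR : IsPGroup r R) (S : Finset P)
    (hS : ∀ x ∈ S, ∀ g ∈ R, g * x * g⁻¹ ∈ S) (f : P → k)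
    (hf : ∀ x, ∀ g ∈ R, f (g * x * g⁻¹) = f x) :
    ∑ x ∈ S, f x = ∑ x ∈ S with x ∈ Subgroup.centralizer (R : Set P), f x := by
  have h1 : ∀ T ⊆ S, ∑ x ∈ T, f x = ∑ v ∈ S.image f, ((T.filter fun x ↦ f x = v).card : k) * v := by
    intro T hT
    rw [← Finset.sum_fiberwise_of_maps_to (t := S.image f) (g := f)
      fun x hx ↦ Finset.mem_image_of_mem f (hT hx)]
    refine Finset.sum_congr rfl fun v _ ↦ ?_
    rw [Finset.sum_congr rfl fun x hx ↦ (Finset.mem_filter.1 hx).2, Finset.sum_const, nsmul_eq_mul]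
  rw [h1 S subset_rfl, h1 _ (Finset.filter_subset _ _)]
  refine Finset.sum_congr rfl fun v _ ↦ ?_
  congr 1
  rw [Finset.filter_comm]
  refine (CharP.cast_eq_iff_mod_eq k r).2 (card_modEq_card_commute hR _ fun x hx g hg ↦ ?_)
  rw [Finset.mem_filter] at hx ⊢
  exact ⟨hS x hx.1 g hg, by rw [hf x g hg, hx.2]⟩

theorem sum_rreg_mul {R : Subgroup P} (hR : IsPGroup r R)
    (hD : RNilp r (Subgroup.centralizer (R : Set P))) (f : P → k)
    (hf : ∀ x g, f (g * x * g⁻¹) = f x) {y : P} (hy : ¬ r ∣ orderOf y)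
    (hyR : y ∈ Subgroup.centralizer (R : Set P)) :
    ∑ g ∈ rreg P r, f (y * g) = ∑ g ∈ rreg P r, f g := by
  rw [sum_eq_sum_commute hR _ (fun x hx g _ ↦ rreg_conj x hx g) f fun x g _ ↦ hf x g,
    sum_eq_sum_commute hR _ (fun x hx g _ ↦ rreg_conj x hx g) (fun g ↦ f (y * g)) ?_]
  · refine Finset.sum_bij (fun g _ ↦ y * g) ?_ (fun _ _ _ _ h ↦ mul_left_cancel h) ?_
      fun _ _ ↦ rfl
    · intro g hg
      rw [Finset.mem_filter, mem_rreg] at hg ⊢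
      exact ⟨hD _ hyR _ hg.2 hy hg.1, Subgroup.mul_mem _ hyR hg.2⟩
    · intro g hg
      rw [Finset.mem_filter, mem_rreg] at hg
      refine ⟨y⁻¹ * g, ?_, by simp⟩
      rw [Finset.mem_filter, mem_rreg]
      exact ⟨hD _ (inv_mem hyR) _ hg.2 (by rwa [orderOf_inv]) hg.1,
        Subgroup.mul_mem _ (inv_mem hyR) hg.2⟩
  · intro x g hg
    have h1 : g * y = y * g := Subgroup.mem_centralizer_iff.1 hyR g hg
    have h2 : y * (g * x * g⁻¹) = g * (y * x) * g⁻¹ := by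
      rw [← mul_assoc, ← mul_assoc, ← h1, mul_assoc g y x]
    rw [h2, hf]

/-- If `r` is the smallest prime divisor of `|P|` and `R` is an `r`-subgroup whose index in a
Sylow subgroup is at most `r`, then the centralizer of `R` has a normal `r`-complement. -/
theorem rNilp_centralizer (hmin : ∀ q, q.Prime → q ∣ Nat.card P → r ≤ q) {R : Subgroup P}
    (hR : IsPGroup r R) (hidx : ¬ Nat.card R * r ^ 2 ∣ Nat.card P) :
    RNilp r (Subgroup.centralizer (R : Set P)) := by
  obtain ⟨T, hT⟩ := exists_isSyl r (Subgroup.centralizer (R : Set P))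
  have hTn : T ≤ Subgroup.normalizer (R : Set P) := fun t ht ↦
    Subgroup.mem_normalizer_fintype fun n hn ↦ by
      rw [← Subgroup.mem_centralizer_iff.1 (hT.1 ht) n hn, mul_inv_cancel_right]; exact hn
  have hU := hR.to_sup_of_normal_left' hT.isPGroup hTn
  obtain ⟨b, hb⟩ := IsPGroup.iff_card.1 hU
  have hle : R.relIndex T ≤ r := by
    by_contra! hlt
    have h1 : R.relIndex T ≤ R.relIndex (R ⊔ T) :=
      Subgroup.relIndex_le_of_le_right le_sup_right Subgroup.index_ne_zero_of_finite
    have h2 := Subgroup.relIndex_mul_relIndex ⊥ R (R ⊔ T) bot_le le_sup_left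
    simp only [Subgroup.relIndex_bot_left] at h2
    obtain ⟨c, -, hc⟩ := (Nat.dvd_prime_pow hr.out).1 (hb ▸ (Dvd.intro_left _ h2))
    have h3 : 2 ≤ c := by
      by_contra! h
      have : r ^ c ≤ r ^ 1 := Nat.pow_le_pow_right hr.out.pos (by omega)
      rw [pow_one, ← hc] at this
      omega
    apply hidx
    refine Dvd.dvd.trans ?_ (Subgroup.card_subgroup_dvd_card (R ⊔ T))
    rw [← h2, hc]
    exact mul_dvd_mul_left _ (pow_dvd_pow r h3)
  have hab : ∀ x ∈ T, ∀ y ∈ T, Commute x y := by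
    set S := R.subgroupOf T with hS
    have hSc : ∀ c ∈ S, ∀ y : T, y * c = c * y := fun c hc y ↦ Subtype.ext
      (Subgroup.mem_centralizer_iff.1 (hT.1 y.2) c (Subgroup.mem_subgroupOf.1 hc)).symm
    have hSn : S.Normal := ⟨fun c hc y ↦ by rw [hSc c hc, mul_inv_cancel_right]; exact hc⟩
    have hcyc : IsCyclic (T ⧸ S) := by
      have h1 : Nat.card (T ⧸ S) = R.relIndex T := rfl
      obtain ⟨c, hc⟩ := IsPGroup.iff_card.1 hT.isPGroup
      obtain ⟨d, -, hd⟩ := (Nat.dvd_prime_pow hr.out).1 (hc ▸ Subgroup.relIndex_dvd_card R T)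
      have : d = 0 ∨ d = 1 := by
        by_contra! h
        have h2 : r ^ 2 ≤ r ^ d := Nat.pow_le_pow_right hr.out.pos (by omega)
        rw [← hd] at h2
        nlinarith [hr.out.one_lt]
      rcases this with rfl | rfl
      · have : Subsingleton (T ⧸ S) := (Nat.card_eq_one_iff_unique.1 (by rw [h1, hd, pow_zero])).1
        infer_instance
      · exact isCyclic_of_prime_card (p := r) (by rw [h1, hd, pow_one])
    intro a ha b hb
    have h1 := (MonoidHom.isMulCommutative_of_isCyclic_of_ker_le_center
      (QuotientGroup.mk' S) (by
        rw [QuotientGroup.ker_mk']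
        intro c hc
        rw [Subgroup.mem_center_iff]
        exact hSc c hc)).is_comm.comm ⟨a, ha⟩ ⟨b, hb⟩
    exact congrArg Subtype.val h1
  refine hT.rNilp_of_normalizer fun b hb hbT ↦ ?_
  exact hT.commute_of_relIndex (D := R) hab
    (fun q hq h ↦ hmin q hq (h.trans (Subgroup.card_subgroup_dvd_card _))) hb
    (Subgroup.mem_normalizer_fintype hbT)
    (fun x hx _ ↦ (Subgroup.mem_centralizer_iff.1 hb x hx).symm) (Or.inl hle)

variable (φ : integralClosure ℤ ℂ →+* k)

/-- The reduced central character at the sum of the `r`-regular elements. -/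
def omr (r : ℕ) [Fact r.Prime] (i : Irr P) : k := mom φ (rreg_conj (r := r)) i

theorem sum_mch_ne_zero (hmin : ∀ q, q.Prime → q ∣ Nat.card P → r ≤ q) {B : Finset (Irr P)}
    {w : k} (hw : w ≠ 0) (hB : ∀ i ∈ B, omr φ r i = w) (h1 : ∑ i ∈ B, mch φ i 1 ≠ 0) {x : P}
    (hx : ¬ r ^ 2 ∣ classSize x) : ∑ i ∈ B, mch φ i x ≠ 0 := by
  obtain ⟨n, hn⟩ := exists_pow_not_dvd_orderOf (r := r) x
  set y := x ^ r ^ n with hy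
  suffices h : ∑ i ∈ B, mch φ i y ≠ 0 by
    intro h0
    apply h
    simp_rw [hy, mch_pow φ]
    rw [← sum_pow_char_pow, h0, zero_pow (pow_ne_zero _ hr.out.ne_zero)]
  have hy2 : ¬ r ^ 2 ∣ classSize y := fun h ↦ hx (h.trans (by
    refine Subgroup.index_dvd_of_le fun z hz ↦ ?_
    rw [mem_centralizer_singleton] at hz ⊢
    exact hz.pow_right _))
  obtain ⟨R, hR⟩ := exists_isSyl r (Subgroup.centralizer ({y} : Set P))
  have hidx : ¬ Nat.card R * r ^ 2 ∣ Nat.card P := by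
    intro h
    apply hy2
    rw [← card_centralizer_mul_classSize y] at h
    have h0 := (classSize_pos y).ne'
    rw [hR.2, ← pow_add, hr.out.pow_dvd_iff_le_factorization
      (mul_ne_zero Nat.card_pos.ne' h0), Nat.factorization_mul Nat.card_pos.ne' h0,
      Finsupp.add_apply] at h
    rw [hr.out.pow_dvd_iff_le_factorization h0]
    omega
  have hD := rNilp_centralizer hmin hR.isPGroup hidx
  have hyR : y ∈ Subgroup.centralizer (R : Set P) := Subgroup.mem_centralizer_iff.2 fun z hz ↦
    (mem_centralizer_singleton.1 (hR.1 hz)).eq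
  have h2 := sum_rreg_mul (k := k) hR.isPGroup hD (fun z ↦ ∑ i ∈ B, mch φ i z)
    (fun z g ↦ by simp_rw [mch_conj]) hn hyR
  have h3 (z : P) : ∑ g ∈ rreg P r, ∑ i ∈ B, mch φ i (z * g) = w * ∑ i ∈ B, mch φ i z := by
    rw [Finset.sum_comm, Finset.mul_sum]
    refine Finset.sum_congr rfl fun i hi ↦ ?_
    rw [sum_mch_mul φ rreg_conj, ← hB i hi]; rfl
  have h4 := h3 1
  simp only [one_mul] at h4
  rw [h3, h4] at h2
  rw [mul_left_cancel₀ hw h2]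
  exact h1

/-- The linear character attached to a homomorphism. -/
theorem exists_irr_of_hom (f : P →* ℂˣ) : ∃ i : Irr P, deg i = 1 ∧ ∀ g, ch i g = f g := by
  have := Fintype.ofFinite P
  let ψ : MonoidAlgebra ℂ P →ₐ[ℂ] Matrix (Fin 1) (Fin 1) ℂ := MonoidAlgebra.lift ℂ _ _
    ((Matrix.scalar (Fin 1)).toMonoidHom.comp ((Units.coeHom ℂ).comp f))
  have hψ (g : P) : (ψ (gof g)).trace = f g := by
    simp [ψ, gof_apply]
  obtain ⟨i, hi, h⟩ := exists_chi_eq (ψ := ψ) (by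
    simp_rw [hψ, map_inv, Units.mul_inv]
    simp)
  exact ⟨i, hi, fun g ↦ by rw [ch, ← h, hψ]⟩

theorem card_linear_ne_zero (hmin : ∀ q, q.Prime → q ∣ Nat.card P → r ≤ q)
    (hgen : Subgroup.closure {x : P | ¬ r ∣ orderOf x} = ⊤) :
    ((Finset.univ.filter fun i : Irr P ↦ deg i = 1 ∧ omr φ r i ≠ 0).card : k) ≠ 0 := by
  obtain ⟨R, hR⟩ := exists_isSyl r (⊤ : Subgroup P)
  set D := Subgroup.centralizer (R : Set P) with hDdef
  have hD : RNilp r D := rNilp_centralizer hmin hR.isPGroup (by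
    rw [hR.2, Subgroup.card_top, ← pow_add,
      hr.out.pow_dvd_iff_le_factorization Nat.card_pos.ne']
    omega)
  set A := regularPart r D hD with hA
  have hAcard : (Nat.card A : k) ≠ 0 := by
    rw [Ne, CharP.cast_eq_zero_iff k r]
    exact not_dvd_card_regularPart
  have hfil : ((rreg P r).filter fun x ↦ x ∈ D) = (Set.toFinite (A : Set P)).toFinset := by
    ext x
    simp [mem_rreg, hA, mem_regularPart, and_comm]
  have hom (i : Irr P) (hi : deg i = 1) :
      omr φ r i = φ (∑ x ∈ (Set.toFinite (A : Set P)).toFinset, ⟨ch i x, ch_isIntegral i x⟩) := by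
    have h1 := sum_mch_mul φ (rreg_conj (P := P) (r := r)) i 1
    simp only [one_mul] at h1
    rw [mch_one, hi, Nat.cast_one, mul_one] at h1
    rw [omr, ← h1, sum_eq_sum_commute hR.isPGroup _ (fun x hx g _ ↦ rreg_conj x hx g) _
      fun x g _ ↦ mch_conj φ i g x, hfil, map_sum]
    rfl
  have hunit (i : Irr P) (hi : deg i = 1) : omr φ r i ≠ 0 ↔ ∀ x ∈ A, ch i x = 1 := by
    rw [hom i hi]
    constructor
    · intro h y hy
      by_contra hne
      apply h
      rw [← map_zero φ]
      congr 1
      apply Subtype.ext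
      push_cast
      have h1 : ch i y * ∑ x ∈ (Set.toFinite (A : Set P)).toFinset, ch i x =
          ∑ x ∈ (Set.toFinite (A : Set P)).toFinset, ch i x := by
        rw [Finset.mul_sum]
        refine Finset.sum_bij (fun x _ ↦ y * x) ?_ (fun _ _ _ _ h ↦ mul_left_cancel h) ?_ ?_
        · intro x hx
          rw [Set.Finite.mem_toFinset] at hx ⊢
          exact A.mul_mem hy hx
        · intro x hx
          rw [Set.Finite.mem_toFinset] at hx
          exact ⟨y⁻¹ * x, by rw [Set.Finite.mem_toFinset]; exact A.mul_mem (A.inv_mem hy) hx,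
            by simp⟩
        · intro x _
          exact (map_mul (linChar i hi) y x).symm
      by_contra h0
      exact hne (mul_right_cancel₀ h0 (h1.trans (one_mul _).symm))
    · intro h
      have h1 : (∑ x ∈ (Set.toFinite (A : Set P)).toFinset,
          (⟨ch i x, ch_isIntegral i x⟩ : integralClosure ℤ ℂ)) = (Nat.card A : ℕ) := by
        apply Subtype.ext
        push_cast
        rw [Finset.sum_congr rfl fun x hx ↦ h x ((Set.Finite.mem_toFinset _).1 hx)]
        rw [Finset.sum_const, nsmul_eq_mul, mul_one, ← Nat.card_eq_card_finite_toFinset]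
        rfl
      rw [h1, map_natCast]
      exact hAcard
  let F : Subgroup (P →* ℂˣ) :=
    { carrier := {f | ∀ x ∈ A, f x = 1}
      one_mem' := fun x _ ↦ rfl
      mul_mem' := fun hf hg x hx ↦ by rw [MonoidHom.mul_apply, hf x hx, hg x hx, one_mul]
      inv_mem' := fun hf x hx ↦ by rw [MonoidHom.inv_apply, hf x hx, inv_one] }
  set L := Finset.univ.filter fun i : Irr P ↦ deg i = 1 ∧ omr φ r i ≠ 0 with hL
  have hLmem (i : L) : deg i.1 = 1 ∧ omr φ r i.1 ≠ 0 := (Finset.mem_filter.1 i.2).2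
  let e : L → F := fun i ↦ ⟨(linChar i.1 (hLmem i).1).toHomUnits, fun x hx ↦
    Units.ext ((hunit i.1 (hLmem i).1).1 (hLmem i).2 x hx)⟩
  have he : Function.Bijective e := by
    constructor
    · intro i j hij
      apply Subtype.ext
      apply irr_ext
      intro g
      have := congrArg (fun f : F ↦ (f.1 g : ℂ)) hij
      exact this
    · rintro ⟨f, hf⟩
      obtain ⟨i, hi, h⟩ := exists_irr_of_hom f
      refine ⟨⟨i, Finset.mem_filter.2 ⟨Finset.mem_univ _, hi, (hunit i hi).2 fun x hx ↦ ?_⟩⟩, ?_⟩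
      · rw [h, hf x hx, Units.val_one]
      · apply Subtype.ext
        ext g
        exact h g
  have hcard : L.card = Nat.card F := by
    rw [← Fintype.card_coe, ← Nat.card_eq_fintype_card]
    exact Nat.card_eq_of_bijective e he
  have : Finite F := Finite.of_surjective e he.2
  rw [hcard, Ne, CharP.cast_eq_zero_iff k r]
  intro hdvd
  obtain ⟨f, hf⟩ := exists_prime_orderOf_dvd_card' r hdvd
  have hf1 : f.1 = 1 := by
    have h1 : Subgroup.closure {x : P | ¬ r ∣ orderOf x} ≤ f.1.ker := by
      rw [Subgroup.closure_le]
      intro x hx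
      have h2 : orderOf (f.1 x) ∣ r := by
        apply orderOf_dvd_of_pow_eq_one
        have : f ^ r = 1 := hf ▸ pow_orderOf_eq_one f
        exact congrArg (fun h : F ↦ h.1 x) this
      have h3 := orderOf_map_dvd f.1 x
      rcases (Nat.dvd_prime hr.out).1 h2 with h | h
      · exact orderOf_eq_one_iff.1 h
      · exact absurd (h ▸ h3) hx
    rw [hgen, top_le_iff, MonoidHom.ker_eq_top_iff] at h1
    exact h1
  rw [show f = 1 from Subtype.ext hf1, orderOf_one] at hf
  exact hr.out.one_lt.ne hf

end ModularCongruence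

section Clifford

set_option linter.unusedSectionVars false

variable {G : Type} [Group G] [Finite G] (M : Subgroup G) [M.Normal]

theorem exists_conj_irr (g : G) (j : Irr M) : ∃ i : Irr M, deg i = deg j ∧
    ∀ x, ch i x = ch j (MulAut.conjNormal g⁻¹ x) :=
  exists_inflation (MulAut.conjNormal g⁻¹).toMonoidHom (MulAut.conjNormal g⁻¹).surjective j

/-- The conjugation action on the irreducible characters of a normal subgroup. -/
instance irrMulAction : MulAction G (Irr M) where
  smul g j := (exists_conj_irr M g j).choose
  one_smul j := irr_ext fun x ↦ by
    refine ((exists_conj_irr M 1 j).choose_spec.2 x).trans ?_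
    rw [inv_one, map_one, MulAut.one_apply]
  mul_smul g h j := irr_ext fun x ↦ by
    refine ((exists_conj_irr M (g * h) j).choose_spec.2 x).trans ?_
    refine Eq.trans ?_ ((exists_conj_irr M g _).choose_spec.2 x).symm
    refine Eq.trans ?_ ((exists_conj_irr M h j).choose_spec.2 _).symm
    rw [mul_inv_rev, map_mul]; rfl

variable {M}

theorem deg_smul (g : G) (j : Irr M) : deg (g • j) = deg j :=
  (exists_conj_irr M g j).choose_spec.1

theorem ch_smul (g : G) (j : Irr M) (x : M) : ch (g • j) x = ch j (MulAut.conjNormal g⁻¹ x) :=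
  (exists_conj_irr M g j).choose_spec.2 x

theorem smul_irr_of_mem (x : M) (j : Irr M) : (x : G) • j = j := irr_ext fun y ↦ by
  rw [ch_smul, ← ch_conj j x⁻¹ y]
  congr 1

variable (M) in
/-- The inclusion of group algebras. -/
def incl : MonoidAlgebra ℂ M →ₐ[ℂ] MonoidAlgebra ℂ G :=
  MonoidAlgebra.mapDomainAlgHom ℂ ℂ M.subtype

theorem incl_gof (x : M) : incl M (gof x) = gof (x : G) := by
  simp [incl, gof_apply]

theorem incl_injective : Function.Injective (incl M) :=
  MonoidAlgebra.mapDomain_injective M.subtype_injective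

theorem gof_mul_incl_idem (g : G) (i : Irr M) :
    gof g * incl M (idem i) = incl M (idem (g • i)) * gof g := by
  have := Fintype.ofFinite M
  rw [eq_sum_gof (idem i), eq_sum_gof (idem (g • i)), map_sum, map_sum, Finset.mul_sum,
    Finset.sum_mul]
  refine Fintype.sum_equiv (MulAut.conjNormal g).toEquiv _ _ fun x ↦ ?_
  have h1 : MulAut.conjNormal g⁻¹ ((MulAut.conjNormal g) x)⁻¹ = x⁻¹ := by
    apply Subtype.ext
    simp
  have h2 : ((MulAut.conjNormal g x : M) : G) * g = g * x := by simp
  change gof g * incl M _ = incl M ((idem (g • i)).coeff (MulAut.conjNormal g x) •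
    gof (MulAut.conjNormal g x)) * gof g
  rw [map_smul, map_smul, incl_gof, incl_gof, mul_smul_comm, smul_mul_assoc, ← map_mul, ← map_mul,
    idem_coeff, idem_coeff, deg_smul, ch_smul, h1, h2]

/-- Clifford theory over the orbit of an irreducible character of a normal subgroup. -/
theorem exists_irr_over (j : Irr M) : ∃ (l : Irr G) (c : ℕ), c ≠ 0 ∧
    (∀ x : M, ch l (x : G) = c * ∑ i with i ∈ MulAction.orbit G j, ch i x) ∧
    ∀ g : G, (∀ i ∈ MulAction.orbit G j, g • i ≠ i) → ch l g = 0 := by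
  set O := Finset.univ.filter fun i : Irr M ↦ i ∈ MulAction.orbit G j with hO
  have hOmem (i : Irr M) : i ∈ O ↔ i ∈ MulAction.orbit G j := by simp [hO]
  have hidem_ne {i i' : Irr M} (h : i ≠ i') : idem i * idem i' = 0 := by
    apply ext_rho; intro t
    rw [map_mul, map_zero]
    by_cases ht : t = i
    · rw [rho_idem_of_ne (i := i') (by rw [ht]; exact h), mul_zero]
    · rw [rho_idem_of_ne ht, zero_mul]
  have hj0 : incl M (idem j) ≠ 0 := by
    rw [Ne, map_eq_zero_iff _ incl_injective]
    intro h
    have h1 := rho_idem_self j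
    rw [h, map_zero] at h1
    exact zero_ne_one h1
  obtain ⟨l, hl⟩ : ∃ l : Irr G, rho l (incl M (idem j)) ≠ 0 := by
    by_contra! h
    exact hj0 (ext_rho fun l ↦ by rw [h, map_zero])
  set E := ∑ i ∈ O, idem i with hE
  have hmulE {i : Irr M} (hi : i ∈ O) : idem i * E = idem i := by
    rw [hE, Finset.mul_sum, Finset.sum_eq_single i (fun i' _ h ↦ hidem_ne h.symm)
      (fun h ↦ absurd hi h), idem_mul_idem]
  have hmulE' {i : Irr M} (hi : i ∉ O) : idem i * E = 0 := by
    rw [hE, Finset.mul_sum]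
    exact Finset.sum_eq_zero fun i' h' ↦ hidem_ne fun h ↦ hi (h ▸ h')
  have hEc (g : G) : gof g * incl M E = incl M E * gof g := by
    rw [hE, map_sum, Finset.mul_sum, Finset.sum_mul]
    refine Finset.sum_bij (fun i _ ↦ g • i) (fun i hi ↦ ?_) (fun i _ i' _ h ↦ smul_left_cancel g h)
      (fun i hi ↦ ⟨g⁻¹ • i, ?_, smul_inv_smul g i⟩) fun i _ ↦ gof_mul_incl_idem g i
    · rw [hOmem] at hi ⊢
      exact MulAction.mem_orbit_of_mem_orbit _ hi
    · rw [hOmem] at hi ⊢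
      exact MulAction.mem_orbit_of_mem_orbit _ hi
  have hjO : j ∈ O := (hOmem j).2 (MulAction.mem_orbit_self j)
  have hE1 : rho l (incl M E) = 1 := by
    have hEE : E * E = E := by
      nth_rw 1 [hE]
      rw [Finset.sum_mul]
      exact Finset.sum_congr rfl fun i hi ↦ hmulE hi
    have h1 := rho_eq_smul_one hEc l
    set c := chi l (incl M E) / deg l
    have h2 : rho l (incl M E) * rho l (incl M E) = rho l (incl M E) := by
      rw [← map_mul, ← map_mul, hEE]
    rw [h1, smul_mul_smul_comm, mul_one] at h2
    have h3 : c * c = c := smul_left_injective ℂ (one_ne_zero) h2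
    have h4 : c ≠ 0 := by
      intro h0
      apply hl
      rw [← hmulE hjO, map_mul, map_mul, h1, h0, zero_smul, mul_zero]
    rw [h1, mul_left_cancel₀ h4 (h3.trans (mul_one c).symm), one_smul]
  obtain ⟨m, hm⟩ := exists_multiplicity ((rho l).comp (incl M))
  have hm' (i : Irr M) : (rho l (incl M (idem i))).trace = m i * deg i := by
    refine (hm (idem i)).trans ?_
    rw [Finset.sum_eq_single i]
    · rw [chi_apply, rho_idem_self, Matrix.trace_one, Fintype.card_fin]
    · intro i' _ h
      rw [chi_apply, rho_idem_of_ne h, Matrix.trace_zero, mul_zero]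
    · simp
  have hdeg (i : Irr M) : (deg i : ℂ) ≠ 0 := by exact_mod_cast NeZero.ne (deg i)
  have hm0 (i : Irr M) (hi : i ∉ O) : m i = 0 := by
    have h1 : rho l (incl M (idem i)) = 0 := by
      rw [← mul_one (rho l _), ← hE1, ← map_mul, ← map_mul, hmulE' hi, map_zero, map_zero]
    have h2 := hm' i
    rw [h1, Matrix.trace_zero] at h2
    exact_mod_cast (mul_eq_zero.1 h2.symm).resolve_right (hdeg i)
  have hmj (i : Irr M) (hi : i ∈ O) : m i = m j := by
    rw [hOmem] at hi
    obtain ⟨g, rfl⟩ := hi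
    have h1 : incl M (idem (g • j)) = gof g * incl M (idem j) * gof g⁻¹ := by
      rw [gof_mul_incl_idem, mul_assoc, ← map_mul, mul_inv_cancel, map_one, mul_one]
    have h2 := hm' (g • j)
    rw [h1, ← chi_apply, chi_mul_comm, ← mul_assoc, ← map_mul, inv_mul_cancel, map_one, one_mul,
      chi_apply, hm', deg_smul] at h2
    exact_mod_cast (mul_right_cancel₀ (hdeg j) h2).symm
  have hres (x : M) : ch l (x : G) = m j * ∑ i ∈ O, ch i x := by
    have h1 := hm (gof x)
    rw [AlgHom.comp_apply, incl_gof, ← ch_def] at h1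
    rw [h1, Finset.mul_sum, ← Finset.sum_subset (Finset.subset_univ O)
      (fun i _ hi ↦ by rw [hm0 i hi, Nat.cast_zero, zero_mul])]
    exact Finset.sum_congr rfl fun i hi ↦ by rw [hmj i hi]; rfl
  refine ⟨l, m j, fun h0 ↦ ?_, hres, fun g hg ↦ ?_⟩
  · have h1 := hres 1
    rw [h0, Nat.cast_zero, zero_mul, Subgroup.coe_one, ch_one] at h1
    exact NeZero.ne (deg l) (by exact_mod_cast h1)
  · have h1 : ch l g = chi l (gof g * incl M E) := by
      rw [chi_apply, map_mul, hE1, mul_one, ch_def]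
    rw [h1, hE, map_sum, Finset.mul_sum, map_sum]
    refine Finset.sum_eq_zero fun i hi ↦ ?_
    rw [← idem_mul_idem, map_mul (incl M), ← mul_assoc, chi_mul_comm, gof_mul_incl_idem, ← mul_assoc,
      ← map_mul, hidem_ne (hg i ((hOmem i).1 hi)).symm, map_zero, zero_mul, map_zero]

theorem exists_card_orbit_mul_ne_zero {α k : Type} [Fintype α] [MulAction G α] [Field k] {f : α → k}
    (hf : ∀ (g : G) a, f (g • a) = f a) (h : ∑ a, f a ≠ 0) :
    ∃ a, (Nat.card (MulAction.orbit G a) : k) * f a ≠ 0 := by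
  by_contra! hc
  apply h
  rw [← Finset.sum_fiberwise Finset.univ (fun a ↦ (Quotient.mk (MulAction.orbitRel G α) a)) f]
  refine Finset.sum_eq_zero fun q _ ↦ ?_
  obtain ⟨a, rfl⟩ := Quotient.exists_rep q
  rw [← hc a, Finset.sum_congr rfl (g := fun _ ↦ f a), Finset.sum_const, nsmul_eq_mul]
  · congr 2
    rw [← Fintype.card_subtype, ← Nat.card_eq_fintype_card]
    refine Nat.card_congr (Equiv.subtypeEquivRight fun b ↦ ?_)
    rw [Quotient.eq]
    exact MulAction.orbitRel_apply
  · intro b hb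
    rw [Finset.mem_filter, Quotient.eq] at hb
    obtain ⟨g, rfl⟩ := MulAction.orbitRel_apply.1 hb.2
    exact hf g a

variable {r : ℕ} [hr : Fact r.Prime] {k : Type} [Field k] [CharP k r]
  (φ : integralClosure ℤ ℂ →+* k)

theorem omr_smul (g : G) (j : Irr M) : omr φ r (g • j) = omr φ r j := by
  unfold omr mom
  congr 1
  apply Subtype.ext
  change chi _ _ / (deg (g • j) : ℂ) = _
  rw [deg_smul]
  congr 1
  rw [ssum, map_sum, map_sum]
  refine Finset.sum_bij (fun x _ ↦ MulAut.conjNormal g⁻¹ x) (fun x hx ↦ ?_)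
    (fun _ _ _ _ h ↦ (MulAut.conjNormal g⁻¹).injective h) (fun x hx ↦ ?_) fun x _ ↦ ch_smul g j x
  · rw [mem_rreg] at hx ⊢
    rwa [MulEquiv.orderOf_eq]
  · refine ⟨MulAut.conjNormal g x, ?_, by simp [map_inv]⟩
    rw [mem_rreg] at hx ⊢
    rwa [MulEquiv.orderOf_eq]

end Clifford

section StepT

set_option linter.unusedSectionVars false

variable {G : Type} [Group G] [Finite G]

theorem card_inf_mul_relIndex (H K : Subgroup G) :
    Nat.card ↥(H ⊓ K) * H.relIndex K = Nat.card K := by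
  rw [← Subgroup.inf_relIndex_right, ← Subgroup.relIndex_bot_left (H ⊓ K),
    Subgroup.relIndex_mul_relIndex _ _ _ bot_le inf_le_right, Subgroup.relIndex_bot_left]

theorem relIndex_mul_index_sup (H K : Subgroup G) [K.Normal] :
    H.relIndex K * (H ⊔ K).index = H.index := by
  rw [← Subgroup.relIndex_mul_index (le_sup_left : H ≤ H ⊔ K)]
  congr 1
  have h1 := card_inf_mul_relIndex H K
  have h2 := card_inf_mul_relIndex K H
  rw [inf_comm] at h2
  have h3 := card_inf_mul_relIndex K (H ⊔ K)
  rw [inf_of_le_left le_sup_right, Subgroup.relIndex_sup_right] at h3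
  have h4 := card_inf_mul_relIndex H (H ⊔ K)
  rw [inf_of_le_left le_sup_left] at h4
  have h5 : 0 < Nat.card H := Nat.card_pos
  apply Nat.eq_of_mul_eq_mul_left h5
  rw [h4, ← h3, ← h1, ← h2]
  ring

theorem relIndex_dvd_index_of_normal_right (H K : Subgroup G) [K.Normal] :
    H.relIndex K ∣ H.index :=
  Dvd.intro _ (relIndex_mul_index_sup H K)

theorem classSize_eq_relIndex (M : Subgroup G) (x : M) :
    classSize x = (Subgroup.centralizer {(x : G)}).relIndex M := by
  have h : Subgroup.centralizer {x} = (Subgroup.centralizer {(x : G)}).subgroupOf M := by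
    ext y
    rw [Subgroup.mem_subgroupOf, mem_centralizer_singleton, mem_centralizer_singleton,
      commute_iff_eq, commute_iff_eq, Subtype.ext_iff]
    rfl
  rw [classSize, h, Subgroup.relIndex]

theorem classSize_subtype_dvd (M : Subgroup G) [M.Normal] (x : M) :
    classSize x ∣ classSize (x : G) := by
  rw [classSize_eq_relIndex]
  exact relIndex_dvd_index_of_normal_right _ _

theorem mem_of_primePow_mem (Y : Subgroup G) (n : ℕ) : 0 < n → ∀ x : G, x ^ n = 1 →
    (∀ p m k : ℕ, p.Prime → (x ^ k) ^ p ^ m = 1 → x ^ k ∈ Y) → x ∈ Y := by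
  induction n using Nat.recOnPosPrimePosCoprime with
  | zero => simp
  | one => intro _ x hx _; rw [pow_one] at hx; rw [hx]; exact Y.one_mem
  | prime_pow p m hp _ =>
    intro _ x hx h
    simpa using h p m 1 hp (by simpa using hx)
  | coprime a b ha hb hab iha ihb =>
    intro _ x hx h
    have h1 : x ^ a ∈ Y := ihb (by omega) (x ^ a) (by rw [← pow_mul, hx]) fun p m k hp hk ↦ by
      rw [← pow_mul x] at hk ⊢; exact h p m _ hp hk
    have h2 : x ^ b ∈ Y := iha (by omega) (x ^ b) (by rw [← pow_mul, mul_comm, hx])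
      fun p m k hp hk ↦ by rw [← pow_mul x] at hk ⊢; exact h p m _ hp hk
    have h3 : x = (x ^ a) ^ a.gcdA b * (x ^ b) ^ a.gcdB b := by
      rw [← zpow_natCast, ← zpow_natCast, ← zpow_mul, ← zpow_mul, ← zpow_add,
        ← Nat.gcd_eq_gcd_ab, hab.gcd_eq_one]
      simp
    rw [h3]
    exact Y.mul_mem (Y.zpow_mem h1 _) (Y.zpow_mem h2 _)

theorem exists_primePow_conj_notMem {I : Subgroup G} (hI : I ≠ ⊤) {n : ℕ}
    (hn : derivedSeries G n ≤ I) :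
    ∃ p m : ℕ, ∃ g : G, p.Prime ∧ g ^ p ^ m = 1 ∧ ∀ t, t * g * t⁻¹ ∉ I := by
  obtain h | ⟨Y, hY, hIY⟩ := eq_top_or_exists_le_coatom I
  · exact absurd h hI
  obtain ⟨i, hi, hi1⟩ := exists_not_and_succ (P := fun i ↦ derivedSeries G i ≤ Y)
    (fun h ↦ hY.1 (top_le_iff.1 (by simpa using h))) (hn.trans hIY)
  set E := derivedSeries G i with hE
  have hEn : E.Normal := derivedSeries_normal G i
  have hsup : E ⊔ Y = ⊤ := by
    refine (hY.le_iff.1 le_sup_right).resolve_right fun h ↦ hi ?_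
    exact h ▸ le_sup_left
  have hnorm (t x : G) (hx : x ∈ E ⊓ Y) : t * x * t⁻¹ ∈ E ⊓ Y := by
    obtain ⟨e, he, y, hy, rfl⟩ := Subgroup.mem_sup_of_normal_left.1
      (show t ∈ E ⊔ Y from hsup ▸ trivial)
    refine ⟨hEn.conj_mem x hx.1 _, ?_⟩
    have h1 : y * x * y⁻¹ ∈ E := hEn.conj_mem x hx.1 _
    have h2 : y * x * y⁻¹ ∈ Y := Y.mul_mem (Y.mul_mem hy hx.2) (Y.inv_mem hy)
    have h3 : e * (y * x * y⁻¹) * e⁻¹ * (y * x * y⁻¹)⁻¹ ∈ Y :=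
      hi1 (Subgroup.commutator_mem_commutator he h1)
    have h4 := Y.mul_mem h3 h2
    rw [inv_mul_cancel_right] at h4
    have h5 : e * y * x * (e * y)⁻¹ = e * (y * x * y⁻¹) * e⁻¹ := by group
    rw [h5]
    exact h4
  by_contra! hcon
  apply hi
  intro x hx
  refine mem_of_primePow_mem Y _ (orderOf_pos x) x (pow_orderOf_eq_one x) fun p m k hp hk ↦ ?_
  obtain ⟨t, ht⟩ := hcon p m _ hp hk
  have h1 := hnorm t⁻¹ _ ⟨hEn.conj_mem _ (E.pow_mem hx k) t, hIY ht⟩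
  have h2 : t⁻¹ * (t * x ^ k * t⁻¹) * t⁻¹⁻¹ = x ^ k := by group
  rw [← h2]
  exact h1.2

variable {s r : ℕ} [hr : Fact r.Prime]

theorem rNilp_of_vcs (hv : vcs G = {s}) (hs : Squarefree s) {K : Subgroup G} [hKn : K.Normal]
    (hco : (Nat.card K).Coprime K.index) {n : ℕ} (hK : derivedSeries G n ≤ K)
    (hmin : ∀ q, q.Prime → q ∣ Nat.card K → r ≤ q) : RNilp r K := by
  have hrs : ¬ r ^ 2 ∣ s := fun h ↦ hr.out.one_lt.ne' (Nat.isUnit_iff.1 (hs r (by rwa [← sq])))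
  set S : Set G := {x | x ∈ K ∧ ¬ r ∣ orderOf x} with hS
  set M := Subgroup.closure S with hM
  have hMK : M ≤ K := (Subgroup.closure_le _).2 fun x hx ↦ hx.1
  have hMn : M.Normal := by
    refine ⟨fun x hx g ↦ ?_⟩
    have : M ≤ M.comap (MulAut.conj g).toMonoidHom := by
      refine (Subgroup.closure_le _).2 fun y hy ↦ Subgroup.subset_closure ⟨?_, ?_⟩
      · exact hKn.conj_mem y hy.1 g
      · change ¬ r ∣ orderOf (g * y * g⁻¹)
        rw [orderOf_conj']; exact hy.2
    exact this hx
  by_cases hrM : r ∣ Nat.card M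
  swap
  · intro x hx y hy hxr hyr h
    apply hrM
    have : x * y ∈ M := M.mul_mem (Subgroup.subset_closure ⟨hx, hxr⟩)
      (Subgroup.subset_closure ⟨hy, hyr⟩)
    exact h.trans (Subgroup.orderOf_dvd_natCard M this)
  have hminM : ∀ q, q.Prime → q ∣ Nat.card M → r ≤ q := fun q hq h ↦
    hmin q hq (h.trans (Subgroup.card_dvd_of_le hMK))
  have hgen : Subgroup.closure {x : M | ¬ r ∣ orderOf x} = ⊤ := by
    rw [eq_top_iff, ← Subgroup.closure_closure_coe_preimage (k := S)]
    refine Subgroup.closure_mono fun x hx ↦ ?_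
    have := hx.2
    rwa [Subgroup.orderOf_coe] at this
  obtain ⟨k, _, φ, _, htor⟩ := exists_residue_field r
  have hN : ∃ N, 0 < N ∧ ∀ i : Irr M, omr φ r i ≠ 0 → omr φ r i ^ N = 1 := by
    have htor' (x : k) : ∃ n, 0 < n ∧ (x ≠ 0 → x ^ n = 1) := by
      by_cases hx : x = 0
      · exact ⟨1, one_pos, fun h ↦ absurd hx h⟩
      · obtain ⟨n, hn, h⟩ := htor x hx
        exact ⟨n, hn, fun _ ↦ h⟩
    choose e he0 he using htor'
    refine ⟨∏ i : Irr M, e (omr φ r i), Finset.prod_pos fun i _ ↦ he0 _, fun i hi ↦ ?_⟩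
    obtain ⟨c, hc⟩ := Finset.dvd_prod_of_mem (fun i : Irr M ↦ e (omr φ r i)) (Finset.mem_univ i)
    rw [hc, pow_mul, he _ hi, one_pow]
  obtain ⟨N, hN0, hN⟩ := hN
  let f (i : Irr M) : k := if omr φ r i ≠ 0 ∧ deg i ≠ 1 then (deg i : k) ^ 2 else 0
  have hsum : ∑ i, f i ≠ 0 := by
    intro h0
    apply card_linear_ne_zero φ hminM hgen
    have h1 := sum_deg_sq_mul_mom_pow φ (rreg_conj (P := M) (r := r)) hrM N
    refine Eq.trans ?_ ((congrArg₂ (· - ·) h1 h0).trans (sub_zero 0))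
    rw [← Finset.sum_sub_distrib, Finset.card_filter, Nat.cast_sum]
    refine Finset.sum_congr rfl fun i _ ↦ ?_
    change _ = (deg i : k) ^ 2 * omr φ r i ^ N - _
    by_cases h1 : omr φ r i = 0
    · simp [f, h1, hN0.ne']
    · by_cases h2 : deg i = 1 <;> simp [f, h1, h2, hN i h1]
  obtain ⟨j, hj⟩ := exists_card_orbit_mul_ne_zero (G := G) (f := f) (fun g a ↦ by
    simp only [f, omr_smul, deg_smul]) hsum
  obtain ⟨hj1, hj2⟩ := mul_ne_zero_iff.1 hj
  have hj3 : omr φ r j ≠ 0 ∧ deg j ≠ 1 := by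
    by_contra h
    exact hj2 (if_neg h)
  have hj4 : (deg j : k) ≠ 0 := by
    simp only [f, if_pos hj3] at hj2
    exact fun h ↦ hj2 (by rw [h]; simp)
  set B := Finset.univ.filter fun i : Irr M ↦ i ∈ MulAction.orbit G j with hB
  have hBmem (i : Irr M) : i ∈ B ↔ ∃ g : G, g • j = i := by simp [hB, MulAction.mem_orbit_iff]
  have hBcard : (B.card : k) = Nat.card (MulAction.orbit G j) := by
    rw [hB, ← Fintype.card_subtype, ← Nat.card_eq_fintype_card]
  obtain ⟨l, c, hc, hl, hl0⟩ := exists_irr_over j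
  have hΘ (x : M) : ∑ i ∈ B, ch i x ≠ 0 := by
    intro h0
    have hx : IsVanishing G (x : G) := (isVanishing_iff _).2 ⟨l, by rw [hl, ← hB, h0, mul_zero]⟩
    have h2 : ¬ r ^ 2 ∣ classSize x := fun h ↦ hrs <| by
      rw [← classSize_of_isVanishing hv hx]
      exact h.trans (classSize_subtype_dvd M x)
    refine sum_mch_ne_zero φ hminM (B := B) hj3.1 (fun i hi ↦ ?_) ?_ h2 ?_
    · obtain ⟨g, rfl⟩ := (hBmem i).1 hi
      exact omr_smul φ g j
    · rw [Finset.sum_congr rfl (g := fun _ ↦ (deg j : k)), Finset.sum_const, nsmul_eq_mul, hBcard]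
      · exact mul_ne_zero hj1 hj4
      · intro i hi
        obtain ⟨g, rfl⟩ := (hBmem i).1 hi
        rw [mch_one, deg_smul]
    · simp only [mch]
      rw [← map_sum, ← map_zero φ]
      congr 1
      apply Subtype.ext
      push_cast
      exact h0
  set I := MulAction.stabilizer G j with hI
  have hIdx : I.index = Nat.card (MulAction.orbit G j) := MulAction.index_stabilizer G j
  have hrI : ¬ r ∣ I.index := by
    rw [hIdx, ← CharP.cast_eq_zero_iff k r]
    exact hj1
  have hMI : M ≤ I := fun x hx ↦ smul_irr_of_mem (⟨x, hx⟩ : M) j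
  have hKI : K ≤ I := by
    rw [← Subgroup.relIndex_eq_one]
    by_contra hne
    obtain ⟨q, hq, hqd⟩ := Nat.exists_prime_and_dvd hne
    have := Fact.mk hq
    have hqr : q ≠ r := fun h ↦ hrI ((h ▸ hqd).trans (relIndex_dvd_index_of_normal_right I K))
    obtain ⟨Q, hQ⟩ := exists_isSyl q K
    have hQM : Q ≤ M := by
      intro x hx
      refine Subgroup.subset_closure ⟨hQ.1 hx, fun h ↦ hqr ?_⟩
      have h1 := h.trans (Subgroup.orderOf_dvd_natCard Q hx)
      rw [hQ.2] at h1
      exact ((Nat.prime_dvd_prime_iff_eq hr.out hq).1 (hr.out.dvd_of_dvd_pow h1)).symm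
    have h1 : q ∣ Q.relIndex K := (hqd.trans (Subgroup.relIndex_dvd_of_le_left K hMI)).trans
      (Subgroup.relIndex_dvd_of_le_left K hQM)
    have h2 : Nat.card Q * Q.relIndex K = Nat.card K := by
      rw [← Subgroup.relIndex_bot_left Q,
        Subgroup.relIndex_mul_relIndex _ _ _ bot_le hQ.1, Subgroup.relIndex_bot_left]
    have h3 := mul_dvd_mul_left (Nat.card Q) h1
    rw [h2, hQ.2, ← pow_succ] at h3
    exact Nat.pow_succ_factorization_not_dvd Nat.card_pos.ne' hq h3
  have hItop : I ≠ ⊤ := by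
    intro h
    have hB1 : B = {j} := by
      ext i
      rw [hBmem, Finset.mem_singleton]
      refine ⟨?_, fun h ↦ ⟨1, by rw [one_smul, h]⟩⟩
      rintro ⟨g, rfl⟩
      exact (show g ∈ I from h ▸ trivial)
    obtain ⟨x, hx⟩ := exists_ch_eq_zero j (by have := NeZero.pos (deg j); omega)
    exact hΘ x (by rw [hB1, Finset.sum_singleton, hx])
  obtain ⟨p, m, g, hp, hgp, hg⟩ := exists_primePow_conj_notMem hItop (hK.trans hKI)
  have := Fact.mk hp
  have hgv : IsVanishing G g := by
    refine (isVanishing_iff _).2 ⟨l, hl0 g fun i hi h ↦ ?_⟩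
    obtain ⟨t, rfl⟩ := hi
    apply hg t⁻¹
    change (t⁻¹ * g * t⁻¹⁻¹) • j = j
    rw [inv_inv, mul_smul, mul_smul]
    change g • t • j = t • j at h
    rw [h, inv_smul_smul]
  have hgK : g ∉ K := fun h ↦ hg 1 (by simpa using hKI h)
  have hpK : ¬ p ∣ Nat.card K := by
    intro h
    apply hgK
    rw [← QuotientGroup.eq_one_iff, ← orderOf_eq_one_iff]
    have h1 : orderOf (g : G ⧸ K) ∣ p ^ m := orderOf_dvd_of_pow_eq_one (by
      rw [← QuotientGroup.mk_pow, hgp]; rfl)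
    have h2 : orderOf (g : G ⧸ K) ∣ K.index := orderOf_dvd_natCard _
    have h3 : (p ^ m).Coprime K.index := Nat.Coprime.pow_left m (hco.coprime_dvd_left h)
    exact Nat.eq_one_of_dvd_coprimes h3 h1 h2
  refine rNilp_of_coprime_action hgp (normalizes_of_normal _ K) hpK (fun x hx y hy hxg hyg ↦ ?_)
    hmin fun h ↦ hrs ?_
  · exact centralizer_le_of_isVanishing hv hgv hyg.symm ((coprime_orderOf_of_pow hgp hpK).coprime_dvd_right
      (Subgroup.orderOf_dvd_natCard K hy)) hxg
  · rw [← classSize_of_isVanishing hv hgv]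
    refine h.trans ?_
    rw [inf_comm, Subgroup.inf_relIndex_right]
    have h1 : Subgroup.centralizer (Subgroup.zpowers g : Set G) = Subgroup.centralizer {g} := by
      ext x
      rw [mem_centralizer_zpowers, mem_centralizer_singleton]
    rw [h1]
    exact relIndex_dvd_index_of_normal_right _ _

end StepT

section Solvability

set_option linter.unusedSectionVars false

variable {G : Type} [Group G] [Finite G]

theorem isSolvable_of_derivedSeries_le {X : Type*} [Group X] {Q : Subgroup X} {m : ℕ}
    (hm : derivedSeries X m ≤ Q) (hQ : Group.IsSolvable Q) : Group.IsSolvable X := by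
  obtain ⟨j, hj⟩ := hQ.solvable
  have h (i : ℕ) : derivedSeries X (m + i) ≤ (derivedSeries Q i).map Q.subtype := by
    induction i with
    | zero =>
      rw [derivedSeries_zero, ← MonoidHom.range_eq_map, Subgroup.range_subtype]
      exact hm
    | succ i ih =>
      rw [← add_assoc, derivedSeries_succ, derivedSeries_succ, Subgroup.map_commutator]
      exact Subgroup.commutator_mono ih ih
  refine ⟨m + j, ?_⟩
  have := h j
  rwa [hj, Subgroup.map_bot, le_bot_iff] at this

variable {s r : ℕ} [hr : Fact r.Prime]

theorem index_regularPart {K : Subgroup G} (h : RNilp r K) :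
    (regularPart r K h).index = r ^ (Nat.card K).factorization r * K.index := by
  have h1 := card_regularPart_mul h
  have h2 := (regularPart r K h).card_mul_index
  have h3 := K.card_mul_index
  have h4 : 0 < Nat.card (regularPart r K h) := Nat.card_pos
  apply Nat.eq_of_mul_eq_mul_left h4
  rw [h2, ← mul_assoc, h1, h3]

theorem coprime_card_regularPart {K : Subgroup G} (h : RNilp r K)
    (hco : (Nat.card K).Coprime K.index) :
    (Nat.card (regularPart r K h)).Coprime (regularPart r K h).index := by
  rw [index_regularPart]
  refine Nat.Coprime.mul_right ?_ (hco.coprime_dvd_left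
    (Subgroup.card_dvd_of_le (regularPart_le (h := h))))
  exact (((Nat.Prime.coprime_iff_not_dvd hr.out).2 (not_dvd_card_regularPart (h := h))).pow_left _).symm

theorem card_regularPart_lt {K : Subgroup G} (h : RNilp r K) (hK : r ∣ Nat.card K) :
    Nat.card (regularPart r K h) < Nat.card K := by
  refine lt_of_le_of_ne (Nat.le_of_dvd Nat.card_pos (Subgroup.card_dvd_of_le (regularPart_le (h := h)))) ?_
  intro h1
  exact not_dvd_card_regularPart (h := h) (h1 ▸ hK)

theorem isSolvable_of_regularPart {K : Subgroup G} [K.Normal] (h : RNilp r K) {n : ℕ}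
    (hK : derivedSeries G n ≤ K) : ∃ m, derivedSeries G m ≤ regularPart r K h := by
  set K2 := regularPart r K h with hK2
  set Q := K.map (QuotientGroup.mk' K2) with hQ
  have hQp : IsPGroup r Q := by
    rintro ⟨_, x, hx, rfl⟩
    obtain ⟨m, hm⟩ := exists_pow_not_dvd_orderOf (r := r) x
    refine ⟨m, Subtype.ext ?_⟩
    change (x : G ⧸ K2) ^ r ^ m = 1
    rw [← QuotientGroup.mk_pow, QuotientGroup.eq_one_iff]
    exact ⟨K.pow_mem hx _, hm⟩
  have hQs : Group.IsSolvable Q := by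
    have := hQp.isNilpotent
    infer_instance
  have h1 : derivedSeries (G ⧸ K2) n ≤ Q := by
    rw [← map_derivedSeries_eq (QuotientGroup.mk'_surjective K2)]
    exact Subgroup.map_mono hK
  obtain ⟨m, hm⟩ := (isSolvable_of_derivedSeries_le h1 hQs).solvable
  refine ⟨m, ?_⟩
  rw [← map_derivedSeries_eq (QuotientGroup.mk'_surjective K2), Subgroup.map_eq_bot_iff,
    QuotientGroup.ker_mk'] at hm
  exact hm

theorem isSolvable_of_vcs (hv : vcs G = {s}) (hs : Squarefree s) (N : ℕ) :
    ∀ (K : Subgroup G) [K.Normal], Nat.card K ≤ N → (Nat.card K).Coprime K.index → ∀ n : ℕ,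
      derivedSeries G n ≤ K → Group.IsSolvable G := by
  induction N with
  | zero => intro K _ h; exact absurd h (by have := Nat.card_pos (α := K); omega)
  | succ N ih =>
    intro K _ hN hco n hn
    by_cases h1 : Nat.card K = 1
    · rw [Subgroup.card_eq_one] at h1
      exact ⟨n, le_bot_iff.1 (h1 ▸ hn)⟩
    have := Fact.mk (Nat.minFac_prime h1)
    have hR : RNilp (Nat.card K).minFac K := rNilp_of_vcs hv hs hco hn fun q hq h ↦
      Nat.minFac_le_of_dvd hq.two_le h
    obtain ⟨m, hm⟩ := isSolvable_of_regularPart hR hn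
    have h2 := card_regularPart_lt hR (Nat.minFac_dvd _)
    exact ih _ (by omega) (coprime_card_regularPart hR hco) m hm

end Solvability

section HallDecomposition

set_option linter.unusedSectionVars false

variable {G : Type} [Group G] [Finite G]

/-- `G = N H` with `H` abelian, `|N|` and `|H|` coprime, and `π(N) ⊆ π(s)`, `s` prime to `|H|`. -/
structure HallDecomp (s : ℕ) (N H : Subgroup G) : Prop where
  abelian : IsAbelianSubgroup H
  sup : N ⊔ H = ⊤
  coprime : (Nat.card N).Coprime (Nat.card H)
  dvd : ∀ p, p.Prime → p ∣ Nat.card N → p ∣ s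
  coprime' : s.Coprime (Nat.card H)

theorem mem_center_iff_commute {x : G} : x ∈ Subgroup.center G ↔ ∀ g, Commute g x :=
  Subgroup.mem_center_iff

theorem exists_conj_mul_of_fixedPointFree {N : Subgroup G} [N.Normal] {h : G}
    (hf : ∀ n ∈ N, Commute n h → n = 1) {m : G} (hm : m ∈ N) : ∃ n ∈ N, m * h = n⁻¹ * h * n := by
  have hN : N.Normal := inferInstance
  let f (n : N) : N := ⟨(n : G)⁻¹ * (h * n * h⁻¹),
    N.mul_mem (N.inv_mem n.2) (hN.conj_mem _ n.2 h)⟩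
  have hfi : Function.Injective f := by
    intro x y hxy
    have h1 : (x : G)⁻¹ * (h * x * h⁻¹) = (y : G)⁻¹ * (h * y * h⁻¹) := congrArg Subtype.val hxy
    have h2 : (y : G) * (x : G)⁻¹ = 1 := by
      refine hf _ (N.mul_mem y.2 (N.inv_mem x.2)) ?_
      have h3 : (y : G) * (x : G)⁻¹ * h = y * ((x : G)⁻¹ * (h * x * h⁻¹)) * h * (x : G)⁻¹ := by
        group
      rw [commute_iff_eq, h3, h1]
      group
    exact Subtype.ext (mul_inv_eq_one.1 h2).symm
  obtain ⟨n, hn⟩ := (Finite.surjective_of_injective hfi) ⟨m, hm⟩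
  refine ⟨n, n.2, ?_⟩
  have h1 : (n : G)⁻¹ * (h * n * h⁻¹) = m := congrArg Subtype.val hn
  rw [← h1]
  group

variable {s : ℕ} {N H : Subgroup G} [hNn : N.Normal]

namespace HallDecomp

theorem exists_mul (D : HallDecomp s N H) (t : G) : ∃ n ∈ N, ∃ h ∈ H, n * h = t :=
  Subgroup.mem_sup_of_normal_left.1 (show t ∈ N ⊔ H from D.sup ▸ trivial)

theorem exists_mul' (D : HallDecomp s N H) (t : G) : ∃ h ∈ H, ∃ n ∈ N, h * n = t := by
  obtain ⟨n, hn, h, hh, e⟩ := D.exists_mul t⁻¹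
  exact ⟨h⁻¹, H.inv_mem hh, n⁻¹, N.inv_mem hn, by rw [← mul_inv_rev, e, inv_inv]⟩

theorem mem_center (D : HallDecomp s N H) {x : G} (hN : ∀ n ∈ N, Commute n x)
    (hH : ∀ h ∈ H, Commute h x) : x ∈ Subgroup.center G := by
  rw [mem_center_iff_commute]
  intro g
  obtain ⟨n, hn, h, hh, rfl⟩ := D.exists_mul g
  exact (hN n hn).mul_left (hH h hh)

theorem exists_not_commute (D : HallDecomp s N H) {h : G} (hh : h ∈ H)
    (hc : h ∉ Subgroup.center G) : ∃ n ∈ N, ¬ Commute n h := by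
  by_contra! hcon
  exact hc (D.mem_center hcon fun k hk ↦ D.abelian k hk h hh)

theorem coprime_orderOf (D : HallDecomp s N H) {h : G} (hh : h ∈ H) :
    (orderOf h).Coprime (Nat.card N) :=
  (D.coprime.coprime_dvd_right (Subgroup.orderOf_dvd_natCard H hh)).symm

theorem isVanishing_of_mem (D : HallDecomp s N H) (hsol : Group.IsSolvable N) {h : G}
    (hh : h ∈ H) (hc : h ∉ Subgroup.center G) : IsVanishing G h := by
  refine isVanishing_of_coprime_action N hsol (D.coprime_orderOf hh) (D.exists_not_commute hh hc)
    fun t ↦ ?_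
  obtain ⟨c, hcH, a, ha, rfl⟩ := D.exists_mul' t
  refine ⟨a, ha, 1, 1, fun x _ ↦ Commute.one_left x, ?_⟩
  have h1 : c⁻¹ * h * c = h := by
    rw [mul_assoc, D.abelian h hh c hcH, inv_mul_cancel_left]
  calc (c * a)⁻¹ * h * (c * a) = a⁻¹ * (c⁻¹ * h * c) * a := by group
    _ = _ := by rw [h1, pow_one, mul_one]

theorem commute_of_commute (D : HallDecomp s N H) (hv : vcs G = {s}) {h u x : G} (hh : h ∈ H)
    (hh' : IsVanishing G h) (hu : u ∈ N) (huh : Commute u h) (hx : Commute x h) : Commute x u :=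
  centralizer_le_of_isVanishing hv hh' huh.symm ((D.coprime_orderOf hh).coprime_dvd_right
    (Subgroup.orderOf_dvd_natCard N hu)) hx

theorem relIndex_centralizer (D : HallDecomp s N H) (hv : vcs G = {s}) {h : G} (hh : h ∈ H)
    (hh' : IsVanishing G h) : (Subgroup.centralizer {h}).relIndex N = s := by
  rw [← classSize_of_isVanishing hv hh', classSize,
    ← relIndex_mul_index_sup (Subgroup.centralizer {h}) N]
  have h1 : Subgroup.centralizer {h} ⊔ N = ⊤ := by
    rw [eq_top_iff, ← D.sup, sup_comm]
    refine sup_le_sup_right (fun k hk ↦ ?_) N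
    rw [mem_centralizer_singleton]
    exact D.abelian k hk h hh
  rw [h1, Subgroup.index_top, mul_one]

theorem isFrobenius (D : HallDecomp s N H) (hs : 1 < s)
    (hfix : ∀ h ∈ H, h ∉ Subgroup.center G → ∀ n ∈ N, Commute n h → n ∈ Subgroup.center G)
    {h0 : G} (h0H : h0 ∈ H) (h0c : h0 ∉ Subgroup.center G)
    (hcard : (Subgroup.centralizer {h0}).relIndex N = s) :
    IsFrobenius (N.map (QuotientGroup.mk' (Subgroup.center G)))
      (H.map (QuotientGroup.mk' (Subgroup.center G))) ∧
    Nat.card (N.map (QuotientGroup.mk' (Subgroup.center G))) = s := by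
  set π := QuotientGroup.mk' (Subgroup.center G) with hπ
  have hsurj : Function.Surjective π := QuotientGroup.mk'_surjective _
  have hpi (x : G) : π x = 1 ↔ x ∈ Subgroup.center G := QuotientGroup.eq_one_iff x
  set N' := N.map π with hN'
  set H' := H.map π with hH'
  have hN'n : N'.Normal := hNn.map π hsurj
  have hcN : Nat.card N' = s := by
    rw [← hcard, ← Subgroup.relIndex_ker, hπ, QuotientGroup.ker_mk',
      ← Subgroup.inf_relIndex_right (Subgroup.center G),
      ← Subgroup.inf_relIndex_right (Subgroup.centralizer {h0})]
    congr 1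
    ext x
    simp only [Subgroup.mem_inf, mem_centralizer_singleton]
    exact ⟨fun h ↦ ⟨(mem_center_iff_commute.1 h.1 h0).symm, h.2⟩,
      fun h ↦ ⟨hfix h0 h0H h0c x h.2 h.1, h.2⟩⟩
  have hdN : Nat.card N' ∣ Nat.card N := Subgroup.card_map_dvd N π
  have hdH : Nat.card H' ∣ Nat.card H := Subgroup.card_map_dvd H π
  have hinf : N' ⊓ H' = ⊥ := (Subgroup.disjoint_of_coprime_natCard
    ((D.coprime.coprime_dvd_left hdN).coprime_dvd_right hdH)).eq_bot
  have hsup : N' ⊔ H' = ⊤ := by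
    rw [hN', hH', ← Subgroup.map_sup, D.sup, ← MonoidHom.range_eq_map, MonoidHom.range_eq_top.2 hsurj]
  have hfpf (h : G) (hh : h ∈ H) (hc : h ∉ Subgroup.center G) (x : G ⧸ Subgroup.center G)
      (hx : x ∈ N') (hxh : Commute x (π h)) : x = 1 := by
    obtain ⟨n, hn, rfl⟩ := hx
    rw [hpi]
    refine hfix h hh hc n hn ?_
    have h1 : n⁻¹ * h⁻¹ * n * h ∈ Subgroup.center G := by
      rw [← hpi, map_mul, map_mul, map_mul, map_inv, map_inv, mul_assoc, hxh.eq]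
      group
    have h2 : n⁻¹ * h⁻¹ * n * h ∈ N := by
      rw [mul_assoc, mul_assoc]
      refine N.mul_mem (N.inv_mem hn) ?_
      simpa [mul_assoc] using hNn.conj_mem n hn h⁻¹
    have h3 := eq_one_of_coprime_commutator (h := h) (n := n) (by group)
      (mem_center_iff_commute.1 h1 h).symm (pow_card_eq_one_of_mem h2) (D.coprime_orderOf hh)
    calc n * h = h * n * (n⁻¹ * h⁻¹ * n * h) := by group
      _ = h * n := by rw [h3, mul_one]
  refine ⟨⟨⟨?_, ?_, hN'n, ?_⟩, hsup, hinf⟩, hcN⟩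
  · intro h
    rw [h, Subgroup.card_bot] at hcN
    omega
  · intro h
    rw [h, top_inf_eq] at hinf
    apply h0c
    rw [← hpi, ← Subgroup.mem_bot, ← hinf]
    exact Subgroup.mem_map_of_mem _ h0H
  · intro k hk hk1 x hx
    rw [mem_centralizer_singleton] at hx
    obtain ⟨x, rfl⟩ := hsurj x
    obtain ⟨m, hm, h, hh, rfl⟩ := D.exists_mul x
    by_cases hc : h ∈ Subgroup.center G
    · rw [map_mul, (hpi h).2 hc, mul_one]
      exact Subgroup.mem_map_of_mem _ hm
    exfalso
    obtain ⟨n, hn, hmn⟩ := exists_conj_mul_of_fixedPointFree (hfpf h hh hc)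
      (Subgroup.mem_map_of_mem _ hm)
    rw [map_mul, hmn] at hx
    have h1 : n * k * n⁻¹ = 1 := by
      refine hfpf h hh hc _ (hN'n.conj_mem k hk n) ?_
      rw [commute_iff_eq] at hx ⊢
      calc n * k * n⁻¹ * π h = n * (k * (n⁻¹ * π h * n)) * n⁻¹ := by group
        _ = _ := by rw [← hx]; group
    exact hk1 (conj_eq_one_iff.1 h1)

end HallDecomp

end HallDecomposition

section PrimePower

set_option linter.unusedSectionVars false

variable {G : Type} [Group G] [Finite G] {s : ℕ} {N H : Subgroup G} [hNn : N.Normal]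

theorem exists_primePow_of_notMem_center {h : G} (hh : h ∈ H) (hc : h ∉ Subgroup.center G) :
    ∃ (h : G) (q m : ℕ), h ∈ H ∧ h ∉ Subgroup.center G ∧ q.Prime ∧ h ^ q ^ m = 1 := by
  by_contra! hcon
  refine hc (mem_of_primePow_mem _ _ (orderOf_pos h) h (pow_orderOf_eq_one h) fun q m k hq hk ↦ ?_)
  by_contra hc'
  exact hcon _ q m (H.pow_mem hh k) hc' hq hk

theorem prime_dvd_card_of_primePow {h : G} {q m : ℕ} [hq : Fact q.Prime] (hhH : h ∈ H)
    (hhc : h ∉ Subgroup.center G) (hhq : h ^ q ^ m = 1) : q ∣ Nat.card H := by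
  have h1 : orderOf h ≠ 1 := fun h1 ↦ hhc (by rw [orderOf_eq_one_iff.1 h1]; exact Subgroup.one_mem _)
  obtain ⟨q', hq', hd⟩ := Nat.exists_prime_and_dvd h1
  have h2 := hq'.dvd_of_dvd_pow (hd.trans (orderOf_dvd_of_pow_eq_one hhq))
  rw [← (Nat.prime_dvd_prime_iff_eq hq' hq.out).1 h2]
  exact hd.trans (Subgroup.orderOf_dvd_natCard H hhH)

namespace HallDecomp

theorem classSize_coe_eq (D : HallDecomp s N H) {x : N}
    (hx : ∀ h ∈ H, Commute h (x : G)) : classSize x = classSize (x : G) := by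
  rw [classSize_eq_relIndex, classSize,
    ← relIndex_mul_index_sup (Subgroup.centralizer {(x : G)}) N]
  have h1 : Subgroup.centralizer {(x : G)} ⊔ N = ⊤ := by
    rw [eq_top_iff, ← D.sup, sup_comm]
    refine sup_le_sup_right (fun k hk ↦ ?_) N
    rw [mem_centralizer_singleton]
    exact hx k hk
  rw [h1, Subgroup.index_top, mul_one]

theorem isVanishing_of_isNilpotent (D : HallDecomp s N H) (hnil : Group.IsNilpotent N) {u : G}
    (hu : u ∈ N) (huH : ∀ h ∈ H, Commute h u) (huc : u ∉ Subgroup.center G) : IsVanishing G u := by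
  refine _root_.isVanishing_of_isNilpotent N hnil hu ?_ fun g ↦ ?_
  · by_contra! hcon
    exact huc (D.mem_center hcon huH)
  · obtain ⟨n, hn, h, hh, rfl⟩ := D.exists_mul g
    exact ⟨n, hn, h, huH h hh, rfl⟩

theorem cs_eq (D : HallDecomp s N H) (hv : vcs G = {s}) (hnil : Group.IsNilpotent N)
    (hH : ∀ h ∈ H, h ∈ Subgroup.center G) : cs N = {1, s} := by
  have hcom (h : G) (hh : h ∈ H) (x : G) : Commute h x :=
    (mem_center_iff_commute.1 (hH h hh) x).symm
  have key (x : N) : classSize x = if (x : G) ∈ Subgroup.center G then 1 else s := by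
    rw [D.classSize_coe_eq fun h hh ↦ hcom h hh x]
    split_ifs with hx
    · exact classSize_eq_one_iff.2 hx
    · exact classSize_of_isVanishing hv
        (D.isVanishing_of_isNilpotent hnil x.2 (fun h hh ↦ hcom h hh x) hx)
  ext n
  simp only [cs, Set.mem_ofPred_eq, Set.mem_insert_iff, Set.mem_singleton_iff]
  constructor
  · rintro ⟨x, rfl⟩
    rw [key]
    split_ifs <;> simp
  · rintro (rfl | rfl)
    · exact ⟨1, by rw [key, if_pos (by simp)]⟩
    · by_contra! hcon
      obtain ⟨v, hv'⟩ := exists_isVanishing hv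
      refine not_isVanishing_of_mem_center ?_ hv'
      obtain ⟨m, hm, h, hh, rfl⟩ := D.exists_mul v
      refine Subgroup.mul_mem _ ?_ (hH h hh)
      by_contra hc
      exact hcon ⟨m, hm⟩ (by rw [key, if_neg hc])

theorem not_isVanishing_of_mem_of_isNilpotent (D : HallDecomp s N H) (hv : vcs G = {s})
    (hnil : Group.IsNilpotent N)
    (hH : ∃ h ∈ H, h ∉ Subgroup.center G) : ∀ v ∈ N, ¬ IsVanishing G v := by
  have hsol : Group.IsSolvable N := inferInstance
  obtain ⟨h0, h0H, h0c⟩ := hH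
  obtain ⟨h, q, m, hhH, hhc, hq, hhq⟩ := exists_primePow_of_notMem_center h0H h0c
  have := Fact.mk hq
  have hhV := D.isVanishing_of_mem hsol hhH hhc
  have hqH := prime_dvd_card_of_primePow hhH hhc hhq
  have hqs : ¬ q ∣ s := fun hd ↦ hq.one_lt.ne' (Nat.eq_one_of_dvd_coprimes D.coprime' hd hqH)
  intro v0 hv0 hv0V
  -- replace `v0` by a conjugate commuting with `h`
  obtain ⟨v, hvN, hvV, hvh⟩ : ∃ v ∈ N, IsVanishing G v ∧ Commute v h := by
    have := Fintype.ofFinite G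
    have hcl : Nat.card {y : G | IsConj v0 y} = s := by
      rw [← classSize_of_isVanishing hv hv0V, ← card_isConj, Nat.card_eq_fintype_card,
        Fintype.card_subtype]
      simp
    obtain ⟨v, hv1, hv2⟩ := exists_commute_of_not_dvd_card (isPGroup_zpowers hhq)
      {y : G | IsConj v0 y} (fun γ _ x hx ↦ hx.trans (isConj_iff.2 ⟨γ, rfl⟩)) (by rwa [hcl])
    obtain ⟨c, rfl⟩ := isConj_iff.1 hv1
    exact ⟨_, hNn.conj_mem _ hv0 c, hv0V.conj c, (hv2 h (Subgroup.mem_zpowers h)).symm⟩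
  have hCv (x : G) (hx : Commute x v) : Commute x h :=
    centralizer_le_of_isVanishing hv hvV hvh (((D.coprime_orderOf hhH).coprime_dvd_right
      (Subgroup.orderOf_dvd_natCard N hvN)).symm) hx
  -- the centralizer of `h` in `N` is self-normalizing in `N`
  set C := (Subgroup.centralizer {h}).subgroupOf N with hC
  have hCmem (x : N) : x ∈ C ↔ Commute (x : G) h := by
    rw [hC, Subgroup.mem_subgroupOf, mem_centralizer_singleton]
  have hCtop : C = ⊤ := by
    by_contra hne
    have hlt := Group.normalizerCondition_of_isNilpotent (G := N) C (lt_top_iff_ne_top.2 hne)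
    obtain ⟨r, hr, hrC⟩ := SetLike.exists_of_lt hlt
    apply hrC
    rw [hCmem]
    have h1 : Commute ((r : G) * v * (r : G)⁻¹) h := by
      have h2 := (Subgroup.mem_normalizer_iff.1 hr ⟨v, hvN⟩).1 ((hCmem _).2 hvh)
      exact (hCmem _).1 h2
    have h3 : Commute ((r : G)⁻¹ * h⁻¹ * r * h) v := by
      have h4 : (r : G) * v * (r : G)⁻¹ = h⁻¹ * (r * v * (r : G)⁻¹) * h := by
        rw [mul_assoc h⁻¹, h1.eq, inv_mul_cancel_left]
      have h5 : h * v * h⁻¹ = v := by rw [← hvh.eq, mul_inv_cancel_right]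
      rw [commute_iff_eq]
      calc (r : G)⁻¹ * h⁻¹ * r * h * v
          = (r : G)⁻¹ * (h⁻¹ * (r * (h * v * h⁻¹) * (r : G)⁻¹) * h) * (h⁻¹ * r * h) := by group
        _ = v * ((r : G)⁻¹ * h⁻¹ * r * h) := by rw [h5, ← h4]; group
    refine commute_of_commutator_commute (K := N) hhq ?_ ?_ (hCv _ h3)
    · intro hd
      exact hqs (D.dvd q hq hd)
    · rw [mul_assoc, mul_assoc]
      refine N.mul_mem (N.inv_mem r.2) ?_
      simpa [mul_assoc] using hNn.conj_mem r r.2 h⁻¹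
  obtain ⟨n, hn, hnh⟩ := D.exists_not_commute hhH hhc
  exact hnh ((hCmem ⟨n, hn⟩).1 (hCtop ▸ trivial))

theorem isFrobenius_of_isNilpotent (D : HallDecomp s N H) (hv : vcs G = {s})
    (hnil : Group.IsNilpotent N)
    {h0 : G} (h0H : h0 ∈ H) (h0c : h0 ∉ Subgroup.center G) :
    (IsFrobenius (N.map (QuotientGroup.mk' (Subgroup.center G)))
      (H.map (QuotientGroup.mk' (Subgroup.center G))) ∧
    Nat.card (N.map (QuotientGroup.mk' (Subgroup.center G))) = s) ∧
    ∀ x ∈ N, ¬ IsVanishing G x := by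
  have hV := D.not_isVanishing_of_mem_of_isNilpotent hv hnil ⟨h0, h0H, h0c⟩
  have hsol : Group.IsSolvable N := inferInstance
  refine ⟨D.isFrobenius (one_lt_of_vcs hv) (fun h hh hc n hn hnh ↦ ?_) h0H h0c
    (D.relIndex_centralizer hv h0H (D.isVanishing_of_mem hsol h0H h0c)), hV⟩
  by_contra hnc
  exact hV n hn (D.isVanishing_of_isNilpotent hnil hn (fun k hk ↦ D.commute_of_commute hv hh
    (D.isVanishing_of_mem hsol hh hc) hn hnh (D.abelian k hk h hh)) hnc)

end HallDecomp

end PrimePower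

section SquarefreeNoncentral

set_option linter.unusedSectionVars false

variable {G : Type} [Group G] [Finite G] {s : ℕ} {r : ℕ} [hr : Fact r.Prime]

theorem IsSyl.of_hall {K L R : Subgroup G} (hR : IsSyl r K R) (hKL : K ≤ L)
    (hK : ¬ r ∣ K.index) : IsSyl r L R := by
  refine ⟨hR.1.trans hKL, ?_⟩
  have h1 := card_inf_mul_relIndex K L
  rw [inf_of_le_left hKL] at h1
  have h2 : ¬ r ∣ K.relIndex L := fun h ↦
    hK (h.trans (Dvd.intro _ (Subgroup.relIndex_mul_index hKL)))
  have h3 : K.relIndex L ≠ 0 := fun h ↦ h2 (h ▸ dvd_zero r)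
  rw [hR.2, ← h1, Nat.factorization_mul Nat.card_pos.ne' h3, Finsupp.add_apply,
    Nat.factorization_eq_zero_of_not_dvd h2, add_zero]

theorem IsSyl.not_dvd_index {C R : Subgroup G} (hR : IsSyl r ⊤ R) (hRC : R ≤ C) :
    ¬ r ∣ C.index := by
  intro h
  have h1 : Nat.card R * r ∣ Nat.card G := by
    rw [← C.card_mul_index]
    exact mul_dvd_mul (Subgroup.card_dvd_of_le hRC) h
  rw [hR.2, ← pow_succ, Subgroup.card_top] at h1
  exact Nat.pow_succ_factorization_not_dvd Nat.card_pos.ne' hr.out h1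

theorem exists_pow_mul_of_relIndex {A R : Subgroup G} (hR : ∀ x ∈ R, ∀ y ∈ R, Commute x y)
    (hA : A.relIndex R = r) {y w : G} (hy : y ∈ R) (hyA : y ∉ A) (hw : w ∈ R) :
    ∃ k : ℕ, ∃ c ∈ A, w = y ^ k * c := by
  have hn : (A.subgroupOf R).Normal := ⟨fun x hx g ↦ by
    have : g * x * g⁻¹ = x := by
      apply Subtype.ext
      change (g : G) * x * (g : G)⁻¹ = x
      rw [(hR g g.2 x x.2).eq, mul_inv_cancel_right]
    rwa [this]⟩
  have hcard : Nat.card (R ⧸ A.subgroupOf R) = r := hA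
  have h1 : ((⟨y, hy⟩ : R) : R ⧸ A.subgroupOf R) ≠ 1 := by
    rw [Ne, QuotientGroup.eq_one_iff, Subgroup.mem_subgroupOf]
    exact hyA
  obtain ⟨k, hk⟩ := mem_powers_of_prime_card hcard h1 (g' := ((⟨w, hw⟩ : R) : R ⧸ A.subgroupOf R))
  refine ⟨k, (y ^ k)⁻¹ * w, ?_, by group⟩
  simp only [← QuotientGroup.mk_pow] at hk
  rw [QuotientGroup.eq, Subgroup.mem_subgroupOf] at hk
  exact hk

theorem factorization_eq_one_of_squarefree (hs : Squarefree s) (h : r ∣ s) :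
    s.factorization r = 1 :=
  le_antisymm (hs.natFactorization_le_one r)
    (hr.out.factorization_pos_of_dvd (hs.ne_zero) h)

namespace HallDecomp

variable {N H : Subgroup G} [hNn : N.Normal]

theorem commute_of_squarefree (D : HallDecomp s N H) (hv : vcs G = {s}) (hs : Squarefree s)
    (hsol : Group.IsSolvable G) {h : G} {q m : ℕ} [hq : Fact q.Prime] (hhH : h ∈ H)
    (hhc : h ∉ Subgroup.center G) (hhq : h ^ q ^ m = 1) (hqN : ¬ q ∣ Nat.card N) (b : ℕ) :
    ∀ (K : Subgroup G) [K.Normal], Nat.card K ≤ b → (Nat.card K).Coprime K.index → K ≤ N →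
      (∀ x ∈ N, ∃ k ∈ K, ∃ z, (∀ y ∈ N, Commute z y) ∧ x = k * z) →
      ∀ x ∈ N, ∀ y ∈ N, Commute x y := by
  induction b with
  | zero => intro K _ h; exact absurd h (by have := Nat.card_pos (α := K); omega)
  | succ b ih =>
    intro K hKn hb hco hKN hdec
    by_cases h1 : Nat.card K = 1
    · rw [Subgroup.card_eq_one] at h1
      intro x hx y hy
      obtain ⟨k, hk, z, hz, rfl⟩ := hdec x hx
      rw [h1, Subgroup.mem_bot] at hk
      rw [hk, one_mul]
      exact hz y hy
    set r := (Nat.card K).minFac with hrdef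
    have hr := Fact.mk (Nat.minFac_prime h1)
    have hrK : r ∣ Nat.card K := Nat.minFac_dvd _
    have hrs : r ∣ s := D.dvd r hr.out (hrK.trans (Subgroup.card_dvd_of_le hKN))
    obtain ⟨n, hn⟩ := hsol.solvable
    have hRN : RNilp r K := rNilp_of_vcs hv hs hco (hn ▸ bot_le) fun q hq h ↦
      Nat.minFac_le_of_dvd hq.two_le h
    set K2 := regularPart r K hRN with hK2
    have hhV : IsVanishing G h := D.isVanishing_of_mem inferInstance hhH hhc
    have hΓ := isPGroup_zpowers hhq
    have hqK : ¬ q ∣ Nat.card K := fun h ↦ hqN (h.trans (Subgroup.card_dvd_of_le hKN))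
    obtain ⟨R, hR, hRΓ⟩ := exists_isSyl_normalizes (r := r) hΓ
      (normalizes_of_normal (Subgroup.zpowers h) K) hqK
    have hrKi : ¬ r ∣ K.index := fun h ↦ hr.out.one_lt.ne' (Nat.eq_one_of_dvd_coprimes hco hrK h)
    have hRsylN := hR.of_hall hKN hrKi
    have hRsylG := hR.of_hall le_top hrKi
    have hcent : Subgroup.centralizer (Subgroup.zpowers h : Set G) = Subgroup.centralizer {h} := by
      ext x
      rw [mem_centralizer_zpowers, mem_centralizer_singleton]
    set R1 := R ⊓ Subgroup.centralizer (Subgroup.zpowers h : Set G) with hR1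
    have hR1idx : R1.relIndex R = r := by
      rw [IsSyl.relIndex_eq inf_le_left (hRsylN.inf_centralizer hΓ (normalizes_of_normal _ N) hqN hRΓ)
        hRsylN inf_le_left, inf_comm, Subgroup.inf_relIndex_right, hcent,
        D.relIndex_centralizer hv hhH hhV, factorization_eq_one_of_squarefree hs hrs, pow_one]
    have hRN' : R ≤ N := hR.1.trans hKN
    have hRab : ∀ x ∈ R, ∀ y ∈ R, Commute x y :=
      (commute_of_relIndex_inf_centralizer hhq
        (fun h ↦ hqN (h.trans (Subgroup.card_dvd_of_le hRN'))) hR.isPGroup hRΓ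
        (fun x _ y hy hxh hyh ↦ D.commute_of_commute hv hhH hhV (hRN' hy) hyh hxh) hR1idx).1
    have hRV (y : G) (hy : y ∈ R) : ¬ IsVanishing G y := fun h ↦ by
      refine hRsylG.not_dvd_index (C := Subgroup.centralizer {y}) (fun x hx ↦ ?_) ?_
      · rw [mem_centralizer_singleton]
        exact hRab x hx y hy
      · have := classSize_of_isVanishing hv h
        rw [classSize] at this
        rwa [this]
    have hK2sol : Group.IsSolvable K2 := inferInstance
    have hRco (y : G) (hy : y ∈ R) : (orderOf y).Coprime (Nat.card K2) := by
      refine Nat.Coprime.coprime_dvd_left (Subgroup.orderOf_dvd_natCard R hy) ?_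
      rw [hR.2]
      exact ((Nat.Prime.coprime_iff_not_dvd hr.out).2
        (not_dvd_card_regularPart (h := hRN))).pow_left _
    have hdecG (t : G) : ∃ a ∈ K2, ∃ x ∈ R, ∃ z, (∀ y ∈ N, Commute z y) ∧ ∃ k ∈ H,
        t = a * x * z * k := by
      obtain ⟨n, hn, k, hk, rfl⟩ := D.exists_mul t
      obtain ⟨c, hc, z, hz, rfl⟩ := hdec n hn
      obtain ⟨a, ha, x, hx, rfl⟩ := hR.exists_mul_regularPart hRN hc
      exact ⟨a, ha, x, hx, z, hz, k, hk, rfl⟩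
    have hR1K2 (y : G) (hy : y ∈ R1) (a : G) (ha : a ∈ K2) : Commute a y := by
      by_contra hnc
      refine hRV y hy.1 (isVanishing_of_coprime_action K2 hK2sol (hRco y hy.1) ⟨a, ha, hnc⟩
        fun t ↦ ?_)
      obtain ⟨a, ha, x, hx, z, hz, k, hk, htt⟩ := hdecG t⁻¹
      refine ⟨a⁻¹, K2.inv_mem ha, 1, 1, fun x _ ↦ Commute.one_left x, ?_⟩
      have hky : Commute k y := D.commute_of_commute hv hhH hhV (hRN' hy.1)
        (mem_centralizer_zpowers.1 hy.2) (D.abelian k hk h hhH)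
      have hc : Commute (x * z * k) y :=
        ((hRab x hx y hy.1).mul_left (hz y (hRN' hy.1))).mul_left hky
      rw [← inv_inv t, htt]
      calc (a * x * z * k)⁻¹⁻¹ * y * (a * x * z * k)⁻¹
          = a * ((x * z * k) * y * (x * z * k)⁻¹) * a⁻¹ := by group
        _ = _ := by rw [hc.eq, mul_inv_cancel_right, pow_one, mul_one, inv_inv]
    have hRK2 (y : G) (hy : y ∈ R) (a : G) (ha : a ∈ K2) : Commute a y := by
      by_cases hyR1 : y ∈ R1
      · exact hR1K2 y hyR1 a ha
      by_contra hnc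
      refine hRV y hy (isVanishing_of_coprime_action K2 hK2sol (hRco y hy) ⟨a, ha, hnc⟩
        fun t ↦ ?_)
      have h2 := hR.map_cj t⁻¹
      rw [(normalizes_of_normal ⊤ K).cj_eq (γ := t⁻¹) trivial] at h2
      obtain ⟨k, hk, hkR⟩ := hR.exists_cj h2
      obtain ⟨a, ha, x, hx, rfl⟩ := hR.exists_mul_regularPart hRN hk
      have h3 : t⁻¹ * y * t ∈ cj (a * x) R := by
        rw [← hkR, mem_cj]
        have : t⁻¹⁻¹ * (t⁻¹ * y * t) * t⁻¹ = y := by group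
        rwa [this]
      rw [mem_cj] at h3
      have h4 : a⁻¹ * (t⁻¹ * y * t) * a ∈ R := by
        have := R.mul_mem (R.mul_mem hx h3) (R.inv_mem hx)
        have e : x * ((a * x)⁻¹ * (t⁻¹ * y * t) * (a * x)) * x⁻¹ = a⁻¹ * (t⁻¹ * y * t) * a := by
          group
        rwa [e] at this
      obtain ⟨k, c, hc, hkc⟩ := exists_pow_mul_of_relIndex hRab hR1idx hy hyR1 h4
      refine ⟨a⁻¹, K2.inv_mem ha, k, c, fun x hx ↦ (hR1K2 c hc x hx).symm, ?_⟩
      rw [← hkc]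
      group
    refine ih K2 ?_ (coprime_card_regularPart hRN hco) ((regularPart_le (h := hRN)).trans hKN) ?_
    · have : Nat.card K2 < Nat.card K := card_regularPart_lt hRN hrK
      omega
    · intro x hx
      obtain ⟨k, hk, z, hz, rfl⟩ := hdec x hx
      obtain ⟨a, ha, ρ, hρ, rfl⟩ := hR.exists_mul_regularPart hRN hk
      refine ⟨a, ha, ρ * z, fun y hy ↦ Commute.mul_left ?_ (hz y hy), mul_assoc _ _ _⟩
      obtain ⟨k', hk', z', hz', rfl⟩ := hdec y hy
      obtain ⟨a', ha', ρ', hρ', rfl⟩ := hR.exists_mul_regularPart hRN hk'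
      exact ((hRK2 ρ hρ a' ha').symm.mul_right (hRab ρ hρ ρ' hρ')).mul_right
        (hz' ρ (hRN' hρ)).symm

theorem isFrobenius_of_squarefree (D : HallDecomp s N H) (hv : vcs G = {s}) (hs : Squarefree s)
    (hsol : Group.IsSolvable G) (hco : (Nat.card N).Coprime N.index)
    {h0 : G} (h0H : h0 ∈ H) (h0c : h0 ∉ Subgroup.center G) :
    (IsFrobenius (N.map (QuotientGroup.mk' (Subgroup.center G)))
      (H.map (QuotientGroup.mk' (Subgroup.center G))) ∧
    Nat.card (N.map (QuotientGroup.mk' (Subgroup.center G))) = s) ∧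
    ∀ x ∈ N, ¬ IsVanishing G x := by
  obtain ⟨h, q, m, hhH, hhc, hq, hhq⟩ := exists_primePow_of_notMem_center h0H h0c
  have := Fact.mk hq
  have hqN : ¬ q ∣ Nat.card N := fun h ↦ hq.one_lt.ne'
    (Nat.eq_one_of_dvd_coprimes D.coprime h (prime_dvd_card_of_primePow hhH hhc hhq))
  have hab := D.commute_of_squarefree hv hs hsol hhH hhc hhq hqN _ N le_rfl hco le_rfl
    fun x hx ↦ ⟨x, hx, 1, fun y _ ↦ Commute.one_left y, (mul_one x).symm⟩
  have hnil : Group.IsNilpotent N := by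
    let _ : CommGroup N :=
      { mul_comm := fun x y ↦ Subtype.ext (hab x x.2 y y.2) }
    infer_instance
  exact D.isFrobenius_of_isNilpotent hv hnil h0H h0c

end HallDecomp

end SquarefreeNoncentral

section SquarefreeCentral

set_option linter.unusedSectionVars false

variable {G : Type} [Group G] [Finite G] {s : ℕ} {r : ℕ} [hr : Fact r.Prime]

theorem normal_subgroupOf_of_relIndex {A R : Subgroup G} (hR : IsPGroup r R)
    (hA : A.relIndex R = r) : (A.subgroupOf R).Normal := by
  have hAi : (A.subgroupOf R).index = r := hA
  apply Subgroup.normal_of_index_eq_minFac_card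
  obtain ⟨m, hm⟩ := IsPGroup.iff_card.1 hR
  have : m ≠ 0 := by
    rintro rfl
    have h1 := Subgroup.index_dvd_card (A.subgroupOf R)
    rw [hAi, hm, pow_zero] at h1
    exact hr.out.one_lt.ne' (Nat.dvd_one.1 h1)
  rw [hAi, hm, Nat.pow_minFac this, hr.out.minFac_eq]

theorem exists_acts_trivially_of_relIndex {Q D R : Subgroup G} (hQ : IsPGroup r Q)
    (hD : D.relIndex Q = r) (hRQ : Normalizes R Q) (hRD : Normalizes R (Q ⊓ D))
    (hnc : ∃ x ∈ R, ∃ y ∈ R, ¬ Commute x y) :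
    ∃ h ∈ R, (∃ y ∈ R, ¬ Commute h y) ∧ ∀ x ∈ Q, x⁻¹ * h * x * h⁻¹ ∈ D := by
  have hDn := normal_subgroupOf_of_relIndex hQ hD
  have hle : R ≤ Subgroup.normalizer (Q : Set G) := by
    intro ρ hρ
    rw [Subgroup.mem_normalizer_iff]
    refine fun x ↦ ⟨hRQ ρ hρ x, fun h ↦ ?_⟩
    have := hRQ ρ⁻¹ (R.inv_mem hρ) _ h
    rwa [show ρ⁻¹ * (ρ * x * ρ⁻¹) * ρ⁻¹⁻¹ = x by group] at this
  let c : R →* MulAut Q := (Subgroup.normalizerMonoidHom Q).comp (Subgroup.inclusion hle)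
  have hc (ρ : R) (x : Q) : ((c ρ x : Q) : G) = ρ * x * (ρ : G)⁻¹ := rfl
  have hcD (ρ : R) (x : Q) (hx : x ∈ D.subgroupOf Q) : c ρ x ∈ D.subgroupOf Q := by
    rw [Subgroup.mem_subgroupOf, hc]
    exact (hRD ρ ρ.2 x ⟨x.2, hx⟩).2
  have hcmap (ρ : R) : (D.subgroupOf Q).map (c ρ : Q →* Q) = D.subgroupOf Q := by
    apply le_antisymm
    · rintro _ ⟨x, hx, rfl⟩
      exact hcD ρ x hx
    · intro x hx
      refine ⟨c ρ⁻¹ x, hcD _ _ hx, ?_⟩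
      change (c ρ * c ρ⁻¹) x = x
      rw [← map_mul, mul_inv_cancel, map_one, MulAut.one_apply]
  let f : R →* MulAut (Q ⧸ D.subgroupOf Q) :=
    { toFun := fun ρ ↦ QuotientGroup.congr _ _ (c ρ) (hcmap ρ)
      map_one' := by
        ext x
        induction x using QuotientGroup.induction_on
        simp
      map_mul' := fun a b ↦ by
        ext x
        induction x using QuotientGroup.induction_on
        simp }
  have hcard : Nat.card (Q ⧸ D.subgroupOf Q) = r := hD
  have hcyc : IsCyclic (Q ⧸ D.subgroupOf Q) := isCyclic_of_prime_card hcard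
  have hcyc2 : IsCyclic (MulAut (Q ⧸ D.subgroupOf Q)) := by
    have e := IsCyclic.mulAutMulEquiv (Q ⧸ D.subgroupOf Q)
    rw [hcard] at e
    exact isCyclic_of_surjective e.symm e.symm.surjective
  obtain ⟨x, hx, y, hy, hxy⟩ := hnc
  obtain ⟨h, hh, hhc⟩ : ∃ h ∈ f.ker, h ∉ Subgroup.center R := by
    by_contra! hcon
    have := (MonoidHom.isMulCommutative_of_isCyclic_of_ker_le_center f hcon).is_comm.comm
      ⟨x, hx⟩ ⟨y, hy⟩
    exact hxy (congrArg Subtype.val this)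
  refine ⟨h, h.2, ?_, fun x hx ↦ ?_⟩
  · by_contra! hcon
    refine hhc (Subgroup.mem_center_iff.2 fun y ↦ Subtype.ext (hcon y y.2).symm)
  · have h1 : ((c h ⟨x, hx⟩ : Q) : Q ⧸ D.subgroupOf Q) = ((⟨x, hx⟩ : Q) : Q ⧸ D.subgroupOf Q) :=
      DFunLike.congr_fun (MonoidHom.mem_ker.1 hh) ((⟨x, hx⟩ : Q) : Q ⧸ D.subgroupOf Q)
    rw [eq_comm, QuotientGroup.eq, Subgroup.mem_subgroupOf] at h1
    have h2 : x⁻¹ * (h * x * (h : G)⁻¹) ∈ D := h1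
    simpa [mul_assoc] using h2

/-- A group with a normal `r`-complement cannot satisfy `vcs G = {s}` with `s` square-free
and divisible by `r` and another prime. -/
theorem false_of_rNilp_top (hv : vcs G = {s}) (hs : Squarefree s) (hsol : Group.IsSolvable G)
    (hN : RNilp r (⊤ : Subgroup G)) (hrs : r ∣ s) {q : ℕ} [hq : Fact q.Prime] (hqr : q ≠ r)
    (hqs : q ∣ s) : False := by
  set K := regularPart r ⊤ hN with hK
  have hrK : ¬ r ∣ Nat.card K := not_dvd_card_regularPart
  obtain ⟨R, hR⟩ := exists_isSyl r (⊤ : Subgroup G)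
  have hRp := hR.isPGroup
  have hco : (Nat.card R).Coprime (Nat.card K) := by
    rw [hR.2]
    exact ((Nat.Prime.coprime_iff_not_dvd hr.out).2 hrK).pow_left _
  have hinf : R ⊓ K = ⊥ := (Subgroup.disjoint_of_coprime_natCard hco).eq_bot
  have hRco {y : G} (hy : y ∈ R) : (orderOf y).Coprime (Nat.card K) :=
    Nat.Coprime.coprime_dvd_left (Subgroup.orderOf_dvd_natCard R hy) hco
  have hnd {y : G} (hy : IsVanishing G y) (hle : R ≤ Subgroup.centralizer {y}) : False := by
    refine hR.not_dvd_index hle ?_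
    have := classSize_of_isVanishing hv hy
    rw [classSize] at this
    rwa [this]
  have hdec (t : G) : ∃ a ∈ K, ∃ x ∈ R, t = a * x := hR.exists_mul_regularPart hN trivial
  by_cases hab : ∀ x ∈ R, ∀ y ∈ R, Commute x y
  · have hRle (y : G) (hy : y ∈ R) : R ≤ Subgroup.centralizer {y} := fun x hx ↦
      mem_centralizer_singleton.2 (hab x hx y hy)
    have hRK (y : G) (hy : y ∈ R) (a : G) (ha : a ∈ K) : Commute a y := by
      by_contra hnc
      refine hnd (isVanishing_of_coprime_action K inferInstance (hRco hy) ⟨a, ha, hnc⟩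
        fun t ↦ ?_) (hRle y hy)
      obtain ⟨a, ha, x, hx, ht⟩ := hdec t⁻¹
      refine ⟨a⁻¹, K.inv_mem ha, 1, 1, fun x _ ↦ Commute.one_left x, ?_⟩
      rw [← inv_inv t, ht]
      calc (a * x)⁻¹⁻¹ * y * (a * x)⁻¹ = a * (x * y * x⁻¹) * a⁻¹ := by group
        _ = _ := by rw [(hab x hx y hy).eq, mul_inv_cancel_right, pow_one, mul_one, inv_inv]
    obtain ⟨v, hvv⟩ := exists_isVanishing hv
    refine hnd hvv fun y hy ↦ mem_centralizer_singleton.2 ?_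
    obtain ⟨a, ha, x, hx, rfl⟩ := hdec v
    exact (hRK y hy a ha).symm.mul_right (hab y hy x hx)
  push Not at hab
  set π := QuotientGroup.mk' K with hπ
  have hpi (x : G) : π x = 1 ↔ x ∈ K := QuotientGroup.eq_one_iff x
  have hpiK (a : G) (ha : a ∈ K) : π a = 1 := (hpi a).2 ha
  have hpis : Function.Surjective (π.comp R.subtype) := by
    intro x
    obtain ⟨t, rfl⟩ := QuotientGroup.mk'_surjective K x
    obtain ⟨a, ha, x, hx, rfl⟩ := hdec t
    exact ⟨⟨x, hx⟩, by rw [map_mul, hpiK a ha, one_mul]; rfl⟩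
  have hpic {x y : G} (hx : x ∈ R) (hy : y ∈ R) (h : Commute (π x) (π y)) : Commute x y := by
    have h1 : x * y * x⁻¹ * y⁻¹ ∈ R ⊓ K := by
      refine ⟨R.mul_mem (R.mul_mem (R.mul_mem hx hy) (R.inv_mem hx)) (R.inv_mem hy), ?_⟩
      change _ ∈ K
      rw [← hpi, map_mul, map_mul, map_mul, map_inv, map_inv, h.eq]
      group
    rw [hinf, Subgroup.mem_bot] at h1
    exact (mul_inv_eq_iff_eq_mul.1 (mul_inv_eq_one.1 h1))
  have hVan {g : G} (hg : g ∈ R) (hgc : ∃ y ∈ R, ¬ Commute g y) : IsVanishing G g := by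
    obtain ⟨y, hy, hgy⟩ := hgc
    have hp : IsPGroup r (G ⧸ K) := hRp.of_surjective _ hpis
    have hnil : Group.IsNilpotent (G ⧸ K) := hp.isNilpotent
    refine IsVanishing.of_map π (QuotientGroup.mk'_surjective K)
      (isVanishing_of_isNilpotent ⊤ (Group.isNilpotent_top.2 hnil) trivial
      ⟨π y, trivial, fun h ↦ hgy (hpic hy hg h).symm⟩
      fun t ↦ ⟨t, trivial, 1, Commute.one_left _, (mul_one t).symm⟩)
  have hCcomp {g x : G} (hg : g ∈ R) (hx : x ∈ R) (h : x ∈ Subgroup.centralizer {g} ⊔ K) :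
      Commute x g := by
    obtain ⟨c, hc, k, hk, rfl⟩ := Subgroup.mem_sup_of_normal_right.1 h
    refine hpic hx hg ?_
    rw [map_mul, hpiK k hk, mul_one]
    exact (mem_centralizer_singleton.1 hc).map π
  have hidx {g : G} (hg : g ∈ R) (hgc : ∃ y ∈ R, ¬ Commute g y) :
      (Subgroup.centralizer {g}).relIndex R = r ∧
      (Subgroup.centralizer {g}).relIndex K * r = s := by
    set C := Subgroup.centralizer {g} with hC
    have h1 : C.relIndex K * (C ⊔ K).index = s := by
      rw [relIndex_mul_index_sup]
      exact classSize_of_isVanishing hv (hVan hg hgc)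
    have h2 : (C ⊔ K).index = C.relIndex R := by
      have h3 : ((C ⊔ K).map π).index = (C ⊔ K).index := by
        refine Subgroup.index_map_eq _ (QuotientGroup.mk'_surjective K) ?_
        rw [hπ, QuotientGroup.ker_mk']
        exact le_sup_right
      rw [← h3, ← Subgroup.index_comap_of_surjective _ hpis, Subgroup.relIndex]
      congr 1
      ext ρ
      rw [Subgroup.mem_subgroupOf, Subgroup.mem_comap]
      constructor
      · rintro ⟨x, hx, hxe⟩
        rw [hC, mem_centralizer_singleton]
        refine hCcomp hg ρ.2 ?_
        have : x⁻¹ * ρ ∈ K := by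
          rw [← hpi, map_mul, map_inv, hxe]
          exact inv_mul_cancel _
        rw [← mul_inv_cancel_left x (ρ : G)]
        exact (C ⊔ K).mul_mem hx (le_sup_right (a := C) this)
      · exact fun h ↦ ⟨ρ, le_sup_left (b := K) h, rfl⟩
    rw [h2] at h1
    have h4 : C.relIndex R = r := by
      obtain ⟨m, hm⟩ := (Nat.dvd_prime_pow hr.out).1
        (hR.2 ▸ Subgroup.relIndex_dvd_card C R)
      obtain ⟨hm, h5⟩ := hm
      have h6 : C.relIndex R ∣ s := Dvd.intro_left _ h1
      have h7 : m ≠ 0 := by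
        rintro rfl
        rw [pow_zero, Subgroup.relIndex_eq_one] at h5
        obtain ⟨y, hy, hgy⟩ := hgc
        exact hgy (mem_centralizer_singleton.1 (h5 hy)).symm
      have h8 : m ≤ 1 := by
        by_contra! hcon
        have := hs r ((sq r ▸ (pow_dvd_pow r hcon).trans (h5 ▸ h6)))
        exact hr.out.one_lt.ne' (Nat.isUnit_iff.1 this)
      rw [h5, show m = 1 by omega, pow_one]
    exact ⟨h4, h4 ▸ h1⟩
  obtain ⟨Q, hQ, hRQ⟩ := exists_isSyl_normalizes (r := q) hRp (normalizes_of_normal R K) hrK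
  have hQp := hQ.isPGroup
  have hrQ : ¬ r ∣ Nat.card Q := fun h ↦ hrK (h.trans (Subgroup.card_dvd_of_le hQ.1))
  have hpow {g : G} (hg : g ∈ R) : ∃ m, g ^ r ^ m = 1 := by
    obtain ⟨m, hm⟩ := hRp ⟨g, hg⟩
    exact ⟨m, congrArg Subtype.val hm⟩
  have hQidx {g : G} (hg : g ∈ R) (hgc : ∃ y ∈ R, ¬ Commute g y) :
      (Subgroup.centralizer {g}).relIndex Q = q := by
    obtain ⟨m, hm⟩ := hpow hg
    have hcent : Subgroup.centralizer (Subgroup.zpowers g : Set G) = Subgroup.centralizer {g} := by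
      ext x
      rw [mem_centralizer_zpowers, mem_centralizer_singleton]
    have hz : Normalizes (Subgroup.zpowers g) Q := fun γ hγ ↦
      hRQ γ (Subgroup.zpowers_le.2 hg hγ)
    have h1 := IsSyl.inf_centralizer (isPGroup_zpowers hm) (normalizes_of_normal _ K) hrK hQ hz
    rw [hcent] at h1
    have h2 := IsSyl.relIndex_eq inf_le_left h1 hQ inf_le_left
    rw [inf_comm, Subgroup.inf_relIndex_right, inf_comm, Subgroup.inf_relIndex_right] at h2
    have h3 := (hidx hg hgc).2
    have h4 := congrArg (fun n ↦ n.factorization q) h3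
    have h5 : (Subgroup.centralizer {g}).relIndex K ≠ 0 := by
      intro h0
      rw [h0, zero_mul] at h3
      exact hs.ne_zero h3.symm
    simp only [Nat.factorization_mul h5 hr.out.ne_zero, Finsupp.add_apply,
      factorization_eq_one_of_squarefree hs hqs, hr.out.factorization,
      Finsupp.single_eq_of_ne hqr, add_zero] at h4
    rw [h2, h4, pow_one]
  obtain ⟨g, hg, hgc⟩ := hab
  have hCA {x a : G} (hx : Commute x g) (ha : a ∈ K) (hag : Commute a g) : Commute x a :=
    centralizer_le_of_isVanishing hv (hVan hg hgc) hag.symm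
      ((hRco hg).coprime_dvd_right (Subgroup.orderOf_dvd_natCard K ha)) hx
  set D := Subgroup.centralizer {g} with hD
  have hRD : Normalizes R (Q ⊓ D) := by
    rintro ρ hρ a ⟨haQ, haD⟩
    refine ⟨hRQ ρ hρ a haQ, ?_⟩
    change _ ∈ D at haD
    change _ ∈ D
    rw [mem_centralizer_singleton] at haD ⊢
    have hn := normal_subgroupOf_of_relIndex hRp (hidx hg hgc).1
    have h1 := hn.conj_mem ⟨g, hg⟩ (by
      rw [Subgroup.mem_subgroupOf, mem_centralizer_singleton]) ⟨ρ⁻¹, R.inv_mem hρ⟩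
    rw [Subgroup.mem_subgroupOf, mem_centralizer_singleton] at h1
    have h2 : Commute (ρ⁻¹ * g * ρ) g := by simpa using h1
    have h3 : Commute (ρ⁻¹ * g * ρ) a := hCA h2 (hQ.1 haQ) haD
    have h4 := h3.map (MulAut.conj ρ)
    simp only [MulAut.conj_apply] at h4
    rw [show ρ * (ρ⁻¹ * g * ρ) * ρ⁻¹ = g by group] at h4
    exact h4.symm
  obtain ⟨h, hh, hhc, hhQ⟩ := exists_acts_trivially_of_relIndex hQp (hQidx hg hgc) hRQ hRD
    ⟨g, hg, hgc⟩
  have hcop {y x : G} (hy : y ∈ R) (hx : x ∈ Q) (hc : Commute (x⁻¹ * y * x * y⁻¹) y) :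
      Commute x y := by
    obtain ⟨m, hm⟩ := hpow (R.inv_mem hy)
    have h1 : x⁻¹ * y⁻¹⁻¹ * x * y⁻¹ ∈ Q := by
      have := Q.mul_mem (Q.inv_mem hx) (hRQ y hy x hx)
      simpa [mul_assoc] using this
    have := commute_of_commutator_commute hm hrQ h1 (by rw [inv_inv]; exact hc.inv_right)
    exact Commute.inv_right_iff.1 this
  have hhD : ¬ ∀ x ∈ Q, x ∈ D → Commute x h := by
    intro hcon
    have h1 : Q ≤ Subgroup.centralizer {h} := by
      intro x hx
      rw [mem_centralizer_singleton]
      refine hcop hh hx (hcon _ ?_ (hhQ x hx))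
      have := Q.mul_mem (Q.inv_mem hx) (hRQ h hh x hx)
      simpa [mul_assoc] using this
    have h2 := hQidx hh hhc
    rw [Subgroup.relIndex_eq_one.2 h1] at h2
    exact hq.out.one_lt.ne h2
  have hhg : ¬ Commute h g := fun hc ↦ hhD fun x hx hxD ↦
    (hCA hc (hQ.1 hx) (mem_centralizer_singleton.1 hxD)).symm
  have hgh : ∃ y ∈ R, ¬ Commute (g * h) y := ⟨g, hg, fun hc ↦ hhg (by
    have := (Commute.refl g).inv_left.mul_left hc
    rwa [inv_mul_cancel_left] at this)⟩
  have hle : Q ⊓ Subgroup.centralizer {g * h} ≤ Q ⊓ D := by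
    rintro x ⟨hxQ, hx⟩
    refine ⟨hxQ, ?_⟩
    change _ ∈ Subgroup.centralizer _ at hx
    change _ ∈ D
    rw [mem_centralizer_singleton] at hx ⊢
    refine hcop hg hxQ ?_
    have hd := mem_centralizer_singleton.1 (hhQ x hxQ)
    have e : x⁻¹ * g * x * g⁻¹ = (x⁻¹ * h * x * h⁻¹)⁻¹ := by
      have hd' : g * (x⁻¹ * h * x * h⁻¹) * g⁻¹ = x⁻¹ * h * x * h⁻¹ := by
        rw [← hd.eq, mul_inv_cancel_right]
      have hx' : x * (g * h) * x⁻¹ * (g * h)⁻¹ = 1 := by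
        rw [hx.eq]; group
      rw [eq_inv_iff_mul_eq_one, ← hd']
      calc x⁻¹ * g * x * g⁻¹ * (g * (x⁻¹ * h * x * h⁻¹) * g⁻¹)
          = x⁻¹ * (x * (g * h) * x⁻¹ * (g * h)⁻¹)⁻¹⁻¹ * x * (x⁻¹ * (g * h) * x * (g * h)⁻¹) := by
            rw [hx']; group
        _ = 1 := by
          rw [hx', inv_one, inv_one, mul_one, inv_mul_cancel, one_mul, mul_assoc x⁻¹, ← hx.eq]
          group
    rw [e]
    exact hd.inv_left
  have heq : Q ⊓ Subgroup.centralizer {g * h} = Q ⊓ D := by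
    refine Subgroup.eq_of_le_of_card_ge hle ?_
    have h1 := card_inf_mul_relIndex D Q
    have h2 := card_inf_mul_relIndex (Subgroup.centralizer {g * h}) Q
    rw [hQidx hg hgc, inf_comm] at h1
    rw [hQidx (R.mul_mem hg hh) hgh, inf_comm] at h2
    exact (Nat.eq_of_mul_eq_mul_right hq.out.pos (h1.trans h2.symm)).le
  refine hhD fun x hx hxD ↦ ?_
  have h1 : x ∈ Q ⊓ Subgroup.centralizer {g * h} := heq ▸ ⟨hx, hxD⟩
  have h2 := mem_centralizer_singleton.1 h1.2
  have h3 := (mem_centralizer_singleton.1 hxD).inv_right.mul_right h2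
  rwa [inv_mul_cancel_left] at h3

namespace HallDecomp

variable {N H : Subgroup G} [hNn : N.Normal]

theorem false_of_squarefree (D : HallDecomp s N H) (hv : vcs G = {s}) (hs : Squarefree s)
    (hpp : ¬ IsPrimePow s) (hsol : Group.IsSolvable G) (hco : (Nat.card N).Coprime N.index)
    (hH : ∀ h ∈ H, h ∈ Subgroup.center G) : False := by
  have hN1 : Nat.card N ≠ 1 := by
    intro h1
    rw [Subgroup.card_eq_one] at h1
    obtain ⟨v, hvv⟩ := exists_isVanishing hv
    refine not_isVanishing_of_mem_center ?_ hvv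
    obtain ⟨n, hn, h, hh, rfl⟩ := D.exists_mul v
    rw [h1, Subgroup.mem_bot] at hn
    rw [hn, one_mul]
    exact hH h hh
  set r := (Nat.card N).minFac with hrdef
  have hr := Fact.mk (Nat.minFac_prime hN1)
  have hrN : r ∣ Nat.card N := Nat.minFac_dvd _
  have hrs : r ∣ s := D.dvd r hr.out hrN
  obtain ⟨n, hn⟩ := hsol.solvable
  have hRN : RNilp r N := rNilp_of_vcs hv hs hco (hn ▸ bot_le) fun q hq h ↦
    Nat.minFac_le_of_dvd hq.two_le h
  have hrH : ¬ r ∣ Nat.card H := fun h ↦ hr.out.one_lt.ne' (Nat.eq_one_of_dvd_coprimes D.coprime hrN h)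
  have hord {x h : G} (hh : h ∈ H) : r ∣ orderOf (x * h) ↔ r ∣ orderOf x := by
    have key {x h : G} (hh : h ∈ H) (hx : ¬ r ∣ orderOf x) : ¬ r ∣ orderOf (x * h) := by
      intro hd
      have hc : Commute x h := mem_center_iff_commute.1 (hH h hh) x
      rcases (hr.out.dvd_mul).1 (hd.trans hc.orderOf_mul_dvd_mul_orderOf) with h1 | h1
      · exact hx h1
      · exact hrH (h1.trans (Subgroup.orderOf_dvd_natCard H hh))
    refine ⟨fun h1 ↦ ?_, fun h1 ↦ ?_⟩
    · by_contra hx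
      exact key hh hx h1
    · by_contra hx
      have := key (H.inv_mem hh) hx
      rw [mul_inv_cancel_right] at this
      exact this h1
  have htop : RNilp r (⊤ : Subgroup G) := by
    intro x _ y _ hx hy
    obtain ⟨a, ha, b, hb, rfl⟩ := D.exists_mul x
    obtain ⟨c, hc, d, hd, rfl⟩ := D.exists_mul y
    rw [hord hb] at hx
    rw [hord hd] at hy
    have e : a * b * (c * d) = a * c * (b * d) := by
      rw [mul_assoc, ← mul_assoc b, (mem_center_iff_commute.1 (hH b hb) c).symm.eq]
      group
    rw [e, hord (H.mul_mem hb hd)]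
    exact hRN a ha c hc hx hy
  obtain ⟨q, hq, hqr, hqs⟩ : ∃ q, q.Prime ∧ q ≠ r ∧ q ∣ s := by
    by_contra! hcon
    apply hpp
    have : s = r := by
      obtain ⟨m, hm⟩ := hrs
      have : m = 1 := by
        by_contra hm1
        obtain ⟨q, hq, hqm⟩ := Nat.exists_prime_and_dvd hm1
        by_cases hqr : q = r
        · have := hs r (by rw [hm]; exact mul_dvd_mul_left r (hqr ▸ hqm))
          exact hr.out.one_lt.ne' (Nat.isUnit_iff.1 this)
        · exact hcon q hq hqr (hm ▸ hqm.mul_left r)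
      rw [hm, this, mul_one]
    rw [this]
    exact hr.out.prime.isPrimePow
  have := Fact.mk hq
  exact false_of_rNilp_top hv hs hsol htop hrs hqr hqs

end HallDecomp

end SquarefreeCentral

section Main
set_option linter.unusedSectionVars false
variable {G : Type} [Group G] [Finite G] {s : ℕ}

theorem IsVanishing.of_mul_mem_center {g z : G} (hz : z ∈ Subgroup.center G)
    (h : IsVanishing G (g * z)) : IsVanishing G g := by
  rw [isVanishing_iff] at h ⊢
  obtain ⟨i, hi⟩ := h
  refine ⟨i, ?_⟩
  have h1 : ∀ x, gof x * gof z⁻¹ = gof z⁻¹ * gof x := fun x ↦ by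
    rw [← map_mul, ← map_mul, Subgroup.mem_center_iff.1 (inv_mem hz)]
  have h2 := rho_eq_smul_one h1 i
  have h3 : rho i (gof g) = rho i (gof (g * z)) * rho i (gof z⁻¹) := by
    rw [← map_mul, ← map_mul, mul_inv_cancel_right]
  have h4 : (rho i (gof (g * z))).trace = 0 := hi
  change (rho i (gof g)).trace = 0
  rw [h3, h2, mul_smul_comm, mul_one, Matrix.trace_smul, h4, smul_zero]

theorem exists_isVanishing_of_not_commute (h : ∃ a b : G, a * b ≠ b * a) :
    ∃ g : G, IsVanishing G g := by
  obtain ⟨i, hi⟩ := exists_deg_gt_one h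
  obtain ⟨g, hg⟩ := exists_ch_eq_zero i hi
  exact ⟨g, (isVanishing_iff g).2 ⟨i, hg⟩⟩

/-- The elements whose image in the abelianization is killed by a power of `s`. -/
def powTorsionMod (s : ℕ) (G : Type) [Group G] : Subgroup G where
  carrier := {g | ∃ j, (Abelianization.of g) ^ s ^ j = 1}
  one_mem' := ⟨0, by simp⟩
  mul_mem' := by
    rintro a b ⟨j, hj⟩ ⟨k, hk⟩
    refine ⟨j + k, ?_⟩
    rw [map_mul, mul_pow, pow_add, pow_mul, hj, one_pow, one_mul, mul_comm, pow_mul, hk, one_pow]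
  inv_mem' := by
    rintro a ⟨j, hj⟩
    exact ⟨j, by rw [map_inv, inv_pow, hj, inv_one]⟩

theorem commutator_le_powTorsionMod : commutator G ≤ powTorsionMod s G := by
  intro x hx
  rw [← Abelianization.ker_of, MonoidHom.mem_ker] at hx
  exact ⟨0, by rw [hx, one_pow]⟩

open scoped commutatorElement in
theorem exists_hallDecomp (hv : vcs G = {s}) : ∃ N H : Subgroup G, N.Normal ∧
    commutator G ≤ N ∧ (Nat.card N).Coprime N.index ∧ HallDecomp s N H ∧
    IsHallSubgroup (primesOf s) N ∧ IsHallSubgroup (primesOf s)ᶜ H := by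
  set N := powTorsionMod s G with hNdef
  have hc : commutator G ≤ N := commutator_le_powTorsionMod
  have hnorm : N.Normal := by
    refine ⟨fun n hn g ↦ ?_⟩
    obtain ⟨j, hj⟩ := hn
    exact ⟨j, by rw [map_mul, map_mul, map_inv, mul_inv_cancel_comm, hj]⟩
  obtain ⟨k, hk⟩ := exists_card_commutator_dvd hv
  have hdvd : ∀ p, p.Prime → p ∣ Nat.card N → p ∣ s := by
    intro p hp hpN
    have := Fact.mk hp
    obtain ⟨x, hx⟩ := exists_prime_orderOf_dvd_card' p hpN
    obtain ⟨j, hj⟩ := x.2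
    have h1 : (x : G) ^ s ^ j ∈ commutator G := by
      rw [← Abelianization.ker_of, MonoidHom.mem_ker, map_pow, hj]
    have h2 := pow_card_eq_one_of_mem h1
    rw [← pow_mul] at h2
    have h3 := orderOf_dvd_of_pow_eq_one h2
    rw [Subgroup.orderOf_coe, hx] at h3
    rcases hp.dvd_mul.1 h3 with h | h
    · exact hp.dvd_of_dvd_pow h
    · exact hp.dvd_of_dvd_pow (h.trans hk)
  have hidx : ∀ p, p.Prime → p ∣ N.index → ¬ p ∣ s := by
    intro p hp hpN hps
    have := Fact.mk hp
    rw [Subgroup.index] at hpN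
    obtain ⟨x, hx⟩ := exists_prime_orderOf_dvd_card' p hpN
    obtain ⟨g, rfl⟩ := QuotientGroup.mk_surjective x
    have h1 : g ^ p ∈ N := by
      rw [← QuotientGroup.eq_one_iff, QuotientGroup.mk_pow, ← hx, pow_orderOf_eq_one]
    obtain ⟨j, hj⟩ := h1
    have h2 : g ∈ N := by
      obtain ⟨c, rfl⟩ := hps
      refine ⟨j + 1, ?_⟩
      rw [map_pow] at hj
      rw [pow_succ', mul_assoc, mul_comm c, pow_mul, pow_mul, hj, one_pow]
    rw [(QuotientGroup.eq_one_iff g).2 h2, orderOf_one] at hx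
    exact hp.one_lt.ne hx
  have hco : (Nat.card N).Coprime N.index :=
    Nat.coprime_of_dvd fun p hp h1 h2 ↦ hidx p hp h2 (hdvd p hp h1)
  obtain ⟨H, hH⟩ := Subgroup.exists_right_complement'_of_coprime hco
  have hcard : N.index = Nat.card H := hH.symm.index_eq_card
  have hHidx : H.index = Nat.card N := hH.index_eq_card
  refine ⟨N, H, hnorm, hc, hco, ⟨?_, hH.sup_eq_top, hcard ▸ hco, hdvd, ?_⟩, ?_, ?_⟩
  · intro a ha b hb
    have h1 : ⁅a, b⁆ ∈ N := hc (Subgroup.commutator_mem_commutator (Subgroup.mem_top a) (Subgroup.mem_top b))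
    have h2 : ⁅a, b⁆ ∈ H := by
      rw [commutatorElement_def]
      exact H.mul_mem (H.mul_mem (H.mul_mem ha hb) (H.inv_mem ha)) (H.inv_mem hb)
    exact commutatorElement_eq_one_iff_mul_comm.1 (Subgroup.disjoint_def.1 hH.disjoint h1 h2)
  · exact Nat.coprime_of_dvd fun p hp h1 h2 ↦ hidx p hp (hcard ▸ h2) h1
  · exact ⟨fun p hp h ↦ ⟨hp, hdvd p hp h⟩, fun p hp h h' ↦ hidx p hp h h'.2⟩
  · exact ⟨fun p hp h h' ↦ hidx p hp (hcard ▸ h) h'.2,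
      fun p hp h h' ↦ h' ⟨hp, hdvd p hp (hHidx ▸ h)⟩⟩

theorem hallDecomp_of_isHallSubgroup {N H : Subgroup G} (hN : IsHallSubgroup (primesOf s) N)
    (hH : IsHallSubgroup (primesOf s)ᶜ H) (hab : IsAbelianSubgroup H) (hsup : N ⊔ H = ⊤) :
    HallDecomp s N H where
  abelian := hab
  sup := hsup
  coprime := Nat.coprime_of_dvd fun p hp h1 h2 ↦ hH.1 p hp h2 (hN.1 p hp h1)
  dvd p hp h := (hN.1 p hp h).2
  coprime' := Nat.coprime_of_dvd fun p hp h1 h2 ↦ hH.1 p hp h2 ⟨hp, h1⟩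

theorem vcs_eq_of_classSize (hnc : ∃ a b : G, a * b ≠ b * a)
    (h : ∀ v : G, IsVanishing G v → classSize v = s) : vcs G = {s} := by
  ext n
  constructor
  · rintro ⟨v, hv, rfl⟩
    exact h v hv
  · rintro rfl
    obtain ⟨v, hv⟩ := exists_isVanishing_of_not_commute hnc
    exact ⟨v, hv, h v hv⟩

namespace HallDecomp
variable {N H : Subgroup G} [N.Normal]

theorem vcs_eq_of_cs_eq (D : HallDecomp s N H) (hs : s ≠ 1)
    (hcomm : ∀ h ∈ H, ∀ n ∈ N, Commute h n) (hcs : cs N = {1, s}) : vcs G = {s} := by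
  have hHZ : ∀ h ∈ H, h ∈ Subgroup.center G := fun h hh ↦
    D.mem_center (fun n hn ↦ (hcomm h hh n hn).symm) (fun k hk ↦ D.abelian k hk h hh)
  refine vcs_eq_of_classSize ?_ fun v hv ↦ ?_
  · by_contra! hc
    have h1 : s ∈ cs N := by rw [hcs]; simp
    obtain ⟨x, hx⟩ := h1
    refine hs (hx ▸ classSize_eq_one_iff.2 (Subgroup.mem_center_iff.2 fun g ↦ ?_))
    exact Subtype.ext (hc g x)
  · obtain ⟨n, hn, h, hh, rfl⟩ := D.exists_mul v
    have h1 : IsVanishing G n := hv.of_mul_mem_center (hHZ h hh)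
    have h2 : classSize (n * h) = classSize n := by
      rw [classSize, classSize]
      congr 1
      ext x
      have hxh : Commute x h := mem_center_iff_commute.1 (hHZ h hh) x
      rw [mem_centralizer_singleton, mem_centralizer_singleton]
      refine ⟨fun h3 ↦ ?_, fun h3 ↦ h3.mul_right hxh⟩
      have := h3.mul_right hxh.inv_right
      rwa [mul_inv_cancel_right] at this
    rw [h2]
    have h3 := D.classSize_coe_eq (x := ⟨n, hn⟩) fun k hk ↦ hcomm k hk n hn
    have h4 : classSize (⟨n, hn⟩ : N) ∈ cs N := ⟨_, rfl⟩
    rw [h3, hcs] at h4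
    rcases h4 with h4 | h4
    · exact absurd h1 (not_isVanishing_of_mem_center (classSize_eq_one_iff.1 h4))
    · exact h4

theorem vcs_eq_of_isFrobenius (D : HallDecomp s N H)
    (hF : IsFrobenius (N.map (QuotientGroup.mk' (Subgroup.center G)))
      (H.map (QuotientGroup.mk' (Subgroup.center G))))
    (hcard : Nat.card (N.map (QuotientGroup.mk' (Subgroup.center G))) = s)
    (hV : ∀ x ∈ N, ¬ IsVanishing G x) : vcs G = {s} := by
  set π := QuotientGroup.mk' (Subgroup.center G) with hπ
  have hπs : Function.Surjective π := QuotientGroup.mk'_surjective _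
  have hker : ∀ x, π x = 1 ↔ x ∈ Subgroup.center G := fun x ↦ QuotientGroup.eq_one_iff x
  obtain ⟨⟨hne, -, hNn, hcent⟩, hsup, hinf⟩ := hF
  have hfix : ∀ h ∈ H, h ∉ Subgroup.center G → ∀ n ∈ N.map π, Commute n (π h) → n = 1 := by
    intro h hh hhc n hn hnh
    by_contra hn1
    have h1 := hcent n hn hn1 (mem_centralizer_singleton.2 hnh.symm)
    have h2 : π h ∈ N.map π ⊓ H.map π := ⟨h1, Subgroup.mem_map_of_mem π hh⟩
    rw [hinf, Subgroup.mem_bot, hker] at h2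
    exact hhc h2
  have hcompl : (N.map π).IsComplement' (H.map π) := by
    refine Subgroup.isComplement'_of_disjoint_and_mul_eq_univ (disjoint_iff.2 hinf) ?_
    rw [← Subgroup.normal_mul, hsup, Subgroup.coe_top]
  refine vcs_eq_of_classSize ?_ fun v hv ↦ ?_
  · by_contra! hc
    refine hne ((Subgroup.eq_bot_iff_forall _).2 ?_)
    rintro _ ⟨n, -, rfl⟩
    exact (hker n).2 (Subgroup.mem_center_iff.2 fun g ↦ hc g n)
  obtain ⟨n, hn, h, hh, rfl⟩ := D.exists_mul v
  have hhc : h ∉ Subgroup.center G := fun hhc ↦ hV n hn (hv.of_mul_mem_center hhc)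
  obtain ⟨m, hm, hmh⟩ := exists_conj_mul_of_fixedPointFree (hfix h hh hhc)
    (Subgroup.mem_map_of_mem π hn)
  obtain ⟨m, hmN, rfl⟩ := hm
  have hC : Subgroup.centralizer {n * h} =
      ((H.map π).comap π).map ((MulAut.conj m⁻¹ : G ≃* G) : G →* G) := by
    have hz : (m * (n * h) * m⁻¹) * h⁻¹ ∈ Subgroup.center G := by
      rw [← hker]
      simp only [map_mul, map_inv]
      rw [hmh]; group
    ext x
    have key : ∀ y, Commute y h ↔ π y ∈ H.map π := by
      intro y
      constructor
      · intro hy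
        obtain ⟨a, ha, b, hb, rfl⟩ := D.exists_mul y
        have hbh : Commute b h := D.abelian b hb h hh
        have h1 : Commute a h := by
          have := hy.mul_left hbh.inv_left
          rwa [mul_inv_cancel_right] at this
        have h2 := hfix h hh hhc _ (Subgroup.mem_map_of_mem π ha) (h1.map π)
        rw [map_mul, h2, one_mul]
        exact Subgroup.mem_map_of_mem π hb
      · rintro ⟨b, hb, hby⟩
        have h1 : b⁻¹ * y ∈ Subgroup.center G := by
          rw [← hker, map_mul, map_inv, hby, inv_mul_cancel]
        have hbh : Commute b h := D.abelian b hb h hh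
        have := hbh.mul_left (mem_center_iff_commute.1 h1 h).symm
        rwa [mul_inv_cancel_left] at this
    have h3 : ∀ y, Commute y (m * (n * h) * m⁻¹) ↔ Commute y h := by
      intro y
      have h4 := mem_center_iff_commute.1 hz y
      constructor
      · intro h5
        have h6 := h4.inv_right.mul_right h5
        rwa [mul_inv_rev, inv_inv, inv_mul_cancel_right] at h6
      · intro h5
        have h6 := h4.mul_right h5
        rwa [inv_mul_cancel_right] at h6
    have h5 : x ∈ ((H.map π).comap π).map ((MulAut.conj m⁻¹ : G ≃* G) : G →* G) ↔
        (MulAut.conj m⁻¹).symm x ∈ (H.map π).comap π := Subgroup.mem_map_equiv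
    rw [mem_centralizer_singleton, h5, Subgroup.mem_comap, ← key, ← h3]
    have h4 : (MulAut.conj m⁻¹).symm x = m * x * m⁻¹ := by
      simp
    rw [h4]
    exact (Commute.conj_iff m).symm
  rw [classSize, hC, Subgroup.index_map_equiv, Subgroup.index_comap_of_surjective _ hπs,
    hcompl.index_eq_card, hcard]

end HallDecomp

end Main

/-- Theorem A: for `s` a prime power or square-free, `vcs(G) = {s}` iff `G = NH`
with `N` a normal Hall `π(s)`-subgroup, `H` an abelian `π(s)`-complement, and
either (a) `s` is a prime power, `G = N × H` and `cs(N) = {1, s}`, or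
(b) `G/Z(G)` is Frobenius with kernel `NZ(G)/Z(G)` of order `s`, complement
`HZ(G)/Z(G)`, and `N` contains no vanishing elements of `G`. -/
theorem statement0 (G : Type) [Group G] [Finite G] (s : ℕ) (hs : 0 < s)
    (hsp : IsPrimePow s ∨ Squarefree s) :
    vcs G = {s} ↔
      ∃ N H : Subgroup G, N.Normal ∧ IsHallSubgroup (primesOf s) N ∧
        IsHallSubgroup (primesOf s)ᶜ H ∧ IsAbelianSubgroup H ∧ N ⊔ H = ⊤ ∧
        ((IsPrimePow s ∧ (∀ h ∈ H, ∀ n ∈ N, Commute h n) ∧ cs ↥N = {1, s}) ∨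
         (IsFrobenius (N.map (QuotientGroup.mk' (Subgroup.center G)))
            (H.map (QuotientGroup.mk' (Subgroup.center G))) ∧
          Nat.card (N.map (QuotientGroup.mk' (Subgroup.center G))) = s ∧
          ∀ x ∈ N, ¬ IsVanishing G x)) := by
  constructor
  · intro hv
    obtain ⟨N, H, hN, hc, hco, D, hNH, hHH⟩ := exists_hallDecomp hv
    refine ⟨N, H, hN, hNH, hHH, D.abelian, D.sup, ?_⟩
    by_cases hpp : IsPrimePow s
    · have hnil : Group.IsNilpotent N := by
        obtain ⟨p, k, hp, -, rfl⟩ := (isPrimePow_nat_iff _).1 hpp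
        have := Fact.mk hp
        have h1 : Nat.card N = p ^ (Nat.card N).primeFactorsList.length :=
          Nat.eq_prime_pow_of_unique_prime_dvd Nat.card_pos.ne' fun {q} hq hqN ↦
            (Nat.prime_dvd_prime_iff_eq hq hp).1 (hq.dvd_of_dvd_pow (D.dvd q hq hqN))
        exact (IsPGroup.of_card h1).isNilpotent
      by_cases hH : ∀ h ∈ H, h ∈ Subgroup.center G
      · exact Or.inl ⟨hpp, fun h hh n _ ↦ (mem_center_iff_commute.1 (hH h hh) n).symm,
          D.cs_eq hv hnil hH⟩
      · push Not at hH
        obtain ⟨h, hh, hhc⟩ := hH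
        obtain ⟨⟨h1, h2⟩, h3⟩ := D.isFrobenius_of_isNilpotent hv hnil hh hhc
        exact Or.inr ⟨h1, h2, h3⟩
    · have hsf := hsp.resolve_left hpp
      have hsol : Group.IsSolvable G :=
        isSolvable_of_vcs hv hsf _ N le_rfl hco 1 (by rwa [derivedSeries_one])
      by_cases hH : ∀ h ∈ H, h ∈ Subgroup.center G
      · exact (D.false_of_squarefree hv hsf hpp hsol hco hH).elim
      · push Not at hH
        obtain ⟨h, hh, hhc⟩ := hH
        obtain ⟨⟨h1, h2⟩, h3⟩ := D.isFrobenius_of_squarefree hv hsf hsol hco hh hhc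
        exact Or.inr ⟨h1, h2, h3⟩
  · rintro ⟨N, H, hN, hNH, hHH, hab, hsup, h⟩
    have D := hallDecomp_of_isHallSubgroup hNH hHH hab hsup
    rcases h with ⟨hpp, hcomm, hcs⟩ | ⟨hF, hcard, hV⟩
    · exact D.vcs_eq_of_cs_eq hpp.one_lt.ne' hcomm hcs
    · exact D.vcs_eq_of_isFrobenius hF hcard hV
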